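/- Suppose T is Σ1-ill and m ≥ 1. Then there exists a Σ1 provability predicate PR_T(x) of T such that PL(PR_T) = N⁺A_{m,0}. -/

import Mathlib

namespace PLN

/-! ### Modal formulas and the logics N⁺A_{m,n} -/

/-- Formulas of modal propositional logic. -/
inductive MFml : Type
  | var : ℕ → MFml
  | bot : MFml
  | neg : MFml → MFml
  | and : MFml → MFml → MFml
  | or : MFml → MFml → MFml
  | imp : MFml → MFml → MFml
  | box : MFml → MFml
  deriving DecidableEq

/-- `boxIter n A` is `□ⁿ A`, where `□⁰ A = A` and `□^(k+1) A = □ (□ᵏ A)`. -/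
def boxIter : ℕ → MFml → MFml
  | 0, A => A
  | k + 1, A => .box (boxIter k A)

/-- Evaluation of a modal formula under a valuation of its "propositional atoms"
(propositional variables, and boxed formulas); used to define propositional tautologies
in the modal language. -/
def MFml.evalTC (v : MFml → Prop) : MFml → Prop
  | .bot => False
  | .neg A => ¬ A.evalTC v
  | .and A B => A.evalTC v ∧ B.evalTC v
  | .or A B => A.evalTC v ∨ B.evalTC v
  | .imp A B => A.evalTC v → B.evalTC v
  | A => v A

/-- Propositional tautologies in the modal language. -/
def MTaut (A : MFml) : Prop := ∀ v, A.evalTC v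

/-- Provability in the logic `N⁺A_{m,n}`: the pure logic of necessitation `N`
(propositional tautologies, modus ponens, necessitation) together with the axiom scheme
`□ⁿA → □ᵐA` and the rule `Ros□` (from `¬□A` infer `¬□□A`). -/
inductive NAProves (m n : ℕ) : MFml → Prop
  | taut {A} : MTaut A → NAProves m n A
  | acc (A) : NAProves m n (.imp (boxIter n A) (boxIter m A))
  | mp {A B} : NAProves m n (.imp A B) → NAProves m n A → NAProves m n B
  | nec {A} : NAProves m n A → NAProves m n (.box A)
  | ros {A} : NAProves m n (.neg (.box A)) → NAProves m n (.neg (.box (.box A)))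

/-- `IsSub B A` : `B` is a subformula of `A`. -/
inductive IsSub : MFml → MFml → Prop
  | refl (A) : IsSub A A
  | neg {B A} : IsSub B A → IsSub B (.neg A)
  | andL {B A C} : IsSub B A → IsSub B (.and A C)
  | andR {B A C} : IsSub B C → IsSub B (.and A C)
  | orL {B A C} : IsSub B A → IsSub B (.or A C)
  | orR {B A C} : IsSub B C → IsSub B (.or A C)
  | impL {B A C} : IsSub B A → IsSub B (.imp A C)
  | impR {B A C} : IsSub B C → IsSub B (.imp A C)
  | box {B A} : IsSub B A → IsSub B (.box A)

/-! ### N-frames and N-models -/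

/-- An N-model on a set `W` of worlds: an N-frame (a binary relation `≺_B` on `W`
for each modal formula `B`) together with a valuation of propositional variables. -/
structure NModel (W : Type) where
  rel : MFml → W → W → Prop
  val : W → ℕ → Prop

/-- The forcing relation of an N-model:
`x ⊩ □B` iff every `y` with `x ≺_B y` satisfies `y ⊩ B`. -/
def NModel.Forces {W : Type} (M : NModel W) : W → MFml → Prop
  | x, .var p => M.val x p
  | _, .bot => False
  | x, .neg A => ¬ NModel.Forces M x A
  | x, .and A B => NModel.Forces M x A ∧ NModel.Forces M x B
  | x, .or A B => NModel.Forces M x A ∨ NModel.Forces M x B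
  | x, .imp A B => NModel.Forces M x A → NModel.Forces M x B
  | x, .box A => ∀ y, M.rel A x y → NModel.Forces M y A

/-- The relations `≺_B^k` : `x ≺_B^0 y` iff `x = y`, and
`x ≺_B^(k+1) y` iff `∃ w, x ≺_{□ᵏB} w` and `w ≺_B^k y`. -/
def NModel.relIter {W : Type} (M : NModel W) (B : MFml) : ℕ → W → W → Prop
  | 0, x, y => x = y
  | k + 1, x, y => ∃ w, M.rel (boxIter k B) x w ∧ NModel.relIter M B k w y

/-- `(m,n)`-accessibility of (the frame of) an N-model. -/
def NModel.Accessible {W : Type} (M : NModel W) (m n : ℕ) : Prop :=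
  ∀ (B : MFml) (x y : W), NModel.relIter M B m x y → NModel.relIter M B n x y

/-! ### The language of first-order arithmetic -/

/-- Terms of the language of arithmetic, with de Bruijn variables. -/
inductive ATerm : Type
  | var : ℕ → ATerm
  | zero : ATerm
  | succ : ATerm → ATerm
  | add : ATerm → ATerm → ATerm
  | mul : ATerm → ATerm → ATerm
  deriving DecidableEq

/-- Formulas of the language of arithmetic (with `≤` primitive), de Bruijn variables. -/
inductive AFml : Type
  | eq : ATerm → ATerm → AFml
  | le : ATerm → ATerm → AFml
  | neg : AFml → AFml
  | and : AFml → AFml → AFml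
  | or : AFml → AFml → AFml
  | imp : AFml → AFml → AFml
  | all : AFml → AFml
  | ex : AFml → AFml
  deriving DecidableEq

/-- Lift (shift up by one) the variables `≥ c` of a term. -/
def ATerm.lift (c : ℕ) : ATerm → ATerm
  | .var n => .var (if n < c then n else n + 1)
  | .zero => .zero
  | .succ t => .succ (t.lift c)
  | .add t s => .add (t.lift c) (s.lift c)
  | .mul t s => .mul (t.lift c) (s.lift c)

/-- Simultaneous substitution in terms. -/
def ATerm.substAll (σ : ℕ → ATerm) : ATerm → ATerm
  | .var n => σ n
  | .zero => .zero
  | .succ t => .succ (t.substAll σ)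
  | .add t s => .add (t.substAll σ) (s.substAll σ)
  | .mul t s => .mul (t.substAll σ) (s.substAll σ)

/-- Pushing a substitution under a binder. -/
def liftSub (σ : ℕ → ATerm) : ℕ → ATerm
  | 0 => .var 0
  | n + 1 => (σ n).lift 0

/-- Lift (shift up by one) the free variables `≥ c` of a formula. -/
def AFml.lift (c : ℕ) : AFml → AFml
  | .eq t s => .eq (t.lift c) (s.lift c)
  | .le t s => .le (t.lift c) (s.lift c)
  | .neg φ => .neg (φ.lift c)
  | .and φ ψ => .and (φ.lift c) (ψ.lift c)
  | .or φ ψ => .or (φ.lift c) (ψ.lift c)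
  | .imp φ ψ => .imp (φ.lift c) (ψ.lift c)
  | .all φ => .all (φ.lift (c + 1))
  | .ex φ => .ex (φ.lift (c + 1))

/-- Simultaneous (capture-avoiding) substitution in formulas. -/
def AFml.substAll (σ : ℕ → ATerm) : AFml → AFml
  | .eq t s => .eq (t.substAll σ) (s.substAll σ)
  | .le t s => .le (t.substAll σ) (s.substAll σ)
  | .neg φ => .neg (φ.substAll σ)
  | .and φ ψ => .and (φ.substAll σ) (ψ.substAll σ)
  | .or φ ψ => .or (φ.substAll σ) (ψ.substAll σ)
  | .imp φ ψ => .imp (φ.substAll σ) (ψ.substAll σ)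
  | .all φ => .all (φ.substAll (liftSub σ))
  | .ex φ => .ex (φ.substAll (liftSub σ))

def subst0Env (t : ATerm) : ℕ → ATerm
  | 0 => t
  | n + 1 => .var n

def subst2Env (t s : ATerm) : ℕ → ATerm
  | 0 => t
  | 1 => s
  | n + 2 => .var n

/-- Substitute the term `t` for the free variable `0` (decrementing other variables). -/
def AFml.subst0 (φ : AFml) (t : ATerm) : AFml := φ.substAll (subst0Env t)

/-- Substitute the terms `t`, `s` for the free variables `0`, `1` simultaneously. -/
def AFml.subst2 (φ : AFml) (t s : ATerm) : AFml := φ.substAll (subst2Env t s)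

/-- Substitute `S(var 0)` for `var 0`, leaving all other free variables unchanged. -/
def succSubst (φ : AFml) : AFml :=
  φ.substAll fun n => if n = 0 then .succ (.var 0) else .var n

/-- All variables of a term are `< c`. -/
def ATerm.FreeLt (c : ℕ) : ATerm → Prop
  | .var n => n < c
  | .zero => True
  | .succ t => t.FreeLt c
  | .add t s => t.FreeLt c ∧ s.FreeLt c
  | .mul t s => t.FreeLt c ∧ s.FreeLt c

/-- All free variables of a formula are `< c`; `FreeLt 0 φ` says that `φ` is a sentence. -/
def AFml.FreeLt (c : ℕ) : AFml → Prop
  | .eq t s => t.FreeLt c ∧ s.FreeLt c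
  | .le t s => t.FreeLt c ∧ s.FreeLt c
  | .neg φ => φ.FreeLt c
  | .and φ ψ => φ.FreeLt c ∧ ψ.FreeLt c
  | .or φ ψ => φ.FreeLt c ∧ ψ.FreeLt c
  | .imp φ ψ => φ.FreeLt c ∧ ψ.FreeLt c
  | .all φ => φ.FreeLt (c + 1)
  | .ex φ => φ.FreeLt (c + 1)

/-- The numeral `n̄`. -/
def numeral : ℕ → ATerm
  | 0 => .zero
  | n + 1 => .succ (numeral n)

/-- A Gödel numbering of terms. -/
def ATerm.code : ATerm → ℕ
  | .var n => Nat.pair 0 n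
  | .zero => Nat.pair 1 0
  | .succ t => Nat.pair 2 t.code
  | .add t s => Nat.pair 3 (Nat.pair t.code s.code)
  | .mul t s => Nat.pair 4 (Nat.pair t.code s.code)

/-- A Gödel numbering of formulas. -/
def AFml.code : AFml → ℕ
  | .eq t s => Nat.pair 0 (Nat.pair t.code s.code)
  | .le t s => Nat.pair 1 (Nat.pair t.code s.code)
  | .neg φ => Nat.pair 2 φ.code
  | .and φ ψ => Nat.pair 3 (Nat.pair φ.code ψ.code)
  | .or φ ψ => Nat.pair 4 (Nat.pair φ.code ψ.code)
  | .imp φ ψ => Nat.pair 5 (Nat.pair φ.code ψ.code)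
  | .all φ => Nat.pair 6 φ.code
  | .ex φ => Nat.pair 7 φ.code

/-- `⌜φ⌝`, the numeral of the Gödel number of `φ`. -/
def gnum (φ : AFml) : ATerm := numeral φ.code

/-- For a formula `P(x)` (with free variable `var 0`), `P.appNum φ` is `P(⌜φ⌝)`. -/
def AFml.appNum (P φ : AFml) : AFml := P.subst0 (gnum φ)

/-- Iterated application of a predicate: `iterPred P k φ = P(⌜P(⌜⋯P(⌜φ⌝)⋯⌝)⌝)` (`k` times). -/
def iterPred (P : AFml) : ℕ → AFml → AFml
  | 0, φ => φ
  | k + 1, φ => P.appNum (iterPred P k φ)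

/-! ### Satisfaction in the standard model -/

def ATerm.val (ρ : ℕ → ℕ) : ATerm → ℕ
  | .var n => ρ n
  | .zero => 0
  | .succ t => t.val ρ + 1
  | .add t s => t.val ρ + s.val ρ
  | .mul t s => t.val ρ * s.val ρ

def consEnv (a : ℕ) (ρ : ℕ → ℕ) : ℕ → ℕ
  | 0 => a
  | n + 1 => ρ n

/-- Satisfaction in the standard model `ℕ` under an environment `ρ`. -/
def AFml.Sat (ρ : ℕ → ℕ) : AFml → Prop
  | .eq t s => t.val ρ = s.val ρ
  | .le t s => t.val ρ ≤ s.val ρ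
  | .neg φ => ¬ φ.Sat ρ
  | .and φ ψ => φ.Sat ρ ∧ ψ.Sat ρ
  | .or φ ψ => φ.Sat ρ ∨ ψ.Sat ρ
  | .imp φ ψ => φ.Sat ρ → ψ.Sat ρ
  | .all φ => ∀ a, φ.Sat (consEnv a ρ)
  | .ex φ => ∃ a, φ.Sat (consEnv a ρ)

/-- `ℕ ⊨ φ`. -/
def TrueN (φ : AFml) : Prop := φ.Sat fun _ => 0

/-! ### The arithmetical hierarchy: Δ₀, Σ₁, Π₁ -/

/-- `Δ₀` formulas: every quantifier is bounded. -/
inductive IsDelta0 : AFml → Prop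
  | eq (t s : ATerm) : IsDelta0 (.eq t s)
  | le (t s : ATerm) : IsDelta0 (.le t s)
  | neg {φ} : IsDelta0 φ → IsDelta0 (.neg φ)
  | and {φ ψ} : IsDelta0 φ → IsDelta0 ψ → IsDelta0 (.and φ ψ)
  | or {φ ψ} : IsDelta0 φ → IsDelta0 ψ → IsDelta0 (.or φ ψ)
  | imp {φ ψ} : IsDelta0 φ → IsDelta0 ψ → IsDelta0 (.imp φ ψ)
  | ball {φ : AFml} (t : ATerm) : IsDelta0 φ → IsDelta0 (.all (.imp (.le (.var 0) (ATerm.lift 0 t)) φ))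
  | bex {φ : AFml} (t : ATerm) : IsDelta0 φ → IsDelta0 (.ex (.and (.le (.var 0) (ATerm.lift 0 t)) φ))

mutual
  /-- `Σ₁` formulas. -/
  inductive IsSigma1 : AFml → Prop
    | delta0 {φ} : IsDelta0 φ → IsSigma1 φ
    | and {φ ψ} : IsSigma1 φ → IsSigma1 ψ → IsSigma1 (.and φ ψ)
    | or {φ ψ} : IsSigma1 φ → IsSigma1 ψ → IsSigma1 (.or φ ψ)
    | ex {φ} : IsSigma1 φ → IsSigma1 (.ex φ)
    | negPi {φ} : IsPi1 φ → IsSigma1 (.neg φ)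
    | impPiSigma {φ ψ} : IsPi1 φ → IsSigma1 ψ → IsSigma1 (.imp φ ψ)
  /-- `Π₁` formulas. -/
  inductive IsPi1 : AFml → Prop
    | delta0 {φ} : IsDelta0 φ → IsPi1 φ
    | and {φ ψ} : IsPi1 φ → IsPi1 ψ → IsPi1 (.and φ ψ)
    | or {φ ψ} : IsPi1 φ → IsPi1 ψ → IsPi1 (.or φ ψ)
    | all {φ} : IsPi1 φ → IsPi1 (.all φ)
    | negSigma {φ} : IsSigma1 φ → IsPi1 (.neg φ)
    | impSigmaPi {φ ψ} : IsSigma1 φ → IsPi1 ψ → IsPi1 (.imp φ ψ)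
end

/-! ### A Hilbert-style proof system for first-order arithmetic -/

/-- Evaluation of an arithmetical formula under a valuation of its "propositionally atomic"
subformulas (atomic or quantified formulas); used for propositional tautologies and
tautological consequence. -/
def AFml.evalProp (v : AFml → Prop) : AFml → Prop
  | .neg φ => ¬ φ.evalProp v
  | .and φ ψ => φ.evalProp v ∧ ψ.evalProp v
  | .or φ ψ => φ.evalProp v ∨ ψ.evalProp v
  | .imp φ ψ => φ.evalProp v → ψ.evalProp v
  | φ => v φ

/-- Propositional tautologies in the language of arithmetic. -/
def ATaut (φ : AFml) : Prop := ∀ v, φ.evalProp v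

/-- `φ` is a tautological consequence of the set `X` of formulas. -/
def TC (X : Set AFml) (φ : AFml) : Prop :=
  ∀ v : AFml → Prop, (∀ ψ ∈ X, ψ.evalProp v) → φ.evalProp v

def iffF (φ ψ : AFml) : AFml := .and (.imp φ ψ) (.imp ψ φ)

/-- Hilbert-style provability from the set of axioms `Γ` in classical first-order
logic with equality. -/
inductive Proves (Γ : Set AFml) : AFml → Prop
  | ax {φ} : φ ∈ Γ → Proves Γ φ
  | taut {φ} : ATaut φ → Proves Γ φ
  | mp {φ ψ} : Proves Γ (.imp φ ψ) → Proves Γ φ → Proves Γ ψ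
  | allE (φ : AFml) (t : ATerm) : Proves Γ (.imp (.all φ) (φ.subst0 t))
  | exI (φ : AFml) (t : ATerm) : Proves Γ (.imp (φ.subst0 t) (.ex φ))
  | allImp (φ ψ : AFml) : Proves Γ (.imp (.all (.imp φ ψ)) (.imp (.all φ) (.all ψ)))
  | vacAll (φ : AFml) : Proves Γ (.imp φ (.all (AFml.lift 0 φ)))
  | exDef (φ : AFml) : Proves Γ (iffF (.ex φ) (.neg (.all (.neg φ))))
  | gen {φ} : Proves Γ φ → Proves Γ (.all φ)
  | eqRefl (t : ATerm) : Proves Γ (.eq t t)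
  | eqSubst (φ : AFml) (t s : ATerm) : Proves Γ (.imp (.eq t s) (.imp (φ.subst0 t) (φ.subst0 s)))

/-! ### Peano arithmetic -/

/-- The axioms of Peano arithmetic. -/
inductive PAax : AFml → Prop
  | succNeZero : PAax (.all (.neg (.eq (.succ (.var 0)) .zero)))
  | succInj :
      PAax (.all (.all (.imp (.eq (.succ (.var 1)) (.succ (.var 0))) (.eq (.var 1) (.var 0)))))
  | addZero : PAax (.all (.eq (.add (.var 0) .zero) (.var 0)))
  | addSucc :
      PAax (.all (.all (.eq (.add (.var 1) (.succ (.var 0))) (.succ (.add (.var 1) (.var 0))))))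
  | mulZero : PAax (.all (.eq (.mul (.var 0) .zero) .zero))
  | mulSucc :
      PAax (.all (.all (.eq (.mul (.var 1) (.succ (.var 0)))
        (.add (.mul (.var 1) (.var 0)) (.var 1)))))
  | leDef :
      PAax (.all (.all (iffF (.le (.var 1) (.var 0))
        (.ex (.eq (.add (.var 0) (.var 2)) (.var 1))))))
  | ind (φ : AFml) :
      PAax (.imp (.and (φ.subst0 .zero) (.all (.imp φ (succSubst φ)))) (.all φ))

/-- Peano arithmetic, as a set of axioms. -/
def PA : Set AFml := {φ | PAax φ}

/-- The sentence `0 = 1`. -/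
def botFml : AFml := .eq .zero (.succ .zero)

/-- `t < s`, as the formula `S(t) ≤ s`. -/
def ltF (t s : ATerm) : AFml := .le (.succ t) s

/-- `Δ₁(PA)` formulas: `Σ₁` formulas which are `PA`-provably equivalent to a `Π₁` formula. -/
def IsDelta1PA (φ : AFml) : Prop :=
  IsSigma1 φ ∧ ∃ ψ, IsPi1 ψ ∧ Proves PA (iffF φ ψ)

/-! ### Theories, provability predicates, arithmetical interpretations -/

/-- `Tax` is primitive recursively axiomatized (via the Gödel numbering). -/
def PrAxiomatized (Tax : Set AFml) : Prop :=
  ∃ p : ℕ → Bool, Primrec p ∧ ∀ φ : AFml, φ ∈ Tax ↔ p φ.code = true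

/-- `Σ₁`-soundness: every `T`-provable `Σ₁` sentence is true in `ℕ`. -/
def Sigma1Sound (Tax : Set AFml) : Prop :=
  ∀ φ : AFml, IsSigma1 φ → φ.FreeLt 0 → Proves Tax φ → TrueN φ

/-- `P` is a provability predicate of `T`: a formula `P(x)` with at most the free
variable `x` such that for every formula `φ`, `T ⊢ φ` iff `PA ⊢ P(⌜φ⌝)`. -/
def IsProvPred (Tax : Set AFml) (P : AFml) : Prop :=
  P.FreeLt 1 ∧ ∀ φ : AFml, Proves Tax φ ↔ Proves PA (P.appNum φ)

/-- `f` is an arithmetical interpretation based on the predicate `P`. -/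
def IsInterp (P : AFml) (f : MFml → AFml) : Prop :=
  (∀ i, (f (.var i)).FreeLt 0) ∧
  f .bot = botFml ∧
  (∀ A, f (.neg A) = .neg (f A)) ∧
  (∀ A B, f (.and A B) = .and (f A) (f B)) ∧
  (∀ A B, f (.or A B) = .or (f A) (f B)) ∧
  (∀ A B, f (.imp A B) = .imp (f A) (f B)) ∧
  (∀ A, f (.box A) = P.appNum (f A))

/-- The provability logic of the predicate `P` (relative to the theory `Tax`). -/
def PL (Tax : Set AFml) (P : AFml) : Set MFml :=
  {A | ∀ f : MFml → AFml, IsInterp P f → Proves Tax (f A)}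

/-- The formulas with a `T`-proof of code `≤ s` (relative to a proof enumeration `prf`). -/
def PTset (prf : ℕ → Option AFml) (s : ℕ) : Set AFml :=
  {φ | ∃ y ≤ s, prf y = some φ}



/-! ### Substitution algebra -/

theorem ATerm.lift0_substAll (τ : ℕ → ATerm) (t : ATerm) :
    (t.lift 0).substAll (liftSub τ) = (t.substAll τ).lift 0 := by
  induction t with
  | var n => simp [ATerm.lift, ATerm.substAll, liftSub]
  | zero => rfl
  | succ t ih => simp [ATerm.lift, ATerm.substAll, ih]
  | add t s ih1 ih2 => simp [ATerm.lift, ATerm.substAll, ih1, ih2]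
  | mul t s ih1 ih2 => simp [ATerm.lift, ATerm.substAll, ih1, ih2]

theorem ATerm.substAll_comp (σ τ : ℕ → ATerm) (t : ATerm) :
    (t.substAll σ).substAll τ = t.substAll (fun n => (σ n).substAll τ) := by
  induction t with
  | var n => rfl
  | zero => rfl
  | succ t ih => simp [ATerm.substAll, ih]
  | add t s ih1 ih2 => simp [ATerm.substAll, ih1, ih2]
  | mul t s ih1 ih2 => simp [ATerm.substAll, ih1, ih2]

theorem liftSub_comp (σ τ : ℕ → ATerm) :
    (fun n => (liftSub σ n).substAll (liftSub τ)) = liftSub (fun n => (σ n).substAll τ) := by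
  funext n
  cases n with
  | zero => rfl
  | succ n => simp [liftSub, ATerm.lift0_substAll]

theorem AFml.substAll_comp (φ : AFml) : ∀ σ τ : ℕ → ATerm,
    (φ.substAll σ).substAll τ = φ.substAll (fun n => (σ n).substAll τ) := by
  induction φ with
  | eq t s => intro σ τ; simp [AFml.substAll, ATerm.substAll_comp]
  | le t s => intro σ τ; simp [AFml.substAll, ATerm.substAll_comp]
  | neg φ ih => intro σ τ; simp [AFml.substAll, ih]
  | and φ ψ ih1 ih2 => intro σ τ; simp [AFml.substAll, ih1, ih2]
  | or φ ψ ih1 ih2 => intro σ τ; simp [AFml.substAll, ih1, ih2]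
  | imp φ ψ ih1 ih2 => intro σ τ; simp [AFml.substAll, ih1, ih2]
  | all φ ih => intro σ τ; simp [AFml.substAll, ih, liftSub_comp]
  | ex φ ih => intro σ τ; simp [AFml.substAll, ih, liftSub_comp]

theorem ATerm.substAll_var (t : ATerm) : t.substAll ATerm.var = t := by
  induction t <;> simp_all [ATerm.substAll]

theorem liftSub_var : liftSub ATerm.var = ATerm.var := by
  funext n; cases n <;> simp [liftSub, ATerm.lift]

theorem AFml.substAll_var (φ : AFml) : φ.substAll ATerm.var = φ := by
  induction φ <;> simp_all [AFml.substAll, ATerm.substAll_var, liftSub_var]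

/-- The renaming that lifts variables `≥ c`. -/
def ren (c : ℕ) : ℕ → ATerm := fun n => .var (if n < c then n else n + 1)

theorem liftSub_ren (c : ℕ) : liftSub (ren c) = ren (c + 1) := by
  funext n
  cases n with
  | zero => simp [liftSub, ren]
  | succ n => by_cases h : n < c <;> simp [liftSub, ren, ATerm.lift, h]

theorem ATerm.lift_eq (c : ℕ) (t : ATerm) : t.lift c = t.substAll (ren c) := by
  induction t <;> simp_all [ATerm.lift, ATerm.substAll, ren]

theorem AFml.lift_eq (φ : AFml) : ∀ c : ℕ, φ.lift c = φ.substAll (ren c) := by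
  induction φ <;> intro c <;>
    simp_all [AFml.lift, AFml.substAll, ATerm.lift_eq, liftSub_ren]

theorem ren_zero : ren 0 = fun n => ATerm.var (n + 1) := by
  funext n; simp [ren]

/-- cons on substitutions -/
def scons (t : ATerm) (σ : ℕ → ATerm) : ℕ → ATerm
  | 0 => t
  | n + 1 => σ n

theorem subst0Env_eq (t : ATerm) : subst0Env t = scons t ATerm.var := by
  funext n; cases n <;> rfl

theorem ATerm.lift0_subst_scons (t s : ATerm) (σ : ℕ → ATerm) :
    (t.lift 0).substAll (scons s σ) = t.substAll σ := by
  rw [ATerm.lift_eq, ATerm.substAll_comp]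
  congr 1

theorem liftSub_scons (σ : ℕ → ATerm) (t : ATerm) (τ : ℕ → ATerm):
    (fun n => (liftSub σ n).substAll (scons t τ)) = scons t (fun n => (σ n).substAll τ) := by
  funext n
  cases n with
  | zero => rfl
  | succ n => simp [liftSub, ATerm.lift0_subst_scons, scons]

theorem AFml.substAll_liftSub_subst0 (φ : AFml) (σ : ℕ → ATerm) (t : ATerm) :
    (φ.substAll (liftSub σ)).subst0 t = φ.substAll (scons t σ) := by
  rw [AFml.subst0, AFml.substAll_comp, subst0Env_eq, liftSub_scons]
  simp [ATerm.substAll_var]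

theorem AFml.subst0_substAll (φ : AFml) (σ : ℕ → ATerm) (t : ATerm) :
    (φ.subst0 t).substAll σ = φ.substAll (scons (t.substAll σ) σ) := by
  rw [AFml.subst0, AFml.substAll_comp, subst0Env_eq]
  congr 1
  funext n; cases n <;> rfl

theorem AFml.lift0_subst0 (φ : AFml) (t : ATerm) : (φ.lift 0).subst0 t = φ := by
  rw [AFml.subst0, AFml.lift_eq, AFml.substAll_comp, ren_zero]
  exact AFml.substAll_var φ

/-! ### Free variables -/

theorem ATerm.FreeLt.mono {c d : ℕ} (h : c ≤ d) (t : ATerm) : t.FreeLt c → t.FreeLt d := by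
  induction t <;> simp_all [ATerm.FreeLt] <;> omega

theorem AFml.FreeLt.mono (φ : AFml) : ∀ {c d : ℕ}, c ≤ d → φ.FreeLt c → φ.FreeLt d := by
  induction φ with
  | eq t s => intro c d h hf; exact ⟨ATerm.FreeLt.mono h _ hf.1, ATerm.FreeLt.mono h _ hf.2⟩
  | le t s => intro c d h hf; exact ⟨ATerm.FreeLt.mono h _ hf.1, ATerm.FreeLt.mono h _ hf.2⟩
  | neg φ ih => intro c d h hf; exact ih h hf
  | and φ ψ ih1 ih2 => intro c d h hf; exact ⟨ih1 h hf.1, ih2 h hf.2⟩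
  | or φ ψ ih1 ih2 => intro c d h hf; exact ⟨ih1 h hf.1, ih2 h hf.2⟩
  | imp φ ψ ih1 ih2 => intro c d h hf; exact ⟨ih1 h hf.1, ih2 h hf.2⟩
  | all φ ih => intro c d h hf; exact ih (Nat.succ_le_succ h) hf
  | ex φ ih => intro c d h hf; exact ih (Nat.succ_le_succ h) hf

theorem ATerm.exists_freeLt (t : ATerm) : ∃ c, t.FreeLt c := by
  induction t with
  | var n => exact ⟨n + 1, Nat.lt_succ_self n⟩
  | zero => exact ⟨0, trivial⟩
  | succ t ih => exact ih
  | add t s ih1 ih2 =>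
    obtain ⟨a, ha⟩ := ih1; obtain ⟨b, hb⟩ := ih2
    exact ⟨max a b, ATerm.FreeLt.mono (le_max_left _ _) _ ha, ATerm.FreeLt.mono (le_max_right _ _) _ hb⟩
  | mul t s ih1 ih2 =>
    obtain ⟨a, ha⟩ := ih1; obtain ⟨b, hb⟩ := ih2
    exact ⟨max a b, ATerm.FreeLt.mono (le_max_left _ _) _ ha, ATerm.FreeLt.mono (le_max_right _ _) _ hb⟩

theorem AFml.exists_freeLt (φ : AFml) : ∃ c, φ.FreeLt c := by
  induction φ with
  | eq t s =>
    obtain ⟨a, ha⟩ := t.exists_freeLt; obtain ⟨b, hb⟩ := s.exists_freeLt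
    exact ⟨max a b, ATerm.FreeLt.mono (le_max_left _ _) _ ha, ATerm.FreeLt.mono (le_max_right _ _) _ hb⟩
  | le t s =>
    obtain ⟨a, ha⟩ := t.exists_freeLt; obtain ⟨b, hb⟩ := s.exists_freeLt
    exact ⟨max a b, ATerm.FreeLt.mono (le_max_left _ _) _ ha, ATerm.FreeLt.mono (le_max_right _ _) _ hb⟩
  | neg φ ih => exact ih
  | and φ ψ ih1 ih2 =>
    obtain ⟨a, ha⟩ := ih1; obtain ⟨b, hb⟩ := ih2
    exact ⟨max a b, AFml.FreeLt.mono _ (le_max_left _ _) ha, AFml.FreeLt.mono _ (le_max_right _ _) hb⟩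
  | or φ ψ ih1 ih2 =>
    obtain ⟨a, ha⟩ := ih1; obtain ⟨b, hb⟩ := ih2
    exact ⟨max a b, AFml.FreeLt.mono _ (le_max_left _ _) ha, AFml.FreeLt.mono _ (le_max_right _ _) hb⟩
  | imp φ ψ ih1 ih2 =>
    obtain ⟨a, ha⟩ := ih1; obtain ⟨b, hb⟩ := ih2
    exact ⟨max a b, AFml.FreeLt.mono _ (le_max_left _ _) ha, AFml.FreeLt.mono _ (le_max_right _ _) hb⟩
  | all φ ih =>
    obtain ⟨a, ha⟩ := ih
    exact ⟨a, (AFml.FreeLt.mono φ (Nat.le_succ a) ha : φ.FreeLt (a + 1))⟩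
  | ex φ ih =>
    obtain ⟨a, ha⟩ := ih
    exact ⟨a, (AFml.FreeLt.mono φ (Nat.le_succ a) ha : φ.FreeLt (a + 1))⟩

theorem ATerm.substAll_congr {c : ℕ} {σ τ : ℕ → ATerm} (h : ∀ n < c, σ n = τ n) (t : ATerm) :
    t.FreeLt c → t.substAll σ = t.substAll τ := by
  induction t <;> simp_all [ATerm.FreeLt, ATerm.substAll]

theorem AFml.substAll_congr (φ : AFml) : ∀ {c : ℕ} {σ τ : ℕ → ATerm}, (∀ n < c, σ n = τ n) →
    φ.FreeLt c → φ.substAll σ = φ.substAll τ := by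
  have key : ∀ {c : ℕ} {σ τ : ℕ → ATerm}, (∀ n < c, σ n = τ n) →
      (∀ n < c + 1, liftSub σ n = liftSub τ n) := by
    intro c σ τ h n hn
    cases n with
    | zero => rfl
    | succ n => simp [liftSub, h n (by omega)]
  induction φ with
  | eq t s =>
    intro c σ τ h hf
    simp [AFml.substAll, ATerm.substAll_congr h _ hf.1, ATerm.substAll_congr h _ hf.2]
  | le t s =>
    intro c σ τ h hf
    simp [AFml.substAll, ATerm.substAll_congr h _ hf.1, ATerm.substAll_congr h _ hf.2]
  | neg φ ih => intro c σ τ h hf; simp [AFml.substAll, ih h hf]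
  | and φ ψ ih1 ih2 => intro c σ τ h hf; simp [AFml.substAll, ih1 h hf.1, ih2 h hf.2]
  | or φ ψ ih1 ih2 => intro c σ τ h hf; simp [AFml.substAll, ih1 h hf.1, ih2 h hf.2]
  | imp φ ψ ih1 ih2 => intro c σ τ h hf; simp [AFml.substAll, ih1 h hf.1, ih2 h hf.2]
  | all φ ih => intro c σ τ h hf; simp only [AFml.substAll]; rw [ih (key h) hf]
  | ex φ ih => intro c σ τ h hf; simp only [AFml.substAll]; rw [ih (key h) hf]

theorem ATerm.FreeLt.lift {c : ℕ} (t : ATerm) : t.FreeLt c → (t.lift 0).FreeLt (c + 1) := by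
  induction t <;> simp_all [ATerm.FreeLt, ATerm.lift]

theorem ATerm.FreeLt.subst {c d : ℕ} {σ : ℕ → ATerm} (h : ∀ n < c, (σ n).FreeLt d) (t : ATerm) :
    t.FreeLt c → (t.substAll σ).FreeLt d := by
  induction t <;> simp_all [ATerm.FreeLt, ATerm.substAll]

theorem AFml.FreeLt.subst (φ : AFml) : ∀ {c d : ℕ} {σ : ℕ → ATerm}, (∀ n < c, (σ n).FreeLt d) →
    φ.FreeLt c → (φ.substAll σ).FreeLt d := by
  have key : ∀ {c d : ℕ} {σ : ℕ → ATerm}, (∀ n < c, (σ n).FreeLt d) →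
      (∀ n < c + 1, (liftSub σ n).FreeLt (d + 1)) := by
    intro c d σ h n hn
    cases n with
    | zero => exact Nat.succ_pos d
    | succ n => exact ATerm.FreeLt.lift _ (h n (by omega))
  induction φ with
  | eq t s => intro c d σ h hf; exact ⟨ATerm.FreeLt.subst h _ hf.1, ATerm.FreeLt.subst h _ hf.2⟩
  | le t s => intro c d σ h hf; exact ⟨ATerm.FreeLt.subst h _ hf.1, ATerm.FreeLt.subst h _ hf.2⟩
  | neg φ ih => intro c d σ h hf; exact ih h hf
  | and φ ψ ih1 ih2 => intro c d σ h hf; exact ⟨ih1 h hf.1, ih2 h hf.2⟩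
  | or φ ψ ih1 ih2 => intro c d σ h hf; exact ⟨ih1 h hf.1, ih2 h hf.2⟩
  | imp φ ψ ih1 ih2 => intro c d σ h hf; exact ⟨ih1 h hf.1, ih2 h hf.2⟩
  | all φ ih => intro c d σ h hf; exact ih (key h) hf
  | ex φ ih => intro c d σ h hf; exact ih (key h) hf

theorem numeral_freeLt (n c : ℕ) : (numeral n).FreeLt c := by
  induction n with
  | zero => trivial
  | succ n ih => exact ih

/-! ### Structures -/

/-- A structure for the language of arithmetic. -/
structure Str (M : Type) where
  zero : M
  succ : M → M
  add : M → M → M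
  mul : M → M → M
  le : M → M → Prop

def ATerm.ev {M : Type} (S : Str M) (ρ : ℕ → M) : ATerm → M
  | .var n => ρ n
  | .zero => S.zero
  | .succ t => S.succ (t.ev S ρ)
  | .add t s => S.add (t.ev S ρ) (s.ev S ρ)
  | .mul t s => S.mul (t.ev S ρ) (s.ev S ρ)

def mcons {M : Type} (a : M) (ρ : ℕ → M) : ℕ → M
  | 0 => a
  | n + 1 => ρ n

@[simp] theorem mcons_zero {M : Type} (a : M) (ρ : ℕ → M) : mcons a ρ 0 = a := rfl
@[simp] theorem mcons_succ {M : Type} (a : M) (ρ : ℕ → M) (n : ℕ) : mcons a ρ (n + 1) = ρ n := rfl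

def AFml.Ms {M : Type} (S : Str M) (ρ : ℕ → M) : AFml → Prop
  | .eq t s => t.ev S ρ = s.ev S ρ
  | .le t s => S.le (t.ev S ρ) (s.ev S ρ)
  | .neg φ => ¬ φ.Ms S ρ
  | .and φ ψ => φ.Ms S ρ ∧ ψ.Ms S ρ
  | .or φ ψ => φ.Ms S ρ ∨ ψ.Ms S ρ
  | .imp φ ψ => φ.Ms S ρ → ψ.Ms S ρ
  | .all φ => ∀ a, φ.Ms S (mcons a ρ)
  | .ex φ => ∃ a, φ.Ms S (mcons a ρ)

theorem ATerm.ev_subst {M : Type} (S : Str M) (ρ : ℕ → M) (σ : ℕ → ATerm) (t : ATerm) :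
    (t.substAll σ).ev S ρ = t.ev S (fun n => (σ n).ev S ρ) := by
  induction t <;> simp_all [ATerm.substAll, ATerm.ev]

theorem ATerm.ev_lift {M : Type} (S : Str M) (ρ : ℕ → M) (a : M) (t : ATerm) :
    (t.lift 0).ev S (mcons a ρ) = t.ev S ρ := by
  induction t <;> simp_all [ATerm.lift, ATerm.ev]

theorem AFml.Ms_subst {M : Type} (S : Str M) (φ : AFml) : ∀ (ρ : ℕ → M) (σ : ℕ → ATerm),
    (φ.substAll σ).Ms S ρ ↔ φ.Ms S (fun n => (σ n).ev S ρ) := by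
  have key : ∀ (ρ : ℕ → M) (σ : ℕ → ATerm) (a : M),
      (fun n => (liftSub σ n).ev S (mcons a ρ)) = mcons a (fun n => (σ n).ev S ρ) := by
    intro ρ σ a; funext n
    cases n with
    | zero => rfl
    | succ n => simp [liftSub, ATerm.ev_lift]
  induction φ with
  | eq t s => intro ρ σ; simp [AFml.substAll, AFml.Ms, ATerm.ev_subst]
  | le t s => intro ρ σ; simp [AFml.substAll, AFml.Ms, ATerm.ev_subst]
  | neg φ ih => intro ρ σ; simp [AFml.substAll, AFml.Ms, ih]
  | and φ ψ ih1 ih2 => intro ρ σ; simp [AFml.substAll, AFml.Ms, ih1, ih2]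
  | or φ ψ ih1 ih2 => intro ρ σ; simp [AFml.substAll, AFml.Ms, ih1, ih2]
  | imp φ ψ ih1 ih2 => intro ρ σ; simp [AFml.substAll, AFml.Ms, ih1, ih2]
  | all φ ih => intro ρ σ; simp [AFml.substAll, AFml.Ms, ih, key]
  | ex φ ih => intro ρ σ; simp [AFml.substAll, AFml.Ms, ih, key]

theorem AFml.Ms_subst0 {M : Type} (S : Str M) (φ : AFml) (ρ : ℕ → M) (t : ATerm) :
    (φ.subst0 t).Ms S ρ ↔ φ.Ms S (mcons (t.ev S ρ) ρ) := by
  rw [AFml.subst0, AFml.Ms_subst]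
  have : (fun n => (subst0Env t n).ev S ρ) = mcons (t.ev S ρ) ρ := by
    funext n; cases n <;> rfl
  rw [this]

theorem AFml.Ms_lift {M : Type} (S : Str M) (φ : AFml) (ρ : ℕ → M) (a : M) :
    (φ.lift 0).Ms S (mcons a ρ) ↔ φ.Ms S ρ := by
  rw [AFml.lift_eq, AFml.Ms_subst, ren_zero]
  rfl

theorem ATerm.ev_congr {M : Type} (S : Str M) {c : ℕ} {ρ ρ' : ℕ → M} (h : ∀ n < c, ρ n = ρ' n)
    (t : ATerm) : t.FreeLt c → t.ev S ρ = t.ev S ρ' := by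
  induction t <;> simp_all [ATerm.FreeLt, ATerm.ev]

theorem AFml.Ms_congr {M : Type} (S : Str M) (φ : AFml) : ∀ {c : ℕ} {ρ ρ' : ℕ → M},
    (∀ n < c, ρ n = ρ' n) → φ.FreeLt c → (φ.Ms S ρ ↔ φ.Ms S ρ') := by
  have key : ∀ {c : ℕ} {ρ ρ' : ℕ → M}, (∀ n < c, ρ n = ρ' n) → ∀ a : M,
      ∀ n < c + 1, mcons a ρ n = mcons a ρ' n := by
    intro c ρ ρ' h a n hn
    cases n with
    | zero => rfl
    | succ n => exact h n (by omega)
  induction φ with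
  | eq t s =>
    intro c ρ ρ' h hf
    simp [AFml.Ms, ATerm.ev_congr S h _ hf.1, ATerm.ev_congr S h _ hf.2]
  | le t s =>
    intro c ρ ρ' h hf
    simp [AFml.Ms, ATerm.ev_congr S h _ hf.1, ATerm.ev_congr S h _ hf.2]
  | neg φ ih => intro c ρ ρ' h hf; exact not_congr (ih h hf)
  | and φ ψ ih1 ih2 => intro c ρ ρ' h hf; exact and_congr (ih1 h hf.1) (ih2 h hf.2)
  | or φ ψ ih1 ih2 => intro c ρ ρ' h hf; exact or_congr (ih1 h hf.1) (ih2 h hf.2)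
  | imp φ ψ ih1 ih2 => intro c ρ ρ' h hf; exact imp_congr (ih1 h hf.1) (ih2 h hf.2)
  | all φ ih => intro c ρ ρ' h hf; exact forall_congr' fun a => ih (key h a) hf
  | ex φ ih => intro c ρ ρ' h hf; exact exists_congr fun a => ih (key h a) hf

theorem AFml.evalProp_Ms {M : Type} (S : Str M) (ρ : ℕ → M) (φ : AFml) :
    φ.evalProp (fun ψ => ψ.Ms S ρ) ↔ φ.Ms S ρ := by
  induction φ <;> simp_all [AFml.evalProp, AFml.Ms]

/-- `M ⊨ Γ`. -/
def Models {M : Type} (S : Str M) (Γ : Set AFml) : Prop := ∀ φ ∈ Γ, ∀ ρ, φ.Ms S ρ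

theorem soundness {Γ : Set AFml} {M : Type} {S : Str M} (hM : Models S Γ) {φ : AFml}
    (h : Proves Γ φ) : ∀ ρ, φ.Ms S ρ := by
  induction h with
  | ax h => exact hM _ h
  | taut h => intro ρ; exact (AFml.evalProp_Ms S ρ _).1 (h _)
  | mp _ _ ih1 ih2 => intro ρ; exact ih1 ρ (ih2 ρ)
  | allE φ t => intro ρ h; rw [AFml.Ms_subst0]; exact h _
  | exI φ t => intro ρ h; rw [AFml.Ms_subst0] at h; exact ⟨_, h⟩
  | allImp φ ψ => intro ρ h1 h2 a; exact h1 a (h2 a)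
  | vacAll φ => intro ρ h a; exact (AFml.Ms_lift S φ ρ a).2 h
  | exDef φ => intro ρ; simp [iffF, AFml.Ms]
  | gen _ ih => intro ρ a; exact ih _
  | eqRefl t => intro ρ; rfl
  | eqSubst φ t s =>
    intro ρ h h1
    rw [AFml.Ms_subst0] at h1 ⊢
    have h : t.ev S ρ = s.ev S ρ := h
    rwa [← h]


/-! ### Lindenbaum lemma -/

theorem lindenbaum {F : Type} (imp : F → F → F) (L : Set F)
    (hK : ∀ a b, imp a (imp b a) ∈ L)
    (hS : ∀ a b c, imp (imp a (imp b c)) (imp (imp a b) (imp a c)) ∈ L)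
    (hmp : ∀ a b, imp a b ∈ L → a ∈ L → b ∈ L) (φ : F) (hφ : φ ∉ L) :
    ∃ M : Set F, L ⊆ M ∧ (∀ a b, imp a b ∈ M → a ∈ M → b ∈ M) ∧ φ ∉ M ∧
      ∀ ψ, ψ ∈ M ∨ imp ψ φ ∈ M := by
  let C : Set (Set F) := {M | (∀ a b, imp a b ∈ M → a ∈ M → b ∈ M) ∧ φ ∉ M}
  obtain ⟨M, hLM, hM⟩ := zorn_subset_nonempty C (by
    intro c hc hch hne
    refine ⟨⋃₀ c, ⟨?_, ?_⟩, fun s hs => Set.subset_sUnion_of_mem hs⟩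
    · rintro a b ⟨s, hs, h1⟩ ⟨t, ht, h2⟩
      rcases hch.total hs ht with h | h
      · exact ⟨t, ht, (hc ht).1 a b (h h1) h2⟩
      · exact ⟨s, hs, (hc hs).1 a b h1 (h h2)⟩
    · rintro ⟨s, hs, h1⟩
      exact (hc hs).2 h1) L ⟨hmp, hφ⟩
  refine ⟨M, hLM, hM.prop.1, hM.prop.2, fun ψ => ?_⟩
  by_contra hcon
  push Not at hcon
  have hMM := hM.prop.1
  let M' : Set F := {χ | imp ψ χ ∈ M}
  have hM' : M' ∈ C := by
    refine ⟨fun a b h1 h2 => ?_, hcon.2⟩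
    exact hMM _ _ (hMM _ _ (hLM (hS ψ a b)) h1) h2
  have hsub : M ⊆ M' := fun χ hχ => hMM _ _ (hLM (hK χ ψ)) hχ
  have : M' ⊆ M := hM.le_of_ge hM' hsub
  apply hcon.1
  apply this
  show imp ψ ψ ∈ M
  exact hMM _ _ (hMM _ _ (hLM (hS ψ (imp ψ ψ) ψ)) (hLM (hK _ _))) (hLM (hK _ _))

/-! ### Codes are injective -/

theorem ATerm.code_inj : ∀ {t s : ATerm}, t.code = s.code → t = s := by
  intro t
  induction t with
  | var n => intro s h; cases s <;> simp_all [ATerm.code, Nat.pair_eq_pair]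
  | zero => intro s h; cases s <;> simp_all [ATerm.code, Nat.pair_eq_pair]
  | succ t ih =>
    intro s h
    cases s <;> simp [ATerm.code, Nat.pair_eq_pair] at h ⊢
    exact ih h
  | add t u ih1 ih2 =>
    intro s h
    cases s <;> simp [ATerm.code, Nat.pair_eq_pair] at h ⊢
    exact ⟨ih1 h.1, ih2 h.2⟩
  | mul t u ih1 ih2 =>
    intro s h
    cases s <;> simp [ATerm.code, Nat.pair_eq_pair] at h ⊢
    exact ⟨ih1 h.1, ih2 h.2⟩

theorem AFml.code_inj : ∀ {t s : AFml}, t.code = s.code → t = s := by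
  intro t
  induction t with
  | eq t u =>
    intro s h
    cases s <;> simp [AFml.code, Nat.pair_eq_pair] at h ⊢
    exact ⟨ATerm.code_inj h.1, ATerm.code_inj h.2⟩
  | le t u =>
    intro s h
    cases s <;> simp [AFml.code, Nat.pair_eq_pair] at h ⊢
    exact ⟨ATerm.code_inj h.1, ATerm.code_inj h.2⟩
  | neg t ih =>
    intro s h
    cases s <;> simp [AFml.code, Nat.pair_eq_pair] at h ⊢
    exact ih h
  | all t ih =>
    intro s h
    cases s <;> simp [AFml.code, Nat.pair_eq_pair] at h ⊢
    exact ih h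
  | ex t ih =>
    intro s h
    cases s <;> simp [AFml.code, Nat.pair_eq_pair] at h ⊢
    exact ih h
  | and t u ih1 ih2 =>
    intro s h
    cases s <;> simp [AFml.code, Nat.pair_eq_pair] at h ⊢
    exact ⟨ih1 h.1, ih2 h.2⟩
  | or t u ih1 ih2 =>
    intro s h
    cases s <;> simp [AFml.code, Nat.pair_eq_pair] at h ⊢
    exact ⟨ih1 h.1, ih2 h.2⟩
  | imp t u ih1 ih2 =>
    intro s h
    cases s <;> simp [AFml.code, Nat.pair_eq_pair] at h ⊢
    exact ⟨ih1 h.1, ih2 h.2⟩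

theorem exists_enum : ∃ e : ℕ → AFml, Function.Surjective e := by
  have : Countable AFml := Function.Injective.countable (f := AFml.code) fun _ _ h => AFml.code_inj h
  have : Nonempty AFml := ⟨botFml⟩
  exact exists_surjective_nat AFml

/-! ### Derived rules -/

theorem Proves.tc1 {Γ : Set AFml} {a b : AFml} (h : Proves Γ a)
    (ht : ∀ v, a.evalProp v → b.evalProp v) : Proves Γ b :=
  .mp (.taut fun v => ht v) h

theorem Proves.tc2 {Γ : Set AFml} {a b c : AFml} (h : Proves Γ a) (h' : Proves Γ b)
    (ht : ∀ v, a.evalProp v → b.evalProp v → c.evalProp v) : Proves Γ c :=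
  .mp (.mp (.taut fun v => ht v) h) h'

theorem Proves.subst {Γ : Set AFml} : ∀ (N : ℕ) (φ : AFml) (σ : ℕ → ATerm), φ.FreeLt N →
    Proves Γ φ → Proves Γ (φ.substAll σ) := by
  intro N
  induction N with
  | zero =>
    intro φ σ hf h
    rw [AFml.substAll_congr φ (σ := σ) (τ := ATerm.var) (fun n hn => absurd hn (Nat.not_lt_zero n)) hf,
      AFml.substAll_var]
    exact h
  | succ N ih =>
    intro φ σ hf h
    have h1 := ih (.all φ) (fun n => σ (n + 1)) hf (.gen h)
    have h2 := Proves.mp (Proves.allE (φ.substAll (liftSub fun n => σ (n + 1))) (σ 0)) h1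
    rw [AFml.substAll_liftSub_subst0] at h2
    have : scons (σ 0) (fun n => σ (n + 1)) = σ := by
      funext n; cases n <;> rfl
    rwa [this] at h2

/-- Henkin axiom for `∃ψ` with witness variable `k`. -/
def henk (ψ : AFml) (k : ℕ) : AFml := .imp (.ex ψ) (ψ.subst0 (.var k))

theorem henk_removal {Γ : Set AFml} (ψ χ : AFml) (k : ℕ) (hψ : ψ.FreeLt k) (hχ : χ.FreeLt k)
    (h : Proves Γ (.imp (henk ψ k) χ)) : Proves Γ χ := by
  obtain ⟨N, hN⟩ := AFml.exists_freeLt (.imp (henk ψ k) χ)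
  let σ : ℕ → ATerm := fun n => if n < k then .var (n + 1) else .var 0
  have h1 := Proves.subst N _ σ hN h
  have hlift : ∀ α : AFml, α.FreeLt k → α.substAll σ = α.lift 0 := by
    intro α hα
    rw [AFml.lift_eq, ren_zero]
    exact AFml.substAll_congr α (fun n hn => by simp [σ, hn]) hα
  have hex : (AFml.ex ψ).FreeLt k := AFml.FreeLt.mono ψ (Nat.le_succ k) hψ
  have e1 : (ψ.subst0 (.var k)).substAll σ = ψ := by
    rw [AFml.subst0_substAll]
    conv_rhs => rw [← AFml.substAll_var ψ]
    apply AFml.substAll_congr ψ _ hψ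
    intro n hn
    cases n with
    | zero => simp [scons, σ, ATerm.substAll]
    | succ n =>
      have : n < k := by omega
      simp [scons, σ, this]
  have e2 : (AFml.imp (henk ψ k) χ).substAll σ
      = .imp (.imp ((AFml.ex ψ).lift 0) ψ) (χ.lift 0) := by
    rw [← hlift _ hχ, ← hlift _ hex]
    show AFml.imp (.imp ((AFml.ex ψ).substAll σ) ((ψ.subst0 (.var k)).substAll σ)) _ = _
    rw [e1]
  rw [e2] at h1
  have a1 : Proves Γ (.imp ((AFml.neg χ).lift 0) ((AFml.ex ψ).lift 0)) :=
    h1.tc1 fun v => by simp only [AFml.evalProp, AFml.lift]; tauto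
  have a2 : Proves Γ (.imp ((AFml.neg χ).lift 0) (.neg ψ)) :=
    h1.tc1 fun v => by simp only [AFml.evalProp, AFml.lift]; tauto
  have b1 := Proves.mp (Proves.allImp _ _) (Proves.gen a1)
  have b2 := Proves.mp (Proves.allImp _ _) (Proves.gen a2)
  have c1 : Proves Γ (.imp (.neg χ) (.all ((AFml.ex ψ).lift 0))) :=
    (Proves.vacAll (.neg χ)).tc2 b1 fun v => by simp only [AFml.evalProp]; tauto
  have c2 : Proves Γ (.imp (.neg χ) (.all (.neg ψ))) :=
    (Proves.vacAll (.neg χ)).tc2 b2 fun v => by simp only [AFml.evalProp]; tauto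
  have d := Proves.allE (Γ := Γ) ((AFml.ex ψ).lift 0) .zero
  rw [AFml.lift0_subst0] at d
  have c3 : Proves Γ (.imp (.neg χ) (.ex ψ)) :=
    c1.tc2 d fun v => by simp only [AFml.evalProp]; tauto
  have c4 : Proves Γ (.imp (.neg χ) (.neg (.all (.neg ψ)))) :=
    c3.tc2 (Proves.exDef ψ) fun v => by simp only [AFml.evalProp, iffF]; tauto
  exact c2.tc2 c4 fun v => by simp only [AFml.evalProp]; tauto

/-- Chain of Henkin assumptions. -/
def hchain (h : ℕ → AFml) : ℕ → AFml → AFml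
  | 0, χ => χ
  | n + 1, χ => .imp (h n) (hchain h n χ)

theorem hchain_eval (h : ℕ → AFml) (v : AFml → Prop) (n : ℕ) (χ : AFml) :
    (hchain h n χ).evalProp v ↔ ((∀ i < n, (h i).evalProp v) → χ.evalProp v) := by
  induction n with
  | zero => simp [hchain]
  | succ n ih =>
    simp only [hchain, AFml.evalProp, ih]
    constructor
    · intro h1 h2
      exact h1 (h2 n (Nat.lt_succ_self n)) fun i hi => h2 i (by omega)
    · intro h1 h2 h3
      apply h1
      intro i hi
      rcases Nat.lt_succ_iff_lt_or_eq.1 hi with h | h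
      · exact h3 i h
      · rw [h]; exact h2

/-- A maximal Henkin theory omitting `φ`. -/
theorem exists_henkin {Γ : Set AFml} {φ : AFml} (hφ : ¬ Proves Γ φ) :
    ∃ M : Set AFml, (∀ ψ, Proves Γ ψ → ψ ∈ M) ∧ φ ∉ M ∧
      (∀ a b, AFml.imp a b ∈ M → a ∈ M → b ∈ M) ∧
      (∀ ψ, ψ ∈ M ∨ AFml.imp ψ φ ∈ M) ∧
      (∀ ψ, ∃ k, henk ψ k ∈ M) := by
  obtain ⟨e, he⟩ := exists_enum
  choose b hb using AFml.exists_freeLt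
  let k : ℕ → ℕ := fun n => b φ + n + ∑ i ∈ Finset.range (n + 1), b (e i)
  have hk1 : ∀ n, (e n).FreeLt (k n) := by
    intro n
    refine AFml.FreeLt.mono _ ?_ (hb (e n))
    simp only [k, Finset.sum_range_succ]; omega
  have hkφ : ∀ n, φ.FreeLt (k n) := by
    intro n
    refine AFml.FreeLt.mono _ ?_ (hb φ)
    simp only [k]; omega
  have hk2 : ∀ n, k n + 1 ≤ k (n + 1) := by
    intro n
    simp only [k, Finset.sum_range_succ]; omega
  have hmono : StrictMono k := strictMono_nat_of_lt_succ hk2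
  let h : ℕ → AFml := fun n => henk (e n) (k n)
  have hh : ∀ n, (h n).FreeLt (k n + 1) := by
    intro n
    refine ⟨AFml.FreeLt.mono (e n) (by omega) (hk1 n), ?_⟩
    refine AFml.FreeLt.subst (e n) (c := k n) ?_ (hk1 n)
    intro i hi
    cases i with
    | zero => exact Nat.lt_succ_self _
    | succ i => show i < _; omega
  have hcf : ∀ n m, n ≤ m → (hchain h n φ).FreeLt (k m) := by
    intro n
    induction n with
    | zero => intro m _; exact hkφ m
    | succ n ih =>
      intro m hm
      refine ⟨AFml.FreeLt.mono _ ?_ (hh n), ih m (by omega)⟩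
      exact hmono (show n < m by omega)
  have hcons : ∀ n, Proves Γ (hchain h n φ) → Proves Γ φ := by
    intro n
    induction n with
    | zero => exact id
    | succ n ih =>
      intro hp
      exact ih (henk_removal _ _ _ (hk1 n) (hcf n n le_rfl) hp)
  let L : Set AFml := {χ | ∃ n, Proves Γ (hchain h n χ)}
  have hL0 : ∀ χ, Proves Γ χ → χ ∈ L := fun χ hχ => ⟨0, hχ⟩
  obtain ⟨M, hLM, hmp, hφM, hmax⟩ := lindenbaum AFml.imp L
    (fun a b => hL0 _ (.taut fun v => by simp only [AFml.evalProp]; tauto))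
    (fun a b c => hL0 _ (.taut fun v => by simp only [AFml.evalProp]; tauto))
    (by
      rintro a b ⟨n, hn⟩ ⟨m, hm⟩
      refine ⟨max n m, hn.tc2 hm fun v => ?_⟩
      simp only [hchain_eval, AFml.evalProp]
      intro h1 h2 h3
      exact h1 (fun i hi => h3 i (lt_of_lt_of_le hi (le_max_left _ _)))
        (h2 (fun i hi => h3 i (lt_of_lt_of_le hi (le_max_right _ _))))) φ
    (by rintro ⟨n, hn⟩; exact hφ (hcons n hn))
  refine ⟨M, fun ψ hψ => hLM (hL0 ψ hψ), hφM, hmp, hmax, fun ψ => ?_⟩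
  obtain ⟨n, rfl⟩ := he ψ
  refine ⟨k n, hLM ⟨n + 1, .taut fun v => ?_⟩⟩
  rw [hchain_eval]
  intro h1
  exact h1 n (Nat.lt_succ_self n)

/-- Gödel's completeness theorem. -/
theorem completeness {Γ : Set AFml} {φ : AFml}
    (H : ∀ (M : Type) (S : Str M), Models S Γ → ∀ ρ, φ.Ms S ρ) : Proves Γ φ := by
  by_contra hφ
  obtain ⟨M, hΓ, hφM, hmp, hmax, hhenk⟩ := exists_henkin hφ
  have t1 : ∀ {a b : AFml}, a ∈ M → (∀ v, a.evalProp v → b.evalProp v) → b ∈ M :=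
    fun ha ht => hmp _ _ (hΓ _ (.taut fun v => ht v)) ha
  have t2 : ∀ {a b c : AFml}, a ∈ M → b ∈ M →
      (∀ v, a.evalProp v → b.evalProp v → c.evalProp v) → c ∈ M :=
    fun ha hb ht => hmp _ _ (hmp _ _ (hΓ _ (.taut fun v => ht v)) ha) hb
  have hneg : ∀ a, AFml.neg a ∈ M ↔ a ∉ M := by
    intro a
    constructor
    · intro h1 h2
      exact hφM (t2 h1 h2 fun v => by simp only [AFml.evalProp]; tauto)
    · intro h
      have h1 := (hmax a).resolve_left h
      by_contra h2
      have h3 := (hmax (.neg a)).resolve_left h2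
      exact hφM (t2 h1 h3 fun v => by simp only [AFml.evalProp]; tauto)
  have hand : ∀ a b, AFml.and a b ∈ M ↔ a ∈ M ∧ b ∈ M := by
    intro a b
    refine ⟨fun h => ⟨t1 h fun v => ?_, t1 h fun v => ?_⟩, fun h => t2 h.1 h.2 fun v => ?_⟩ <;>
      simp only [AFml.evalProp] <;> tauto
  have himp : ∀ a b, AFml.imp a b ∈ M ↔ (a ∈ M → b ∈ M) := by
    intro a b
    refine ⟨fun h h1 => hmp _ _ h h1, fun h => ?_⟩
    by_cases ha : a ∈ M
    · exact t1 (h ha) fun v => by simp only [AFml.evalProp]; tauto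
    · exact t1 ((hneg a).2 ha) fun v => by simp only [AFml.evalProp]; tauto
  have hor : ∀ a b, AFml.or a b ∈ M ↔ a ∈ M ∨ b ∈ M := by
    intro a b
    constructor
    · intro h
      by_contra hc
      push Not at hc
      have h1 := t2 ((hneg a).2 hc.1) ((hneg b).2 hc.2) (c := .neg (.or a b)) fun v => by
        simp only [AFml.evalProp]; tauto
      exact (hneg _).1 h1 h
    · rintro (h | h)
      · exact t1 h fun v => by simp only [AFml.evalProp]; tauto
      · exact t1 h fun v => by simp only [AFml.evalProp]; tauto
  have hsub : ∀ (ψ : AFml) (t s : ATerm), AFml.eq t s ∈ M → ψ.subst0 t ∈ M → ψ.subst0 s ∈ M :=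
    fun ψ t s h1 h2 => hmp _ _ (hmp _ _ (hΓ _ (.eqSubst ψ t s)) h1) h2
  have hrefl : ∀ t, AFml.eq t t ∈ M := fun t => hΓ _ (.eqRefl t)
  have sl : ∀ t s : ATerm, (t.lift 0).substAll (subst0Env s) = t := by
    intro t s
    rw [subst0Env_eq, ATerm.lift0_subst_scons, ATerm.substAll_var]
  have hsymm : ∀ t s, AFml.eq t s ∈ M → AFml.eq s t ∈ M := by
    intro t s h
    have := hsub (.eq (.var 0) (t.lift 0)) t s h
    simp only [AFml.subst0, AFml.substAll, sl, ATerm.substAll, subst0Env] at this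
    exact this (hrefl t)
  have htrans : ∀ t s u, AFml.eq t s ∈ M → AFml.eq s u ∈ M → AFml.eq t u ∈ M := by
    intro t s u h1 h2
    have := hsub (.eq (t.lift 0) (.var 0)) s u h2
    simp only [AFml.subst0, AFml.substAll, sl, ATerm.substAll, subst0Env] at this
    exact this h1
  let st : Setoid ATerm := ⟨fun t s => AFml.eq t s ∈ M, hrefl, fun h => hsymm _ _ h,
    fun h1 h2 => htrans _ _ _ h1 h2⟩
  have hcongr1 : ∀ (F : ATerm → ATerm) (F' : ATerm), (∀ u, F'.substAll (subst0Env u) = F u) →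
      ∀ t s, AFml.eq t s ∈ M → AFml.eq (F t) (F s) ∈ M := by
    intro F F' hF t s h
    have := hsub (.eq ((F t).lift 0) F') t s h
    simp only [AFml.subst0, AFml.substAll, sl, hF] at this
    exact this (hrefl _)
  have hadd : ∀ t s t' s', AFml.eq t t' ∈ M → AFml.eq s s' ∈ M →
      AFml.eq (.add t s) (.add t' s') ∈ M := by
    intro t s t' s' h1 h2
    refine htrans _ _ _ (hcongr1 (fun u => .add u s) (.add (.var 0) (s.lift 0)) ?_ _ _ h1)
      (hcongr1 (fun u => .add t' u) (.add (t'.lift 0) (.var 0)) ?_ _ _ h2) <;>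
    · intro u; simp only [ATerm.substAll, sl, subst0Env]
  have hmul : ∀ t s t' s', AFml.eq t t' ∈ M → AFml.eq s s' ∈ M →
      AFml.eq (.mul t s) (.mul t' s') ∈ M := by
    intro t s t' s' h1 h2
    refine htrans _ _ _ (hcongr1 (fun u => .mul u s) (.mul (.var 0) (s.lift 0)) ?_ _ _ h1)
      (hcongr1 (fun u => .mul t' u) (.mul (t'.lift 0) (.var 0)) ?_ _ _ h2) <;>
    · intro u; simp only [ATerm.substAll, sl, subst0Env]
  have hsucc : ∀ t t', AFml.eq t t' ∈ M → AFml.eq (.succ t) (.succ t') ∈ M := by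
    intro t t' h1
    refine (hcongr1 (fun u => .succ u) (.succ (.var 0)) ?_ _ _ h1)
    intro u; simp only [ATerm.substAll, subst0Env]
  have hle : ∀ t s t' s', AFml.eq t t' ∈ M → AFml.eq s s' ∈ M →
      AFml.le t s ∈ M → AFml.le t' s' ∈ M := by
    intro t s t' s' h1 h2 h3
    have a1 := hsub (.le (.var 0) (s.lift 0)) t t' h1
    simp only [AFml.subst0, AFml.substAll, sl, ATerm.substAll, subst0Env] at a1
    have a2 := hsub (.le (t'.lift 0) (.var 0)) s s' h2
    simp only [AFml.subst0, AFml.substAll, sl, ATerm.substAll, subst0Env] at a2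
    exact a2 (a1 h3)
  let S : Str (Quotient st) :=
    { zero := Quotient.mk st .zero
      succ := Quotient.map ATerm.succ (fun a b h => hsucc a b h)
      add := Quotient.map₂ ATerm.add (fun a b h c d h' => hadd _ _ _ _ h h')
      mul := Quotient.map₂ ATerm.mul (fun a b h c d h' => hmul _ _ _ _ h h')
      le := Quotient.lift₂ (fun t s => AFml.le t s ∈ M) (by
        intro a b c d h h'
        exact propext ⟨hle _ _ _ _ h h', hle _ _ _ _ (hsymm _ _ h) (hsymm _ _ h')⟩) }
  have hev : ∀ (σ : ℕ → ATerm) (t : ATerm),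
      t.ev S (fun n => Quotient.mk st (σ n)) = Quotient.mk st (t.substAll σ) := by
    intro σ t
    induction t with
    | var n => rfl
    | zero => rfl
    | succ t ih => simp only [ATerm.ev, ih, ATerm.substAll]; rfl
    | add t s ih1 ih2 => simp only [ATerm.ev, ih1, ih2, ATerm.substAll]; rfl
    | mul t s ih1 ih2 => simp only [ATerm.ev, ih1, ih2, ATerm.substAll]; rfl
  have hcons : ∀ (σ : ℕ → ATerm) (t : ATerm), mcons (Quotient.mk st t) (fun n => Quotient.mk st (σ n))
      = fun n => Quotient.mk st (scons t σ n) := by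
    intro σ t; funext n; cases n <;> rfl
  have hexM : ∀ ψ, AFml.ex ψ ∈ M ↔ ∃ t, ψ.subst0 t ∈ M := by
    intro ψ
    constructor
    · intro h
      obtain ⟨k, hk⟩ := hhenk ψ
      exact ⟨_, hmp _ _ hk h⟩
    · rintro ⟨t, ht⟩
      exact hmp _ _ (hΓ _ (.exI ψ t)) ht
  have hallM : ∀ ψ, AFml.all ψ ∈ M ↔ ∀ t, ψ.subst0 t ∈ M := by
    intro ψ
    constructor
    · intro h t
      exact hmp _ _ (hΓ _ (.allE ψ t)) h
    · intro h
      by_contra hc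
      have h1 : AFml.ex (.neg ψ) ∉ M := by
        rw [hexM]
        rintro ⟨t, ht⟩
        exact (hneg _).1 ht (h t)
      have h2 : AFml.all (.neg (.neg ψ)) ∈ M := by
        have h3 := hΓ _ (Proves.exDef (.neg ψ))
        exact t2 h3 ((hneg _).2 h1) fun v => by simp only [AFml.evalProp, iffF]; tauto
      have h4 : AFml.imp (.all (.neg (.neg ψ))) (.all ψ) ∈ M :=
        hΓ _ (.mp (.allImp _ _) (.gen (.taut fun v => by simp only [AFml.evalProp]; tauto)))
      exact hc (hmp _ _ h4 h2)
  have truth : ∀ (χ : AFml) (σ : ℕ → ATerm),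
      χ.Ms S (fun n => Quotient.mk st (σ n)) ↔ χ.substAll σ ∈ M := by
    intro χ
    induction χ with
    | eq t s =>
      intro σ
      simp only [AFml.Ms, hev, AFml.substAll]
      exact Quotient.eq (r := st)
    | le t s =>
      intro σ
      simp only [AFml.Ms, hev, AFml.substAll]
      rfl
    | neg φ ih => intro σ; simp only [AFml.Ms, AFml.substAll, hneg, ih]
    | and φ ψ ih1 ih2 => intro σ; simp only [AFml.Ms, AFml.substAll, hand, ih1, ih2]
    | or φ ψ ih1 ih2 => intro σ; simp only [AFml.Ms, AFml.substAll, hor, ih1, ih2]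
    | imp φ ψ ih1 ih2 => intro σ; simp only [AFml.Ms, AFml.substAll, himp, ih1, ih2]
    | all φ ih =>
      intro σ
      simp only [AFml.Ms, AFml.substAll, hallM, AFml.substAll_liftSub_subst0]
      constructor
      · intro h t
        rw [← ih, ← hcons]; exact h _
      · intro h a
        obtain ⟨t, rfl⟩ := Quotient.exists_rep a
        rw [hcons, ih]; exact h t
    | ex φ ih =>
      intro σ
      simp only [AFml.Ms, AFml.substAll, hexM, AFml.substAll_liftSub_subst0]
      constructor
      · rintro ⟨a, ha⟩
        obtain ⟨t, rfl⟩ := Quotient.exists_rep a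
        rw [hcons, ih] at ha; exact ⟨t, ha⟩
      · rintro ⟨t, ht⟩
        refine ⟨Quotient.mk st t, ?_⟩
        rw [hcons, ih]; exact ht
  have hmod : Models S Γ := by
    intro ψ hψ ρ
    have : ρ = fun n => Quotient.mk st ((ρ n).out) := by
      funext n; exact (Quotient.out_eq _).symm
    rw [this, truth]
    obtain ⟨N, hN⟩ := ψ.exists_freeLt
    exact hΓ _ (Proves.subst N ψ _ hN (.ax hψ))
  have := H _ S hmod (fun n => Quotient.mk st (ATerm.var n))
  rw [truth, AFml.substAll_var] at this
  exact hφM this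


/-! ### Models of PA -/

section PAModels
variable {M : Type} {S : Str M}

theorem succSubst_Ms (φ : AFml) (a : M) (ρ : ℕ → M) :
    (succSubst φ).Ms S (mcons a ρ) ↔ φ.Ms S (mcons (S.succ a) ρ) := by
  rw [succSubst, AFml.Ms_subst]
  have : (fun n => ATerm.ev S (mcons a ρ) (if n = 0 then .succ (.var 0) else .var n))
      = mcons (S.succ a) ρ := by
    funext n; cases n <;> simp [ATerm.ev]
  rw [this]


theorem pa_ind (hM : Models S PA) (φ : AFml) (ρ : ℕ → M) (h0 : φ.Ms S (mcons S.zero ρ))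
    (hs : ∀ a, φ.Ms S (mcons a ρ) → φ.Ms S (mcons (S.succ a) ρ)) (a : M) :
    φ.Ms S (mcons a ρ) := by
  have h := hM _ (PAax.ind φ) ρ
  refine h ⟨?_, ?_⟩ a
  · rw [AFml.Ms_subst0]; exact h0
  · intro b hb
    rw [succSubst_Ms]; exact hs b hb

theorem pa_succ_ne_zero (hM : Models S PA) (a : M) : S.succ a ≠ S.zero :=
  hM _ PAax.succNeZero (fun _ => S.zero) a

theorem pa_succ_inj (hM : Models S PA) {a b : M} (h : S.succ a = S.succ b) : a = b :=
  hM _ PAax.succInj (fun _ => S.zero) a b h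

theorem pa_add_zero (hM : Models S PA) (a : M) : S.add a S.zero = a :=
  hM _ PAax.addZero (fun _ => S.zero) a

theorem pa_add_succ (hM : Models S PA) (a b : M) : S.add a (S.succ b) = S.succ (S.add a b) :=
  hM _ PAax.addSucc (fun _ => S.zero) a b

theorem pa_mul_zero (hM : Models S PA) (a : M) : S.mul a S.zero = S.zero :=
  hM _ PAax.mulZero (fun _ => S.zero) a

theorem pa_mul_succ (hM : Models S PA) (a b : M) : S.mul a (S.succ b) = S.add (S.mul a b) a :=
  hM _ PAax.mulSucc (fun _ => S.zero) a b

theorem pa_le_def (hM : Models S PA) (a b : M) : S.le a b ↔ ∃ z, S.add z a = b := by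
  have h := hM _ PAax.leDef (fun _ => S.zero) a b
  exact ⟨h.1, h.2⟩

theorem pa_zero_add (hM : Models S PA) (a : M) : S.add S.zero a = a := by
  refine pa_ind hM (.eq (.add .zero (.var 0)) (.var 0)) (fun _ => S.zero) ?_ ?_ a
  · exact pa_add_zero hM _
  · intro b hb
    have hb : S.add S.zero b = b := hb
    show S.add S.zero (S.succ b) = S.succ b
    rw [pa_add_succ hM, hb]

theorem pa_succ_add (hM : Models S PA) (a b : M) : S.add (S.succ a) b = S.succ (S.add a b) := by
  refine pa_ind hM (.eq (.add (.succ (.var 1)) (.var 0)) (.succ (.add (.var 1) (.var 0))))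
    (fun _ => a) ?_ ?_ b
  · show S.add (S.succ a) S.zero = S.succ (S.add a S.zero)
    rw [pa_add_zero hM, pa_add_zero hM]
  · intro b hb
    have hb : S.add (S.succ a) b = S.succ (S.add a b) := hb
    show S.add (S.succ a) (S.succ b) = S.succ (S.add a (S.succ b))
    rw [pa_add_succ hM, hb, pa_add_succ hM]

theorem pa_add_comm (hM : Models S PA) (a b : M) : S.add a b = S.add b a := by
  refine pa_ind hM (.eq (.add (.var 1) (.var 0)) (.add (.var 0) (.var 1)))
    (fun _ => a) ?_ ?_ b
  · show S.add a S.zero = S.add S.zero a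
    rw [pa_add_zero hM, pa_zero_add hM]
  · intro b hb
    have hb : S.add a b = S.add b a := hb
    show S.add a (S.succ b) = S.add (S.succ b) a
    rw [pa_add_succ hM, hb, pa_succ_add hM]

theorem pa_add_assoc (hM : Models S PA) (a b c : M) : S.add (S.add a b) c = S.add a (S.add b c) := by
  refine pa_ind hM (.eq (.add (.add (.var 1) (.var 2)) (.var 0))
    (.add (.var 1) (.add (.var 2) (.var 0)))) (mcons a (fun _ => b)) ?_ ?_ c
  · show S.add (S.add a b) S.zero = S.add a (S.add b S.zero)
    rw [pa_add_zero hM, pa_add_zero hM]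
  · intro c hc
    have hc : S.add (S.add a b) c = S.add a (S.add b c) := hc
    show S.add (S.add a b) (S.succ c) = S.add a (S.add b (S.succ c))
    rw [pa_add_succ hM, hc, pa_add_succ hM, pa_add_succ hM]

theorem pa_add_cancel (hM : Models S PA) (a b c : M) : S.add a c = S.add b c → a = b := by
  refine pa_ind hM (.imp (.eq (.add (.var 1) (.var 0)) (.add (.var 2) (.var 0)))
    (.eq (.var 1) (.var 2))) (mcons a (fun _ => b)) ?_ ?_ c
  · show S.add a S.zero = S.add b S.zero → a = b
    rw [pa_add_zero hM, pa_add_zero hM]; exact id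
  · intro c hc
    have hc : S.add a c = S.add b c → a = b := hc
    show S.add a (S.succ c) = S.add b (S.succ c) → a = b
    rw [pa_add_succ hM, pa_add_succ hM]
    intro h
    exact hc (pa_succ_inj hM h)

theorem pa_cases (hM : Models S PA) (a : M) : a = S.zero ∨ ∃ b, a = S.succ b := by
  refine pa_ind hM (.or (.eq (.var 0) .zero) (.ex (.eq (.var 1) (.succ (.var 0)))))
    (fun _ => S.zero) ?_ ?_ a
  · exact Or.inl rfl
  · intro b _
    exact Or.inr ⟨b, rfl⟩

theorem pa_zero_le (hM : Models S PA) (a : M) : S.le S.zero a :=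
  (pa_le_def hM _ _).2 ⟨a, pa_add_zero hM a⟩

theorem pa_le_refl (hM : Models S PA) (a : M) : S.le a a :=
  (pa_le_def hM _ _).2 ⟨S.zero, pa_zero_add hM a⟩

theorem pa_le_trans (hM : Models S PA) {a b c : M} (h1 : S.le a b) (h2 : S.le b c) : S.le a c := by
  obtain ⟨x, rfl⟩ := (pa_le_def hM _ _).1 h1
  obtain ⟨y, rfl⟩ := (pa_le_def hM _ _).1 h2
  exact (pa_le_def hM _ _).2 ⟨S.add y x, pa_add_assoc hM _ _ _⟩

theorem pa_le_add_left (hM : Models S PA) (a b : M) : S.le a (S.add b a) := (pa_le_def hM _ _).2 ⟨b, rfl⟩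

theorem pa_le_add_right (hM : Models S PA) (a b : M) : S.le a (S.add a b) :=
  (pa_le_def hM _ _).2 ⟨b, pa_add_comm hM _ _⟩

theorem pa_le_succ (hM : Models S PA) (a : M) : S.le a (S.succ a) :=
  (pa_le_def hM _ _).2 ⟨S.succ S.zero, by rw [pa_succ_add hM, pa_zero_add hM]⟩

theorem pa_succ_le_succ (hM : Models S PA) {a b : M} (h : S.le a b) : S.le (S.succ a) (S.succ b) := by
  obtain ⟨x, rfl⟩ := (pa_le_def hM _ _).1 h
  exact (pa_le_def hM _ _).2 ⟨x, pa_add_succ hM _ _⟩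

theorem pa_le_zero (hM : Models S PA) {a : M} (h : S.le a S.zero) : a = S.zero := by
  obtain ⟨x, hx⟩ := (pa_le_def hM _ _).1 h
  rcases pa_cases hM a with h | ⟨b, rfl⟩
  · exact h
  · rw [pa_add_succ hM] at hx
    exact absurd hx (pa_succ_ne_zero hM _)

theorem pa_le_succ_cases (hM : Models S PA) {a b : M} (h : S.le a (S.succ b)) : a = S.succ b ∨ S.le a b := by
  obtain ⟨x, hx⟩ := (pa_le_def hM _ _).1 h
  rcases pa_cases hM x with rfl | ⟨w, rfl⟩
  · rw [pa_zero_add hM] at hx; exact Or.inl hx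
  · rw [pa_succ_add hM] at hx
    exact Or.inr ((pa_le_def hM _ _).2 ⟨w, pa_succ_inj hM hx⟩)

theorem pa_trich (hM : Models S PA) (a b : M) : S.le a b ∨ S.le (S.succ b) a := by
  refine pa_ind hM (.or (.le (.var 0) (.var 1)) (.le (.succ (.var 1)) (.var 0)))
    (fun _ => b) ?_ ?_ a
  · exact Or.inl (pa_zero_le hM b)
  · intro a ha
    have ha : S.le a b ∨ S.le (S.succ b) a := ha
    show S.le (S.succ a) b ∨ S.le (S.succ b) (S.succ a)
    rcases ha with h | h
    · obtain ⟨x, hx⟩ := (pa_le_def hM _ _).1 h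
      rcases pa_cases hM x with rfl | ⟨w, rfl⟩
      · rw [pa_zero_add hM] at hx; subst hx
        exact Or.inr (pa_le_refl hM _)
      · rw [pa_succ_add hM, ← pa_add_succ hM] at hx
        exact Or.inl ((pa_le_def hM _ _).2 ⟨w, hx⟩)
    · exact Or.inr (pa_le_trans hM h (pa_le_succ hM a))

theorem pa_not_succ_le (hM : Models S PA) (a : M) : ¬ S.le (S.succ a) a := by
  intro h
  obtain ⟨x, hx⟩ := (pa_le_def hM _ _).1 h
  rw [pa_add_succ hM, ← pa_succ_add hM] at hx
  have : S.add (S.succ x) a = S.add S.zero a := by rw [hx, pa_zero_add hM]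
  exact pa_succ_ne_zero hM _ (pa_add_cancel hM _ _ _ this)

theorem pa_le_antisymm (hM : Models S PA) {a b : M} (h1 : S.le a b) (h2 : S.le b a) : a = b := by
  obtain ⟨x, hx⟩ := (pa_le_def hM _ _).1 h1
  rcases pa_cases hM x with rfl | ⟨w, rfl⟩
  · rw [pa_zero_add hM] at hx; exact hx
  · exfalso
    rw [pa_succ_add hM, ← pa_add_succ hM] at hx
    have h3 : S.le (S.succ a) b := (pa_le_def hM _ _).2 ⟨w, hx⟩
    exact pa_not_succ_le hM a (pa_le_trans hM h3 h2)

theorem pa_lnp (hM : Models S PA) (φ : AFml) (ρ : ℕ → M) (h : ∃ a, φ.Ms S (mcons a ρ)) :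
    ∃ b, φ.Ms S (mcons b ρ) ∧ ∀ c, S.le (S.succ c) b → ¬ φ.Ms S (mcons c ρ) := by
  by_contra hcon
  push Not at hcon
  obtain ⟨a, ha⟩ := h
  have key : ∀ b c, S.le c b → ¬ φ.Ms S (mcons c ρ) := by
    have hl : ∀ b c, (φ.lift 1).Ms S (mcons c (mcons b ρ)) ↔ φ.Ms S (mcons c ρ) := by
      intro b c
      rw [AFml.lift_eq, AFml.Ms_subst]
      have : (fun n => (ren 1 n).ev S (mcons c (mcons b ρ))) = mcons c ρ := by
        funext n; cases n <;> simp [ren, ATerm.ev]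
      rw [this]
    intro b
    have := pa_ind hM (.all (.imp (.le (.var 0) (.var 1)) (.neg (φ.lift 1)))) ρ ?_ ?_ b
    · intro c hc h
      exact this c hc ((hl b c).2 h)
    · intro c hc h
      have hc : S.le c S.zero := hc
      have := pa_le_zero hM hc
      subst this
      have h := (hl _ _).1 h
      obtain ⟨d, hd, _⟩ := hcon _ h
      have : S.le (S.succ d) d := pa_le_trans hM hd (pa_zero_le hM d)
      exact pa_not_succ_le hM _ this
    · intro b hb c hc h
      have hc : S.le c (S.succ b) := hc
      rcases pa_le_succ_cases hM hc with rfl | hc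
      · have h := (hl _ _).1 h
        obtain ⟨d, hd, hd'⟩ := hcon _ h
        rcases pa_le_succ_cases hM hd with h1 | h1
        · have := pa_succ_inj hM h1
          subst this
          exact hb d (pa_le_refl hM d) ((hl _ _).2 hd')
        · exact hb d (pa_le_trans hM (pa_le_succ hM d) h1) ((hl _ _).2 hd')
      · have h := (hl _ _).1 h
        exact hb c hc ((hl _ _).2 h)
  exact key a a (pa_le_refl hM a) ha

end PAModels

/-- Numerals in a structure. -/
def Str.num {M : Type} (S : Str M) : ℕ → M
  | 0 => S.zero
  | n + 1 => S.succ (S.num n)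

theorem numeral_ev {M : Type} (S : Str M) (ρ : ℕ → M) (n : ℕ) : (numeral n).ev S ρ = S.num n := by
  induction n with
  | zero => rfl
  | succ n ih => simp [numeral, ATerm.ev, ih, Str.num]

section PANum
variable {M : Type} {S : Str M}

theorem num_inj (hM : Models S PA) : ∀ {a b : ℕ}, S.num a = S.num b → a = b := by
  intro a
  induction a with
  | zero =>
    intro b h
    cases b with
    | zero => rfl
    | succ b => exact absurd h.symm (pa_succ_ne_zero hM _)
  | succ a ih =>
    intro b h
    cases b with
    | zero => exact absurd h (pa_succ_ne_zero hM _)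
    | succ b => rw [ih (pa_succ_inj hM h)]

theorem num_add (hM : Models S PA) (a b : ℕ) : S.num (a + b) = S.add (S.num a) (S.num b) := by
  induction b with
  | zero => exact (pa_add_zero hM _).symm
  | succ b ih =>
    show S.succ (S.num (a + b)) = S.add _ (S.succ _)
    rw [pa_add_succ hM, ih]

theorem num_mul (hM : Models S PA) (a b : ℕ) : S.num (a * b) = S.mul (S.num a) (S.num b) := by
  induction b with
  | zero => exact (pa_mul_zero hM _).symm
  | succ b ih =>
    show S.num (a * b + a) = S.mul _ (S.succ _)
    rw [pa_mul_succ hM, num_add hM, ih]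

theorem le_num (hM : Models S PA) {a : M} : ∀ {k : ℕ}, S.le a (S.num k) → ∃ j ≤ k, a = S.num j := by
  intro k
  induction k with
  | zero => intro h; exact ⟨0, le_rfl, pa_le_zero hM h⟩
  | succ k ih =>
    intro h
    rcases pa_le_succ_cases hM h with h | h
    · exact ⟨k + 1, le_rfl, h⟩
    · obtain ⟨j, hj, rfl⟩ := ih h
      exact ⟨j, by omega, rfl⟩

theorem num_le (hM : Models S PA) {a b : ℕ} : S.le (S.num a) (S.num b) ↔ a ≤ b := by
  constructor
  · intro h
    obtain ⟨j, hj, h⟩ := le_num hM h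
    rw [num_inj hM h]; exact hj
  · intro h
    obtain ⟨c, rfl⟩ := Nat.exists_eq_add_of_le h
    rw [num_add hM]; exact pa_le_add_right hM _ _

theorem num_le_nonstd (hM : Models S PA) {a : M} (ha : ∀ k, a ≠ S.num k) (k : ℕ) : S.le (S.num k) a := by
  rcases pa_trich hM a (S.num k) with h | h
  · obtain ⟨j, _, rfl⟩ := le_num hM h
    exact absurd rfl (ha j)
  · exact pa_le_trans hM (pa_le_succ hM _) h

theorem ev_num (hM : Models S PA) (ρ : ℕ → ℕ) (t : ATerm) : t.ev S (fun n => S.num (ρ n)) = S.num (t.val ρ) := by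
  induction t with
  | var n => rfl
  | zero => rfl
  | succ t ih => simp [ATerm.ev, ATerm.val, ih, Str.num]
  | add t s ih1 ih2 => simp [ATerm.ev, ATerm.val, ih1, ih2, num_add hM]
  | mul t s ih1 ih2 => simp [ATerm.ev, ATerm.val, ih1, ih2, num_mul hM]

theorem mcons_num (S : Str M) (a : ℕ) (ρ : ℕ → ℕ) :
    mcons (S.num a) (fun n => S.num (ρ n)) = fun n => S.num (consEnv a ρ n) := by
  funext n; cases n <;> rfl

theorem val_lift (a : ℕ) (ρ : ℕ → ℕ) (t : ATerm) : (t.lift 0).val (consEnv a ρ) = t.val ρ := by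
  induction t <;> simp_all [ATerm.lift, ATerm.val, consEnv]

theorem delta0_abs (hM : Models S PA) {φ : AFml} (h : IsDelta0 φ) : ∀ ρ : ℕ → ℕ,
    φ.Ms S (fun n => S.num (ρ n)) ↔ φ.Sat ρ := by
  induction h with
  | eq t s =>
    intro ρ
    simp only [AFml.Ms, AFml.Sat, ev_num hM]
    exact ⟨fun h => num_inj hM h, fun h => by rw [h]⟩
  | le t s => intro ρ; simp only [AFml.Ms, AFml.Sat, ev_num hM, num_le hM]
  | neg _ ih => intro ρ; simp only [AFml.Ms, AFml.Sat, ih]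
  | and _ _ ih1 ih2 => intro ρ; simp only [AFml.Ms, AFml.Sat, ih1, ih2]
  | or _ _ ih1 ih2 => intro ρ; simp only [AFml.Ms, AFml.Sat, ih1, ih2]
  | imp _ _ ih1 ih2 => intro ρ; simp only [AFml.Ms, AFml.Sat, ih1, ih2]
  | ball t _ ih =>
    intro ρ
    simp only [AFml.Ms, AFml.Sat, ATerm.ev_lift, ev_num hM, val_lift]
    constructor
    · intro h a ha
      rw [← ih, ← mcons_num]
      exact h (S.num a) ((num_le hM).2 ha)
    · intro h a ha
      obtain ⟨j, hj, rfl⟩ := le_num hM ha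
      rw [mcons_num, ih]
      exact h j hj
  | bex t _ ih =>
    intro ρ
    simp only [AFml.Ms, AFml.Sat, ATerm.ev_lift, ev_num hM, val_lift]
    constructor
    · rintro ⟨a, ha, h⟩
      obtain ⟨j, hj, rfl⟩ := le_num hM ha
      rw [mcons_num, ih] at h
      exact ⟨j, hj, h⟩
    · rintro ⟨a, ha, h⟩
      refine ⟨S.num a, (num_le hM).2 ha, ?_⟩
      rw [mcons_num, ih]
      exact h

end PANum

/-! ### The standard model as a structure -/

def natStr : Str ℕ := ⟨0, Nat.succ, (· + ·), (· * ·), (· ≤ ·)⟩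

theorem natStr_num (n : ℕ) : natStr.num n = n := by
  induction n with
  | zero => rfl
  | succ n ih =>
    show Nat.succ (natStr.num n) = n + 1
    rw [ih]

theorem natStr_ev (ρ : ℕ → ℕ) (t : ATerm) : t.ev natStr ρ = t.val ρ := by
  induction t <;> simp_all [ATerm.ev, ATerm.val, natStr]

theorem natStr_Ms (φ : AFml) : ∀ ρ : ℕ → ℕ, φ.Ms natStr ρ ↔ φ.Sat ρ := by
  have key : ∀ (a : ℕ) (ρ : ℕ → ℕ), mcons a ρ = consEnv a ρ := by
    intro a ρ; funext n; cases n <;> rfl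
  induction φ with
  | eq t s => intro ρ; simp only [AFml.Ms, AFml.Sat, natStr_ev]
  | le t s => intro ρ; simp only [AFml.Ms, AFml.Sat, natStr_ev]; rfl
  | neg φ ih => intro ρ; simp only [AFml.Ms, AFml.Sat, ih]
  | and φ ψ ih1 ih2 => intro ρ; simp only [AFml.Ms, AFml.Sat, ih1, ih2]
  | or φ ψ ih1 ih2 => intro ρ; simp only [AFml.Ms, AFml.Sat, ih1, ih2]
  | imp φ ψ ih1 ih2 => intro ρ; simp only [AFml.Ms, AFml.Sat, ih1, ih2]
  | all φ ih => intro ρ; simp only [AFml.Ms, AFml.Sat, ih, key]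
  | ex φ ih => intro ρ; simp only [AFml.Ms, AFml.Sat, ih, key]

theorem natStr_PA : Models natStr PA := by
  intro φ hφ ρ
  cases hφ with
  | succNeZero => intro a; exact Nat.succ_ne_zero a
  | succInj => intro a b h; exact Nat.succ.inj h
  | addZero => intro a; rfl
  | addSucc => intro a b; rfl
  | mulZero => intro a; rfl
  | mulSucc => intro a b; rfl
  | leDef =>
    intro a b
    constructor
    · intro h
      exact ⟨b - a, Nat.sub_add_cancel h⟩
    · rintro ⟨z, hz⟩
      have hz : z + a = b := hz
      show a ≤ b
      omega
  | ind φ =>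
    rintro ⟨h0, hs⟩ a
    rw [AFml.Ms_subst0] at h0
    induction a with
    | zero => exact h0
    | succ a ih => exact (succSubst_Ms φ a ρ).1 (hs a ih)

theorem PA_true {φ : AFml} (h : Proves PA φ) (ρ : ℕ → ℕ) : φ.Sat ρ :=
  (natStr_Ms φ ρ).1 (soundness natStr_PA h ρ)

theorem Sat_subst (φ : AFml) (ρ : ℕ → ℕ) (σ : ℕ → ATerm) :
    (φ.substAll σ).Sat ρ ↔ φ.Sat (fun n => (σ n).val ρ) := by
  rw [← natStr_Ms, AFml.Ms_subst, natStr_Ms]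
  simp only [natStr_ev]

theorem Sat_congr (φ : AFml) {c : ℕ} {ρ ρ' : ℕ → ℕ} (h : ∀ n < c, ρ n = ρ' n) (hf : φ.FreeLt c) :
    φ.Sat ρ ↔ φ.Sat ρ' := by
  rw [← natStr_Ms, ← natStr_Ms]
  exact AFml.Ms_congr natStr φ h hf

theorem val_numeral (ρ : ℕ → ℕ) (n : ℕ) : (numeral n).val ρ = n := by
  rw [← natStr_ev, numeral_ev, natStr_num]

/-! ### Prenexing -/

theorem IsDelta0.subst {φ : AFml} (h : IsDelta0 φ) : ∀ σ : ℕ → ATerm, IsDelta0 (φ.substAll σ) := by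
  induction h with
  | eq t s => intro σ; exact .eq _ _
  | le t s => intro σ; exact .le _ _
  | neg _ ih => intro σ; exact .neg (ih σ)
  | and _ _ ih1 ih2 => intro σ; exact .and (ih1 σ) (ih2 σ)
  | or _ _ ih1 ih2 => intro σ; exact .or (ih1 σ) (ih2 σ)
  | imp _ _ ih1 ih2 => intro σ; exact .imp (ih1 σ) (ih2 σ)
  | ball t _ ih =>
    intro σ
    have := IsDelta0.ball (t.substAll σ) (ih (liftSub σ))
    rw [← ATerm.lift0_substAll] at this
    exact this
  | bex t _ ih =>
    intro σ
    have := IsDelta0.bex (t.substAll σ) (ih (liftSub σ))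
    rw [← ATerm.lift0_substAll] at this
    exact this

/-- bounded quantifiers -/
def bexF (t : ATerm) (φ : AFml) : AFml := .ex (.and (.le (.var 0) (ATerm.lift 0 t)) φ)
def ballF (t : ATerm) (φ : AFml) : AFml := .all (.imp (.le (.var 0) (ATerm.lift 0 t)) φ)

theorem bexF_Ms {M : Type} (S : Str M) (ρ : ℕ → M) (t : ATerm) (φ : AFml) :
    (bexF t φ).Ms S ρ ↔ ∃ a, S.le a (t.ev S ρ) ∧ φ.Ms S (mcons a ρ) := by
  simp only [bexF, AFml.Ms, ATerm.ev_lift]; rfl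

theorem ballF_Ms {M : Type} (S : Str M) (ρ : ℕ → M) (t : ATerm) (φ : AFml) :
    (ballF t φ).Ms S ρ ↔ ∀ a, S.le a (t.ev S ρ) → φ.Ms S (mcons a ρ) := by
  simp only [ballF, AFml.Ms, ATerm.ev_lift]; rfl

theorem bexF_Sat (ρ : ℕ → ℕ) (t : ATerm) (φ : AFml) :
    (bexF t φ).Sat ρ ↔ ∃ a ≤ t.val ρ, φ.Sat (consEnv a ρ) := by
  simp only [bexF, AFml.Sat, val_lift]; rfl

theorem ballF_Sat (ρ : ℕ → ℕ) (t : ATerm) (φ : AFml) :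
    (ballF t φ).Sat ρ ↔ ∀ a ≤ t.val ρ, φ.Sat (consEnv a ρ) := by
  simp only [ballF, AFml.Sat, val_lift]; rfl

def Pre (φ : AFml) : Prop := ∃ δ, IsDelta0 δ ∧
  (∀ (M : Type) (S : Str M), Models S PA → ∀ ρ, φ.Ms S ρ → ∃ y, δ.Ms S (mcons y ρ)) ∧
  (∀ ρ y, δ.Sat (consEnv y ρ) → φ.Sat ρ)

theorem Pre.delta0 {φ : AFml} (h : IsDelta0 φ) : Pre φ := by
  refine ⟨φ.lift 0, ?_, ?_, ?_⟩
  · rw [AFml.lift_eq]; exact h.subst _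
  · intro M S _ ρ h; exact ⟨S.zero, (AFml.Ms_lift S φ ρ _).2 h⟩
  · intro ρ y h
    rw [AFml.lift_eq, Sat_subst, ren_zero] at h
    exact h

theorem Pre.or {φ ψ : AFml} (h1 : Pre φ) (h2 : Pre ψ) : Pre (.or φ ψ) := by
  obtain ⟨d, hd, h1, h1'⟩ := h1
  obtain ⟨e, he, h2, h2'⟩ := h2
  refine ⟨.or d e, .or hd he, ?_, ?_⟩
  · rintro M S hS ρ (h | h)
    · obtain ⟨y, hy⟩ := h1 M S hS ρ h; exact ⟨y, Or.inl hy⟩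
    · obtain ⟨y, hy⟩ := h2 M S hS ρ h; exact ⟨y, Or.inr hy⟩
  · rintro ρ y (h | h)
    · exact Or.inl (h1' ρ y h)
    · exact Or.inr (h2' ρ y h)

theorem Pre.and {φ ψ : AFml} (h1 : Pre φ) (h2 : Pre ψ) : Pre (.and φ ψ) := by
  obtain ⟨d, hd, h1, h1'⟩ := h1
  obtain ⟨e, he, h2, h2'⟩ := h2
  let σ1 : ℕ → ATerm := scons (.var 0) (fun n => .var (n + 2))
  refine ⟨.and (bexF (.var 0) (d.substAll σ1)) (bexF (.var 0) (e.substAll σ1)),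
    .and (.bex _ (hd.subst _)) (.bex _ (he.subst _)), ?_, ?_⟩
  · rintro M S hS ρ ⟨h, h'⟩
    obtain ⟨y, hy⟩ := h1 M S hS ρ h
    obtain ⟨z, hz⟩ := h2 M S hS ρ h'
    refine ⟨S.add y z, ?_⟩
    have e1 : ∀ a b, (fun n => (σ1 n).ev S (mcons a (mcons b ρ))) = mcons a ρ := by
      intro a b; funext n; cases n <;> rfl
    simp only [AFml.Ms, bexF_Ms, AFml.Ms_subst, e1]
    exact ⟨⟨y, pa_le_add_right hS _ _, hy⟩, ⟨z, pa_le_add_left hS _ _, hz⟩⟩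
  · intro ρ y h
    have e1 : ∀ a b, (fun n => (σ1 n).val (consEnv a (consEnv b ρ))) = consEnv a ρ := by
      intro a b; funext n; cases n <;> rfl
    simp only [AFml.Sat, bexF_Sat, Sat_subst, e1] at h
    obtain ⟨⟨a, _, ha⟩, ⟨b, _, hb⟩⟩ := h
    exact ⟨h1' _ _ ha, h2' _ _ hb⟩

theorem Pre.ex {φ : AFml} (h1 : Pre φ) : Pre (.ex φ) := by
  obtain ⟨d, hd, h1, h1'⟩ := h1
  let σ1 : ℕ → ATerm := scons (.var 0) (scons (.var 1) (fun n => .var (n + 3)))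
  refine ⟨bexF (.var 0) (bexF (.var 1) (d.substAll σ1)), .bex _ (.bex _ (hd.subst _)), ?_, ?_⟩
  · rintro M S hS ρ ⟨x, hx⟩
    obtain ⟨y, hy⟩ := h1 M S hS _ hx
    refine ⟨S.add x y, ?_⟩
    have e1 : ∀ a b c, (fun n => (σ1 n).ev S (mcons a (mcons b (mcons c ρ)))) = mcons a (mcons b ρ) := by
      intro a b c; funext n; rcases n with _ | _ | n <;> rfl
    simp only [bexF_Ms, AFml.Ms_subst, e1]
    exact ⟨x, pa_le_add_right hS _ _, y, pa_le_add_left hS _ _, hy⟩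
  · intro ρ y h
    have e1 : ∀ a b c, (fun n => (σ1 n).val (consEnv a (consEnv b (consEnv c ρ))))
        = consEnv a (consEnv b ρ) := by
      intro a b c; funext n; rcases n with _ | _ | n <;> rfl
    simp only [bexF_Sat, Sat_subst, e1] at h
    obtain ⟨a, _, b, _, h⟩ := h
    exact ⟨a, h1' _ _ h⟩

theorem Pre.congr {φ ψ : AFml} (h1 : Pre φ)
    (h : ∀ (M : Type) (S : Str M) ρ, ψ.Ms S ρ ↔ φ.Ms S ρ) : Pre ψ := by
  obtain ⟨d, hd, h1, h1'⟩ := h1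
  refine ⟨d, hd, fun M S hS ρ hh => h1 M S hS ρ ((h M S ρ).1 hh), fun ρ y hh => ?_⟩
  rw [← natStr_Ms, h, natStr_Ms]
  exact h1' ρ y hh

theorem pre_main (φ : AFml) : (IsSigma1 φ → Pre φ) ∧ (IsPi1 φ → Pre (.neg φ)) := by
  induction φ with
  | eq t s =>
    exact ⟨fun _ => .delta0 (.eq t s), fun _ => .delta0 (.neg (.eq t s))⟩
  | le t s =>
    exact ⟨fun _ => .delta0 (.le t s), fun _ => .delta0 (.neg (.le t s))⟩
  | neg φ ih =>
    refine ⟨fun h => ?_, fun h => ?_⟩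
    · cases h with
      | delta0 h => exact .delta0 h
      | negPi h => exact ih.2 h
    · cases h with
      | delta0 h => exact .delta0 (.neg h)
      | negSigma h => exact (ih.1 h).congr fun M S ρ => by simp [AFml.Ms]
  | and φ ψ ih1 ih2 =>
    refine ⟨fun h => ?_, fun h => ?_⟩
    · cases h with
      | delta0 h => exact .delta0 h
      | and h h' => exact (ih1.1 h).and (ih2.1 h')
    · cases h with
      | delta0 h => exact .delta0 (.neg h)
      | and h h' =>
        exact ((ih1.2 h).or (ih2.2 h')).congr fun M S ρ => by simp only [AFml.Ms]; tauto
  | or φ ψ ih1 ih2 =>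
    refine ⟨fun h => ?_, fun h => ?_⟩
    · cases h with
      | delta0 h => exact .delta0 h
      | or h h' => exact (ih1.1 h).or (ih2.1 h')
    · cases h with
      | delta0 h => exact .delta0 (.neg h)
      | or h h' =>
        exact ((ih1.2 h).and (ih2.2 h')).congr fun M S ρ => by simp only [AFml.Ms]; tauto
  | imp φ ψ ih1 ih2 =>
    refine ⟨fun h => ?_, fun h => ?_⟩
    · cases h with
      | delta0 h => exact .delta0 h
      | impPiSigma h h' =>
        exact ((ih1.2 h).or (ih2.1 h')).congr fun M S ρ => by simp only [AFml.Ms]; tauto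
    · cases h with
      | delta0 h => exact .delta0 (.neg h)
      | impSigmaPi h h' =>
        exact ((ih1.1 h).and (ih2.2 h')).congr fun M S ρ => by simp only [AFml.Ms]; tauto
  | all φ ih =>
    refine ⟨fun h => ?_, fun h => ?_⟩
    · cases h with
      | delta0 h => exact .delta0 h
    · cases h with
      | delta0 h => exact .delta0 (.neg h)
      | all h => exact (ih.2 h).ex.congr fun M S ρ => by simp [AFml.Ms]
  | ex φ ih =>
    refine ⟨fun h => ?_, fun h => ?_⟩
    · cases h with
      | delta0 h => exact .delta0 h
      | ex h => exact (ih.1 h).ex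
    · cases h with
      | delta0 h => exact .delta0 (.neg h)

/-- A Δ₀ formula witnessing the Σ₁-illness of `T`. -/
theorem exists_ill {Tax : Set AFml} (hext : PA ⊆ Tax) (hill : ¬ Sigma1Sound Tax) :
    ∃ δ : AFml, IsDelta0 δ ∧ δ.FreeLt 1 ∧
      (∀ (M : Type) (S : Str M), Models S Tax → ∀ ρ, ∃ y, δ.Ms S (mcons y ρ)) ∧
      (∀ ρ y, ¬ δ.Sat (consEnv y ρ)) := by
  unfold Sigma1Sound at hill
  push Not at hill
  obtain ⟨φ, hφ, _, hp, hf⟩ := hill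
  obtain ⟨δ, hδ, h1, h2⟩ := (pre_main φ).1 hφ
  let σ : ℕ → ATerm := scons (.var 0) (fun _ => .zero)
  refine ⟨δ.substAll σ, hδ.subst σ, ?_, ?_, ?_⟩
  · obtain ⟨c, hc⟩ := δ.exists_freeLt
    refine AFml.FreeLt.subst δ (fun n _ => ?_) hc
    cases n with
    | zero => exact Nat.zero_lt_one
    | succ n => trivial
  · intro M S hS ρ
    obtain ⟨y, hy⟩ := h1 M S (fun ψ hψ => hS ψ (hext hψ)) (fun _ => S.zero) (soundness hS hp _)
    refine ⟨y, ?_⟩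
    rw [AFml.Ms_subst]
    have : (fun n => (σ n).ev S (mcons y ρ)) = mcons y (fun _ => S.zero) := by
      funext n; cases n <;> rfl
    rwa [this]
  · intro ρ y h
    rw [Sat_subst] at h
    have : (fun n => (σ n).val (consEnv y ρ)) = consEnv y (fun _ => 0) := by
      funext n; cases n <;> rfl
    rw [this] at h
    exact hf (h2 _ _ h)


/-! ### Semantic definability over the standard model -/

/-- Tail of an environment. -/
abbrev tl (ρ : ℕ → ℕ) : ℕ → ℕ := fun n => ρ (n + 1)

theorem consEnv_tl (ρ : ℕ → ℕ) : consEnv (ρ 0) (tl ρ) = ρ := by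
  funext n; cases n <;> rfl

theorem tl_consEnv (a : ℕ) (ρ : ℕ → ℕ) : tl (consEnv a ρ) = ρ := rfl

def TF (f : (ℕ → ℕ) → ℕ) : Prop := ∃ t : ATerm, ∀ ρ, t.val ρ = f ρ

def D0 (R : (ℕ → ℕ) → Prop) : Prop := ∃ φ, IsDelta0 φ ∧ ∀ ρ, φ.Sat ρ ↔ R ρ

theorem TF.var (n : ℕ) : TF fun ρ => ρ n := ⟨.var n, fun _ => rfl⟩
theorem TF.const (c : ℕ) : TF fun _ => c := ⟨numeral c, fun ρ => val_numeral ρ c⟩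
theorem TF.add {f g : (ℕ → ℕ) → ℕ} (hf : TF f) (hg : TF g) : TF fun ρ => f ρ + g ρ := by
  obtain ⟨t, ht⟩ := hf; obtain ⟨s, hs⟩ := hg
  exact ⟨.add t s, fun ρ => by simp [ATerm.val, ht, hs]⟩
theorem TF.mul {f g : (ℕ → ℕ) → ℕ} (hf : TF f) (hg : TF g) : TF fun ρ => f ρ * g ρ := by
  obtain ⟨t, ht⟩ := hf; obtain ⟨s, hs⟩ := hg
  exact ⟨.mul t s, fun ρ => by simp [ATerm.val, ht, hs]⟩
theorem TF.subst {f : (ℕ → ℕ) → ℕ} (hf : TF f) (g : ℕ → (ℕ → ℕ) → ℕ) (hg : ∀ n, TF (g n)) :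
    TF fun ρ => f (fun n => g n ρ) := by
  obtain ⟨t, ht⟩ := hf
  choose s hs using hg
  refine ⟨t.substAll s, fun ρ => ?_⟩
  rw [← natStr_ev, ATerm.ev_subst, natStr_ev]
  simp only [natStr_ev, hs, ht]

theorem D0.eq {f g : (ℕ → ℕ) → ℕ} (hf : TF f) (hg : TF g) : D0 fun ρ => f ρ = g ρ := by
  obtain ⟨t, ht⟩ := hf; obtain ⟨s, hs⟩ := hg
  exact ⟨.eq t s, .eq t s, fun ρ => by simp [AFml.Sat, ht, hs]⟩
theorem D0.le {f g : (ℕ → ℕ) → ℕ} (hf : TF f) (hg : TF g) : D0 fun ρ => f ρ ≤ g ρ := by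
  obtain ⟨t, ht⟩ := hf; obtain ⟨s, hs⟩ := hg
  exact ⟨.le t s, .le t s, fun ρ => by simp [AFml.Sat, ht, hs]⟩
theorem D0.lt {f g : (ℕ → ℕ) → ℕ} (hf : TF f) (hg : TF g) : D0 fun ρ => f ρ < g ρ :=
  D0.le (hf.add (TF.const 1)) hg
theorem D0.not {R : (ℕ → ℕ) → Prop} (h : D0 R) : D0 fun ρ => ¬ R ρ := by
  obtain ⟨φ, hφ, h⟩ := h
  exact ⟨.neg φ, .neg hφ, fun ρ => by simp [AFml.Sat, h]⟩
theorem D0.and {R Q : (ℕ → ℕ) → Prop} (h : D0 R) (h' : D0 Q) : D0 fun ρ => R ρ ∧ Q ρ := by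
  obtain ⟨φ, hφ, h⟩ := h; obtain ⟨ψ, hψ, h'⟩ := h'
  exact ⟨.and φ ψ, .and hφ hψ, fun ρ => by simp [AFml.Sat, h, h']⟩
theorem D0.or {R Q : (ℕ → ℕ) → Prop} (h : D0 R) (h' : D0 Q) : D0 fun ρ => R ρ ∨ Q ρ := by
  obtain ⟨φ, hφ, h⟩ := h; obtain ⟨ψ, hψ, h'⟩ := h'
  exact ⟨.or φ ψ, .or hφ hψ, fun ρ => by simp [AFml.Sat, h, h']⟩
theorem D0.imp {R Q : (ℕ → ℕ) → Prop} (h : D0 R) (h' : D0 Q) : D0 fun ρ => R ρ → Q ρ := by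
  obtain ⟨φ, hφ, h⟩ := h; obtain ⟨ψ, hψ, h'⟩ := h'
  exact ⟨.imp φ ψ, .imp hφ hψ, fun ρ => by simp [AFml.Sat, h, h']⟩
theorem D0.bex {f : (ℕ → ℕ) → ℕ} {R : ℕ → (ℕ → ℕ) → Prop} (hf : TF f)
    (h : D0 fun ρ => R (ρ 0) (tl ρ)) : D0 fun ρ => ∃ a ≤ f ρ, R a ρ := by
  obtain ⟨φ, hφ, h⟩ := h; obtain ⟨t, ht⟩ := hf
  refine ⟨bexF t φ, .bex t hφ, fun ρ => ?_⟩
  rw [bexF_Sat, ht]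
  simp only [h]
  rfl
theorem D0.ball {f : (ℕ → ℕ) → ℕ} {R : ℕ → (ℕ → ℕ) → Prop} (hf : TF f)
    (h : D0 fun ρ => R (ρ 0) (tl ρ)) : D0 fun ρ => ∀ a ≤ f ρ, R a ρ := by
  obtain ⟨φ, hφ, h⟩ := h; obtain ⟨t, ht⟩ := hf
  refine ⟨ballF t φ, .ball t hφ, fun ρ => ?_⟩
  rw [ballF_Sat, ht]
  simp only [h]
  rfl
theorem D0.subst {R : (ℕ → ℕ) → Prop} (h : D0 R) (g : ℕ → (ℕ → ℕ) → ℕ) (hg : ∀ n, TF (g n)) :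
    D0 fun ρ => R (fun n => g n ρ) := by
  obtain ⟨φ, hφ, h⟩ := h
  choose s hs using hg
  refine ⟨φ.substAll s, hφ.subst s, fun ρ => ?_⟩
  rw [Sat_subst]
  simp only [hs, h]
theorem D0.congr {R Q : (ℕ → ℕ) → Prop} (h : D0 R) (h' : ∀ ρ, Q ρ ↔ R ρ) : D0 Q := by
  obtain ⟨φ, hφ, h⟩ := h
  exact ⟨φ, hφ, fun ρ => (h ρ).trans (h' ρ).symm⟩

theorem D0.fml {R : (ℕ → ℕ) → Prop} (h : D0 R) (k : ℕ)
    (hR : ∀ ρ ρ' : ℕ → ℕ, (∀ n < k, ρ n = ρ' n) → (R ρ → R ρ')) :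
    ∃ φ, IsDelta0 φ ∧ φ.FreeLt k ∧ ∀ ρ, φ.Sat ρ ↔ R ρ := by
  obtain ⟨φ, hφ, h⟩ := h
  let σ : ℕ → ATerm := fun n => if n < k then .var n else .zero
  refine ⟨φ.substAll σ, hφ.subst σ, ?_, fun ρ => ?_⟩
  · obtain ⟨c, hc⟩ := φ.exists_freeLt
    refine AFml.FreeLt.subst φ (fun n _ => ?_) hc
    by_cases hn : n < k
    · simpa [σ, hn, ATerm.FreeLt] using hn
    · simp [σ, hn, ATerm.FreeLt]
  · rw [Sat_subst, h]
    constructor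
    · apply hR; intro n hn; simp [σ, hn, ATerm.val]
    · apply hR; intro n hn; simp [σ, hn, ATerm.val]

/-- Σ₁ relations. -/
def S1 (R : (ℕ → ℕ) → Prop) : Prop := ∃ D, D0 D ∧ ∀ ρ, R ρ ↔ ∃ y, D (consEnv y ρ)

theorem S1.congr {R Q : (ℕ → ℕ) → Prop} (h : S1 R) (h' : ∀ ρ, Q ρ ↔ R ρ) : S1 Q := by
  obtain ⟨D, hD, h⟩ := h
  exact ⟨D, hD, fun ρ => (h' ρ).trans (h ρ)⟩

theorem S1.ofD0 {R : (ℕ → ℕ) → Prop} (h : D0 R) : S1 R :=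
  ⟨fun ρ => R (tl ρ), h.subst (fun n ρ => ρ (n + 1)) (fun n => TF.var _), fun ρ => by simp [tl_consEnv]⟩

theorem S1.and {R Q : (ℕ → ℕ) → Prop} (h : S1 R) (h' : S1 Q) : S1 fun ρ => R ρ ∧ Q ρ := by
  obtain ⟨D, hD, h⟩ := h; obtain ⟨E, hE, h'⟩ := h'
  have aux : ∀ {D : (ℕ → ℕ) → Prop}, D0 D →
      D0 fun ρ => ∃ a ≤ ρ 0, D (consEnv a (tl ρ)) := by
    intro D hD
    refine D0.bex (TF.var 0) (R := fun a ρ => D (consEnv a (tl ρ))) ?_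
    refine (hD.subst (fun n ρ => if n = 0 then ρ 0 else ρ (n + 1)) ?_).congr ?_
    · intro n; by_cases hn : n = 0
      · simp only [hn]; exact TF.var 0
      · simp only [hn]; exact TF.var _
    · intro ρ
      have : consEnv (ρ 0) (tl (tl ρ)) = fun n => if n = 0 then ρ 0 else ρ (n + 1) := by
        funext n; cases n <;> simp [consEnv]
      rw [this]
  refine ⟨_, (aux hD).and (aux hE), fun ρ => ?_⟩
  beta_reduce
  rw [h, h']
  constructor
  · rintro ⟨⟨a, ha⟩, ⟨b, hb⟩⟩
    exact ⟨a + b, ⟨a, Nat.le_add_right a b, ha⟩, ⟨b, Nat.le_add_left b a, hb⟩⟩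
  · rintro ⟨y, ⟨a, _, ha⟩, ⟨b, _, hb⟩⟩
    exact ⟨⟨a, ha⟩, ⟨b, hb⟩⟩

theorem S1.or {R Q : (ℕ → ℕ) → Prop} (h : S1 R) (h' : S1 Q) : S1 fun ρ => R ρ ∨ Q ρ := by
  obtain ⟨D, hD, h⟩ := h; obtain ⟨E, hE, h'⟩ := h'
  refine ⟨_, hD.or hE, fun ρ => ?_⟩
  beta_reduce
  rw [h, h', exists_or]

theorem S1.subst {R : (ℕ → ℕ) → Prop} (h : S1 R) (g : ℕ → (ℕ → ℕ) → ℕ) (hg : ∀ n, TF (g n)) :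
    S1 fun ρ => R (fun n => g n ρ) := by
  obtain ⟨D, hD, h⟩ := h
  refine ⟨_, hD.subst (fun n ρ => Nat.casesOn n (ρ 0) (fun n => g n (tl ρ))) ?_, fun ρ => ?_⟩
  · intro n
    cases n with
    | zero => exact TF.var 0
    | succ n => exact (hg n).subst (fun n ρ => ρ (n + 1)) (fun n => TF.var _)
  · beta_reduce
    rw [h]
    apply exists_congr; intro y
    have : (consEnv y fun n => g n ρ) = fun n => Nat.casesOn n (consEnv y ρ 0)
        (fun n => g n (tl (consEnv y ρ))) := by
      funext n; cases n <;> rfl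
    rw [this]

/-- Two-variable version of the swap needed for `ex` and `ball`. -/
theorem D0.swap {D : (ℕ → ℕ) → Prop} (hD : D0 D) :
    D0 fun ρ => D (consEnv (ρ 0) (consEnv (ρ 1) (tl (tl (tl ρ))))) := by
  refine (hD.subst (fun n ρ => if n < 2 then ρ n else ρ (n + 1)) ?_).congr ?_
  · intro n; by_cases hn : n < 2
    · simp only [hn]; exact TF.var n
    · simp only [hn]; exact TF.var _
  · intro ρ
    have : consEnv (ρ 0) (consEnv (ρ 1) (tl (tl (tl ρ)))) = fun n => if n < 2 then ρ n else ρ (n + 1) := by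
      funext n; rcases n with _ | _ | n <;> simp [consEnv]
    rw [this]

theorem S1.ex {R : ℕ → (ℕ → ℕ) → Prop} (h : S1 fun ρ => R (ρ 0) (tl ρ)) :
    S1 fun ρ => ∃ a, R a ρ := by
  obtain ⟨D, hD, h⟩ := h
  refine ⟨fun ρ => ∃ a ≤ ρ 0, ∃ y ≤ ρ 0, D (consEnv y (consEnv a (tl ρ))), ?_, fun ρ => ?_⟩
  · refine D0.bex (TF.var 0) (R := fun a ρ => ∃ y ≤ ρ 0, D (consEnv y (consEnv a (tl ρ)))) ?_
    refine D0.bex (TF.var 1) (R := fun y ρ => D (consEnv y (consEnv (ρ 0) (tl (tl ρ))))) ?_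
    exact hD.swap
  · have h2 : ∀ a, R a ρ ↔ ∃ y, D (consEnv y (consEnv a ρ)) := fun a => h (consEnv a ρ)
    simp only [h2]
    constructor
    · rintro ⟨a, y, hy⟩
      exact ⟨a + y, a, Nat.le_add_right a y, y, Nat.le_add_left y a, hy⟩
    · rintro ⟨_, a, _, y, _, hy⟩
      exact ⟨a, y, hy⟩

theorem S1.ballT {f : (ℕ → ℕ) → ℕ} {R : ℕ → (ℕ → ℕ) → Prop} (hf : TF f)
    (h : S1 fun ρ => R (ρ 0) (tl ρ)) : S1 fun ρ => ∀ a ≤ f ρ, R a ρ := by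
  obtain ⟨D, hD, h⟩ := h
  refine ⟨fun ρ => ∀ a ≤ f (tl ρ), ∃ y ≤ ρ 0, D (consEnv y (consEnv a (tl ρ))), ?_, fun ρ => ?_⟩
  · refine D0.ball (f := fun ρ => f (tl ρ)) (hf.subst (fun n ρ => ρ (n + 1)) (fun n => TF.var _))
      (R := fun a ρ => ∃ y ≤ ρ 0, D (consEnv y (consEnv a (tl ρ)))) ?_
    refine D0.bex (TF.var 1) (R := fun y ρ => D (consEnv y (consEnv (ρ 0) (tl (tl ρ))))) ?_
    exact hD.swap
  · have h2 : ∀ a, R a ρ ↔ ∃ y, D (consEnv y (consEnv a ρ)) := fun a => h (consEnv a ρ)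
    simp only [h2]
    show (∀ a ≤ f ρ, _) ↔ ∃ Y, ∀ a ≤ f ρ, ∃ y ≤ Y, D (consEnv y (consEnv a ρ))
    generalize f ρ = n
    constructor
    · intro H
      induction n with
      | zero =>
        obtain ⟨y, hy⟩ := H 0 le_rfl
        refine ⟨y, fun a ha => ⟨y, le_rfl, ?_⟩⟩
        obtain rfl : a = 0 := by omega
        exact hy
      | succ n ih =>
        obtain ⟨Y, hY⟩ := ih fun a ha => H a (by omega)
        obtain ⟨y, hy⟩ := H (n + 1) le_rfl
        refine ⟨Y + y, fun a ha => ?_⟩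
        rcases Nat.lt_or_ge n a with h | h
        · obtain rfl : a = n + 1 := by omega
          exact ⟨y, Nat.le_add_left _ _, hy⟩
        · obtain ⟨z, hz, hz'⟩ := hY a h
          exact ⟨z, by omega, hz'⟩
    · rintro ⟨Y, hY⟩ a ha
      obtain ⟨y, _, hy⟩ := hY a ha
      exact ⟨y, hy⟩

/-- Functions with Σ₁ graph. -/
def SF (f : (ℕ → ℕ) → ℕ) : Prop := S1 fun ρ => ρ 0 = f (tl ρ)

theorem S1.bind {f : (ℕ → ℕ) → ℕ} {R : ℕ → (ℕ → ℕ) → Prop} (hf : SF f)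
    (h : S1 fun ρ => R (ρ 0) (tl ρ)) : S1 fun ρ => R (f ρ) ρ := by
  refine (S1.ex (R := fun a ρ => a = f ρ ∧ R a ρ) (hf.and h)).congr fun ρ => ?_
  simp

theorem S1.tl {R : (ℕ → ℕ) → Prop} (h : S1 R) : S1 fun ρ => R (tl ρ) :=
  h.subst (fun n ρ => ρ (n + 1)) (fun n => TF.var _)

theorem TF.tl {R : (ℕ → ℕ) → ℕ} (h : TF R) : TF fun ρ => R (tl ρ) :=
  h.subst (fun n ρ => ρ (n + 1)) (fun n => TF.var _)

theorem TF.sf {f : (ℕ → ℕ) → ℕ} (h : TF f) : SF f := S1.ofD0 (D0.eq (TF.var 0) h.tl)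

theorem SF.tl {f : (ℕ → ℕ) → ℕ} (h : SF f) : SF fun ρ => f (tl ρ) := by
  refine (S1.subst h (fun n ρ => if n = 0 then ρ 0 else ρ (n + 1)) ?_).congr ?_
  · intro n; by_cases hn : n = 0
    · simp only [hn]; exact TF.var 0
    · simp only [hn]; exact TF.var _
  · intro ρ
    have e : (PLN.tl fun n => if n = 0 then ρ 0 else ρ (n + 1)) = PLN.tl (PLN.tl ρ) := by
      funext n; rfl
    rw [e]; simp

theorem SF.var (n : ℕ) : SF fun ρ => ρ n := (TF.var n).sf
theorem SF.const (c : ℕ) : SF fun _ => c := (TF.const c).sf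

theorem S1.comp1 {R : ℕ → Prop} (h : S1 fun ρ => R (ρ 0)) {f : (ℕ → ℕ) → ℕ} (hf : SF f) :
    S1 fun ρ => R (f ρ) := S1.bind (R := fun a _ => R a) hf h

theorem S1.comp2 {R : ℕ → ℕ → Prop} (h : S1 fun ρ => R (ρ 0) (ρ 1)) {f g : (ℕ → ℕ) → ℕ}
    (hf : SF f) (hg : SF g) : S1 fun ρ => R (f ρ) (g ρ) := by
  refine S1.bind (R := fun a ρ => R a (g ρ)) hf ?_
  refine S1.bind (R := fun a ρ => R (ρ 0) a) hg.tl ?_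
  refine (h.subst (fun n ρ => if n = 0 then ρ 1 else ρ 0) ?_).congr fun ρ => by simp [PLN.tl]
  intro n; by_cases hn : n = 0
  · simp only [hn]; exact TF.var 1
  · simp only [hn]; exact TF.var _

theorem S1.comp3 {R : ℕ → ℕ → ℕ → Prop} (h : S1 fun ρ => R (ρ 0) (ρ 1) (ρ 2))
    {f g k : (ℕ → ℕ) → ℕ}
    (hf : SF f) (hg : SF g) (hk : SF k) : S1 fun ρ => R (f ρ) (g ρ) (k ρ) := by
  refine S1.bind (R := fun a ρ => R a (g ρ) (k ρ)) hf ?_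
  refine S1.bind (R := fun a ρ => R (ρ 0) a (k (PLN.tl ρ))) hg.tl ?_
  refine S1.bind (R := fun a ρ => R (ρ 1) (ρ 0) a) hk.tl.tl ?_
  refine (h.subst (fun n ρ => ρ (2 - n)) (fun n => TF.var _)).congr fun ρ => by simp [PLN.tl]

theorem S1.eqF {f g : (ℕ → ℕ) → ℕ} (hf : SF f) (hg : SF g) : S1 fun ρ => f ρ = g ρ :=
  S1.comp2 (S1.ofD0 (D0.eq (TF.var 0) (TF.var 1))) hf hg
theorem S1.neF {f g : (ℕ → ℕ) → ℕ} (hf : SF f) (hg : SF g) : S1 fun ρ => f ρ ≠ g ρ :=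
  S1.comp2 (R := fun a b => a ≠ b) (S1.ofD0 (D0.not (D0.eq (TF.var 0) (TF.var 1)))) hf hg
theorem S1.leF {f g : (ℕ → ℕ) → ℕ} (hf : SF f) (hg : SF g) : S1 fun ρ => f ρ ≤ g ρ :=
  S1.comp2 (S1.ofD0 (D0.le (TF.var 0) (TF.var 1))) hf hg
theorem S1.ltF {f g : (ℕ → ℕ) → ℕ} (hf : SF f) (hg : SF g) : S1 fun ρ => f ρ < g ρ :=
  S1.comp2 (S1.ofD0 (D0.lt (TF.var 0) (TF.var 1))) hf hg

theorem SF.comp1 {F : ℕ → ℕ} (h : S1 fun ρ => ρ 0 = F (ρ 1)) {f : (ℕ → ℕ) → ℕ}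
    (hf : SF f) : SF fun ρ => F (f ρ) :=
  S1.comp2 (R := fun a b => a = F b) h (SF.var 0) hf.tl

theorem SF.comp2 {F : ℕ → ℕ → ℕ} (h : S1 fun ρ => ρ 0 = F (ρ 1) (ρ 2)) {f g : (ℕ → ℕ) → ℕ}
    (hf : SF f) (hg : SF g) : SF fun ρ => F (f ρ) (g ρ) :=
  S1.comp3 (R := fun a b c => a = F b c) h (SF.var 0) hf.tl hg.tl

theorem SF.add {f g : (ℕ → ℕ) → ℕ} (hf : SF f) (hg : SF g) : SF fun ρ => f ρ + g ρ :=
  SF.comp2 (S1.ofD0 (D0.eq (TF.var 0) ((TF.var 1).add (TF.var 2)))) hf hg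
theorem SF.mul {f g : (ℕ → ℕ) → ℕ} (hf : SF f) (hg : SF g) : SF fun ρ => f ρ * g ρ :=
  SF.comp2 (S1.ofD0 (D0.eq (TF.var 0) ((TF.var 1).mul (TF.var 2)))) hf hg

theorem D0.pairEq {h f g : (ℕ → ℕ) → ℕ} (hh : TF h) (hf : TF f) (hg : TF g) :
    D0 fun ρ => h ρ = Nat.pair (f ρ) (g ρ) := by
  refine (((D0.lt hf hg).and (D0.eq hh ((hg.mul hg).add hf))).or
    ((D0.le hg hf).and (D0.eq hh (((hf.mul hf).add hf).add hg)))).congr fun ρ => ?_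
  unfold Nat.pair
  split <;> omega

theorem SF.pair {f g : (ℕ → ℕ) → ℕ} (hf : SF f) (hg : SF g) : SF fun ρ => Nat.pair (f ρ) (g ρ) :=
  SF.comp2 (S1.ofD0 (D0.pairEq (TF.var 0) (TF.var 1) (TF.var 2))) hf hg

theorem SF.left {f : (ℕ → ℕ) → ℕ} (hf : SF f) : SF fun ρ => (f ρ).unpair.1 := by
  refine SF.comp1 (F := fun a => a.unpair.1) ?_ hf
  refine (S1.ex (R := fun b ρ => ρ 1 = Nat.pair (ρ 0) b)
    (S1.eqF (SF.var 2) ((SF.var 1).pair (SF.var 0)))).congr fun ρ => ?_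
  constructor
  · intro h; exact ⟨(ρ 1).unpair.2, by rw [h, Nat.pair_unpair]⟩
  · rintro ⟨b, hb⟩; rw [hb, Nat.unpair_pair]

theorem SF.right {f : (ℕ → ℕ) → ℕ} (hf : SF f) : SF fun ρ => (f ρ).unpair.2 := by
  refine SF.comp1 (F := fun a => a.unpair.2) ?_ hf
  refine (S1.ex (R := fun b ρ => ρ 1 = Nat.pair b (ρ 0))
    (S1.eqF (SF.var 2) ((SF.var 0).pair (SF.var 1)))).congr fun ρ => ?_
  constructor
  · intro h; exact ⟨(ρ 1).unpair.1, by rw [h, Nat.pair_unpair]⟩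
  · rintro ⟨b, hb⟩; rw [hb, Nat.unpair_pair]

theorem SF.mod {f g : (ℕ → ℕ) → ℕ} (hf : SF f) (hg : SF g) : SF fun ρ => f ρ % (g ρ + 1) := by
  refine SF.comp2 (F := fun a b => a % (b + 1)) ?_ hf hg
  refine (S1.ex (R := fun q ρ => ρ 1 = q * (ρ 2 + 1) + ρ 0 ∧ ρ 0 < ρ 2 + 1)
    ((S1.eqF (SF.var 2) (((SF.var 0).mul ((SF.var 3).add (SF.const 1))).add (SF.var 1))).and
      (S1.ltF (SF.var 1) ((SF.var 3).add (SF.const 1))))).congr fun ρ => ?_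
  constructor
  · intro h
    refine ⟨ρ 1 / (ρ 2 + 1), ?_, ?_⟩
    · rw [h, Nat.mul_comm]; exact (Nat.div_add_mod _ _).symm
    · rw [h]; exact Nat.mod_lt _ (Nat.succ_pos _)
  · rintro ⟨q, h1, h2⟩
    rw [h1, Nat.mul_comm, Nat.mul_add_mod, Nat.mod_eq_of_lt h2]

theorem SF.beta {f g : (ℕ → ℕ) → ℕ} (hf : SF f) (hg : SF g) : SF fun ρ => Nat.beta (f ρ) (g ρ) := by
  unfold Nat.beta
  exact SF.mod hf.left ((hg.add (SF.const 1)).mul hf.right)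

theorem S1.ball {f : (ℕ → ℕ) → ℕ} {R : ℕ → (ℕ → ℕ) → Prop} (hf : SF f)
    (h : S1 fun ρ => R (ρ 0) (PLN.tl ρ)) : S1 fun ρ => ∀ a ≤ f ρ, R a ρ := by
  refine S1.bind (R := fun b ρ => ∀ a ≤ b, R a ρ) hf ?_
  refine S1.ballT (R := fun a ρ => R a (PLN.tl ρ)) (TF.var 0) ?_
  refine (h.subst (fun n ρ => if n = 0 then ρ 0 else ρ (n + 1)) ?_).congr ?_
  · intro n; by_cases hn : n = 0
    · simp only [hn]; exact TF.var 0
    · simp only [hn]; exact TF.var _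
  · intro ρ
    have e : (PLN.tl fun n => if n = 0 then ρ 0 else ρ (n + 1)) = PLN.tl (PLN.tl ρ) := by
      funext n; rfl
    rw [e]; simp

theorem S1.blt {f : (ℕ → ℕ) → ℕ} {R : ℕ → (ℕ → ℕ) → Prop} (hf : SF f)
    (h : S1 fun ρ => R (ρ 0) (PLN.tl ρ)) : S1 fun ρ => ∀ a < f ρ, R a ρ := by
  refine (S1.ball (R := fun a ρ => f ρ ≤ a ∨ R a ρ) hf ((S1.leF hf.tl (SF.var 0)).or h)).congr ?_
  intro ρ
  constructor
  · intro h a _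
    rcases Nat.lt_or_ge a (f ρ) with h1 | h1
    · exact Or.inr (h a h1)
    · exact Or.inl h1
  · intro h a ha
    exact (h a ha.le).resolve_left (by omega)

/-! ### Inductively defined predicates -/

inductive Cl (A : ℕ → Prop) (B : ℕ → ℕ → ℕ → Prop) : ℕ → Prop
  | ax {j} : A j → Cl A B j
  | step {j q1 q2} : Cl A B q1 → Cl A B q2 → B j q1 q2 → Cl A B j

/-- derivation lists -/
def Good (A : ℕ → Prop) (B : ℕ → ℕ → ℕ → Prop) (g : ℕ → ℕ) (L : ℕ) : Prop :=
  ∀ i < L, A (g i) ∨ ∃ k1, k1 < i ∧ ∃ k2, k2 < i ∧ B (g i) (g k1) (g k2)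

theorem Good.congr {A : ℕ → Prop} {B : ℕ → ℕ → ℕ → Prop} {g g' : ℕ → ℕ} {L : ℕ}
    (h : Good A B g L) (hg : ∀ i < L, g' i = g i) : Good A B g' L := by
  intro i hi
  rw [hg i hi]
  rcases h i hi with h | ⟨k1, h1, k2, h2, h⟩
  · exact Or.inl h
  · refine Or.inr ⟨k1, h1, k2, h2, ?_⟩
    rw [hg k1 (by omega), hg k2 (by omega)]
    exact h

theorem Good.cl {A : ℕ → Prop} {B : ℕ → ℕ → ℕ → Prop} {g : ℕ → ℕ} {L : ℕ}
    (h : Good A B g L) : ∀ i < L, Cl A B (g i) := by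
  intro i
  induction i using Nat.strong_induction_on with
  | _ i ih =>
    intro hi
    rcases h i hi with h | ⟨k1, h1, k2, h2, h⟩
    · exact .ax h
    · exact .step (ih k1 h1 (by omega)) (ih k2 h2 (by omega)) h

theorem Cl.good {A : ℕ → Prop} {B : ℕ → ℕ → ℕ → Prop} {j : ℕ} (h : Cl A B j) :
    ∃ g L, Good A B g L ∧ ∃ i < L, g i = j := by
  induction h with
  | @ax j h =>
    exact ⟨fun _ => j, 1, fun i _ => Or.inl h, 0, Nat.one_pos, rfl⟩
  | @step j q1 q2 _ _ h ih1 ih2 =>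
    obtain ⟨g1, L1, h1, i1, hi1, e1⟩ := ih1
    obtain ⟨g2, L2, h2, i2, hi2, e2⟩ := ih2
    let g : ℕ → ℕ := fun i => if i < L1 then g1 i else if i < L1 + L2 then g2 (i - L1) else j
    have ga : ∀ i < L1, g i = g1 i := fun i hi => by simp [g, hi]
    have gb : ∀ i < L2, g (L1 + i) = g2 i := fun i hi => by simp [g, hi]
    have gc : g (L1 + L2) = j := by simp [g]
    refine ⟨g, L1 + L2 + 1, ?_, L1 + L2, Nat.lt_succ_self _, gc⟩
    intro i hi
    rcases Nat.lt_or_ge i L1 with h3 | h3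
    · exact (h1.congr ga) i h3
    · rcases Nat.lt_or_ge i (L1 + L2) with h4 | h4
      · obtain ⟨i', rfl⟩ := Nat.exists_eq_add_of_le h3
        rw [gb i' (by omega)]
        rcases h2 i' (by omega) with h5 | ⟨k1, h5, k2, h6, h7⟩
        · exact Or.inl h5
        · refine Or.inr ⟨L1 + k1, by omega, L1 + k2, by omega, ?_⟩
          rw [gb k1 (by omega), gb k2 (by omega)]; exact h7
      · obtain rfl : i = L1 + L2 := by omega
        refine Or.inr ⟨i1, by omega, L1 + i2, by omega, ?_⟩
        rw [gc, ga i1 hi1, gb i2 hi2, e1, e2]; exact h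

theorem exists_beta (g : ℕ → ℕ) (L : ℕ) : ∃ c, ∀ i < L, Nat.beta c i = g i := by
  refine ⟨Nat.unbeta (List.ofFn fun i : Fin L => g i), fun i hi => ?_⟩
  have := Nat.beta_unbeta_coe (List.ofFn fun i : Fin L => g i) ⟨i, by simpa using hi⟩
  simpa using this

theorem S1.cl {A : (ℕ → ℕ) → ℕ → Prop} {B : (ℕ → ℕ) → ℕ → ℕ → ℕ → Prop}
    (hA : S1 fun ρ => A (PLN.tl ρ) (ρ 0))
    (hB : S1 fun ρ => B (PLN.tl (PLN.tl (PLN.tl ρ))) (ρ 0) (ρ 1) (ρ 2))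
    {f : (ℕ → ℕ) → ℕ} (hf : SF f) : S1 fun ρ => Cl (A ρ) (B ρ) (f ρ) := by
  have key : ∀ ρ, Cl (A ρ) (B ρ) (f ρ) ↔ ∃ c L, (∀ i < L, A ρ (Nat.beta c i) ∨
      ∃ k1, k1 < i ∧ ∃ k2, k2 < i ∧ B ρ (Nat.beta c i) (Nat.beta c k1) (Nat.beta c k2)) ∧
      ∃ i, i < L ∧ f ρ = Nat.beta c i := by
    intro ρ
    constructor
    · intro h
      obtain ⟨g, L, h1, i, hi, e⟩ := h.good
      obtain ⟨c, hc⟩ := exists_beta g L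
      exact ⟨c, L, h1.congr hc, i, hi, by rw [hc i hi, e]⟩
    · rintro ⟨c, L, h, i, hi, e⟩
      rw [e]
      exact Good.cl (g := fun i => Nat.beta c i) h i hi
  refine S1.congr ?_ key
  refine S1.ex (R := fun c ρ => ∃ L, (∀ i < L, A ρ (Nat.beta c i) ∨
      ∃ k1, k1 < i ∧ ∃ k2, k2 < i ∧ B ρ (Nat.beta c i) (Nat.beta c k1) (Nat.beta c k2)) ∧
      ∃ i, i < L ∧ f ρ = Nat.beta c i) ?_
  refine S1.ex (R := fun L ρ => (∀ i < L, A (PLN.tl ρ) (Nat.beta (ρ 0) i) ∨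
      ∃ k1, k1 < i ∧ ∃ k2, k2 < i ∧ B (PLN.tl ρ) (Nat.beta (ρ 0) i) (Nat.beta (ρ 0) k1)
        (Nat.beta (ρ 0) k2)) ∧
      ∃ i, i < L ∧ f (PLN.tl ρ) = Nat.beta (ρ 0) i) ?_
  refine S1.and ?_ ?_
  · refine S1.blt (R := fun i ρ => A (PLN.tl (PLN.tl ρ)) (Nat.beta (ρ 1) i) ∨
      ∃ k1, k1 < i ∧ ∃ k2, k2 < i ∧ B (PLN.tl (PLN.tl ρ)) (Nat.beta (ρ 1) i) (Nat.beta (ρ 1) k1)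
        (Nat.beta (ρ 1) k2)) (SF.var 0) ?_
    refine S1.or ?_ ?_
    · refine S1.bind (R := fun a ρ => A (PLN.tl (PLN.tl (PLN.tl ρ))) a) ((SF.var 2).beta (SF.var 0)) ?_
      refine (hA.subst (fun n ρ => if n = 0 then ρ 0 else ρ (n + 3)) ?_).congr fun ρ => by
        have e : (PLN.tl fun n => if n = 0 then ρ 0 else ρ (n + 3)) =
          PLN.tl (PLN.tl (PLN.tl (PLN.tl ρ))) := by funext n; rfl
        rw [e]; simp
      intro n; by_cases hn : n = 0
      · simp only [hn]; exact TF.var 0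
      · simp only [hn]; exact TF.var _
    · refine S1.ex (R := fun k1 ρ => k1 < ρ 0 ∧ ∃ k2, k2 < ρ 0 ∧ B (PLN.tl (PLN.tl (PLN.tl ρ)))
        (Nat.beta (ρ 2) (ρ 0)) (Nat.beta (ρ 2) k1) (Nat.beta (ρ 2) k2)) ?_
      refine (S1.ltF (SF.var 0) (SF.var 1)).and ?_
      refine S1.ex (R := fun k2 ρ => k2 < ρ 1 ∧ B (PLN.tl (PLN.tl (PLN.tl (PLN.tl ρ))))
        (Nat.beta (ρ 3) (ρ 1)) (Nat.beta (ρ 3) (ρ 0)) (Nat.beta (ρ 3) k2)) ?_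
      refine (S1.ltF (SF.var 0) (SF.var 2)).and ?_
      refine S1.bind (R := fun a ρ => B (PLN.tl (PLN.tl (PLN.tl (PLN.tl (PLN.tl ρ))))) a
        (Nat.beta (ρ 4) (ρ 1)) (Nat.beta (ρ 4) (ρ 0))) ((SF.var 4).beta (SF.var 2)) ?_
      refine S1.bind (R := fun a ρ => B (PLN.tl (PLN.tl (PLN.tl (PLN.tl (PLN.tl (PLN.tl ρ)))))) (ρ 0) a
        (Nat.beta (ρ 5) (ρ 1))) ((SF.var 5).beta (SF.var 2)) ?_
      refine S1.bind (R := fun a ρ => B (PLN.tl (PLN.tl (PLN.tl (PLN.tl (PLN.tl (PLN.tl (PLN.tl ρ)))))))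
        (ρ 1) (ρ 0) a) ((SF.var 6).beta (SF.var 2)) ?_
      refine (hB.subst (fun n ρ => if n < 3 then ρ (2 - n) else ρ (n + 5)) ?_).congr fun ρ => by
        have e : (PLN.tl (PLN.tl (PLN.tl fun n => if n < 3 then ρ (2 - n) else ρ (n + 5)))) =
          PLN.tl (PLN.tl (PLN.tl (PLN.tl (PLN.tl (PLN.tl (PLN.tl (PLN.tl ρ))))))) := by
          funext n; exact if_neg (by omega)
        rw [e]; simp
      intro n; by_cases hn : n < 3
      · simp only [hn]; exact TF.var _
      · simp only [hn]; exact TF.var _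
  · refine S1.ex (R := fun i ρ => i < ρ 0 ∧ f (PLN.tl (PLN.tl ρ)) = Nat.beta (ρ 1) i) ?_
    exact (S1.ltF (SF.var 0) (SF.var 1)).and (S1.eqF hf.tl.tl.tl ((SF.var 2).beta (SF.var 0)))

/-! ### Primitive recursive functions -/

theorem primrec_SF {F : ℕ → ℕ} (h : Nat.Primrec F) : ∀ {f : (ℕ → ℕ) → ℕ}, SF f →
    SF fun ρ => F (f ρ) := by
  induction h with
  | zero => intro f _; exact SF.const 0
  | succ => intro f hf; exact hf.add (SF.const 1)
  | left => intro f hf; exact hf.left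
  | right => intro f hf; exact hf.right
  | pair _ _ ih1 ih2 => intro f hf; exact (ih1 hf).pair (ih2 hf)
  | comp _ _ ih1 ih2 => intro f hf; exact ih1 (ih2 hf)
  | @prec F G _ _ ihF ihG =>
    intro f hf
    let A : ℕ → Prop := fun j => ∃ z, j = Nat.pair z (Nat.pair 0 (F z))
    let B : ℕ → ℕ → ℕ → Prop := fun j q _ => ∃ z y v, q = Nat.pair z (Nat.pair y v) ∧
      j = Nat.pair z (Nat.pair (y + 1) (G (Nat.pair z (Nat.pair y v))))
    let H : ℕ → ℕ → ℕ := fun z n => n.rec (F z) (fun y IH => G (Nat.pair z (Nat.pair y IH)))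
    have hcl1 : ∀ j, Cl A B j → ∃ z n, j = Nat.pair z (Nat.pair n (H z n)) := by
      intro j hj
      induction hj with
      | ax h => obtain ⟨z, rfl⟩ := h; exact ⟨z, 0, rfl⟩
      | step _ _ h ih1 _ =>
        obtain ⟨z, y, v, h1, rfl⟩ := h
        obtain ⟨z', n', h2⟩ := ih1
        rw [h1] at h2
        simp only [Nat.pair_eq_pair] at h2
        obtain ⟨rfl, rfl, rfl⟩ := h2
        exact ⟨z, y + 1, rfl⟩
    have hcl2 : ∀ z n, Cl A B (Nat.pair z (Nat.pair n (H z n))) := by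
      intro z n
      induction n with
      | zero => exact .ax ⟨z, rfl⟩
      | succ n ih => exact .step ih ih ⟨z, n, H z n, rfl, rfl⟩
    have hS : S1 fun ρ => Cl A B (Nat.pair (f (tl ρ)).unpair.1 (Nat.pair (f (tl ρ)).unpair.2 (ρ 0))) := by
      refine S1.cl (A := fun _ => A) (B := fun _ => B) ?_ ?_
        (hf.tl.left.pair (hf.tl.right.pair (SF.var 0)))
      · refine S1.ex ?_
        exact S1.eqF (SF.var 1) ((SF.var 0).pair ((SF.const 0).pair (ihF (SF.var 0))))
      · refine S1.ex (S1.ex (S1.ex (S1.and ?_ ?_)))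
        · exact S1.eqF (SF.var 4) ((SF.var 2).pair ((SF.var 1).pair (SF.var 0)))
        · exact S1.eqF (SF.var 3) ((SF.var 2).pair (((SF.var 1).add (SF.const 1)).pair
            (ihG ((SF.var 2).pair ((SF.var 1).pair (SF.var 0))))))
    refine hS.congr fun ρ => ?_
    show ρ 0 = H (f (tl ρ)).unpair.1 (f (tl ρ)).unpair.2 ↔ _
    constructor
    · intro h; rw [h]; exact hcl2 _ _
    · intro h
      obtain ⟨z, n, e⟩ := hcl1 _ h
      simp only [Nat.pair_eq_pair] at e
      obtain ⟨e1, e2, e3⟩ := e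
      rw [e1, e2]; exact e3

theorem S1.primrec {p : ℕ → Bool} (hp : Primrec p) {f : (ℕ → ℕ) → ℕ} (hf : SF f) :
    S1 fun ρ => p (f ρ) = true := by
  have h : Nat.Primrec fun n => Encodable.encode (p n) := by
    have := (Primrec.encode.comp hp)
    exact Primrec.nat_iff.1 this
  refine (S1.eqF (primrec_SF h hf) (SF.const 1)).congr fun ρ => ?_
  cases p (f ρ) <;> simp

attribute [irreducible] SF S1


/-! ### Arithmetization of syntax -/

def o4 (s p x y : ℕ) : ℕ := Nat.pair s (Nat.pair p (Nat.pair x y))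

theorem o4_inj {s p x y s' p' x' y' : ℕ} :
    o4 s p x y = o4 s' p' x' y' ↔ s = s' ∧ p = p' ∧ x = x' ∧ y = y' := by
  simp [o4, Nat.pair_eq_pair]

theorem SF.o4 {f g h k : (ℕ → ℕ) → ℕ} (hf : SF f) (hg : SF g) (hh : SF h) (hk : SF k) :
    SF fun ρ => PLN.o4 (f ρ) (g ρ) (h ρ) (k ρ) := hf.pair (hg.pair (hh.pair hk))

def OpA (V : ℕ → ℕ → ℕ → Prop) (W : ℕ → Prop) (j : ℕ) : Prop :=
  (∃ p n s, V p n s ∧ j = o4 0 p (Nat.pair 0 n) s) ∨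
  (∃ p, W p ∧ j = o4 0 p (Nat.pair 1 0) (Nat.pair 1 0))

def OpB (U : ℕ → ℕ → Prop) (j q1 q2 : ℕ) : Prop :=
  ∃ p x x' y y' k,
    (q1 = o4 0 p x x' ∧ j = o4 0 p (Nat.pair 2 x) (Nat.pair 2 x')) ∨
    (q1 = o4 0 p x x' ∧ q2 = o4 0 p y y' ∧ (k = 3 ∨ k = 4) ∧
      j = o4 0 p (Nat.pair k (Nat.pair x y)) (Nat.pair k (Nat.pair x' y'))) ∨
    (q1 = o4 0 p x x' ∧ q2 = o4 0 p y y' ∧ (k = 0 ∨ k = 1) ∧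
      j = o4 1 p (Nat.pair k (Nat.pair x y)) (Nat.pair k (Nat.pair x' y'))) ∨
    (q1 = o4 1 p x x' ∧ j = o4 1 p (Nat.pair 2 x) (Nat.pair 2 x')) ∨
    (q1 = o4 1 p x x' ∧ q2 = o4 1 p y y' ∧ (k = 3 ∨ k = 4 ∨ k = 5) ∧
      j = o4 1 p (Nat.pair k (Nat.pair x y)) (Nat.pair k (Nat.pair x' y'))) ∨
    (∃ p', U p p' ∧ q1 = o4 1 p' x x' ∧ (k = 6 ∨ k = 7) ∧
      j = o4 1 p (Nat.pair k x) (Nat.pair k x'))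

section Op
variable {ι : Type} (σ : ι → ℕ → ATerm) (up : ι → ι) (enc : ι → ℕ)

def OpV (p n s : ℕ) : Prop := ∃ i, p = enc i ∧ s = (σ i n).code
def OpW (p : ℕ) : Prop := ∃ i, p = enc i
def OpU (p p' : ℕ) : Prop := ∃ i, p = enc i ∧ p' = enc (up i)

def OpVal (j : ℕ) : Prop :=
  (∃ i, ∃ t : ATerm, j = o4 0 (enc i) t.code (t.substAll (σ i)).code) ∨
  (∃ i, ∃ φ : AFml, j = o4 1 (enc i) φ.code (φ.substAll (σ i)).code)


theorem Op_sound (hinj : Function.Injective enc) (hup : ∀ i, liftSub (σ i) = σ (up i)) (j : ℕ) (h : Cl (OpA (OpV σ enc) (OpW enc)) (OpB (OpU up enc)) j) :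
    OpVal σ enc j := by
  induction h with
  | ax h =>
    rcases h with ⟨p, n, s, ⟨i, rfl, rfl⟩, rfl⟩ | ⟨p, ⟨i, rfl⟩, rfl⟩
    · exact Or.inl ⟨i, .var n, rfl⟩
    · exact Or.inl ⟨i, .zero, rfl⟩
  | step _ _ h ih1 ih2 =>
    obtain ⟨p, x, x', y, y', k, h⟩ := h
    have t1 : ∀ {q p x x'}, OpVal σ enc q → q = o4 0 p x x' → ∃ i, ∃ t : ATerm, p = enc i ∧
        x = t.code ∧ x' = (t.substAll (σ i)).code := by
      intro q p x x' hq e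
      rcases hq with ⟨i, t, e'⟩ | ⟨i, t, e'⟩
      · rw [e', o4_inj] at e
        obtain ⟨_, e1, e2, e3⟩ := e
        exact ⟨i, t, e1.symm, e2.symm, e3.symm⟩
      · rw [e', o4_inj] at e; exact absurd e.1 (by decide)
    have t2 : ∀ {q p x x'}, OpVal σ enc q → q = o4 1 p x x' → ∃ i, ∃ t : AFml, p = enc i ∧
        x = t.code ∧ x' = (t.substAll (σ i)).code := by
      intro q p x x' hq e
      rcases hq with ⟨i, t, e'⟩ | ⟨i, t, e'⟩
      · rw [e', o4_inj] at e; exact absurd e.1 (by decide)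
      · rw [e', o4_inj] at e
        obtain ⟨_, e1, e2, e3⟩ := e
        exact ⟨i, t, e1.symm, e2.symm, e3.symm⟩
    rcases h with ⟨h1, rfl⟩ | ⟨h1, h2, hk, rfl⟩ | ⟨h1, h2, hk, rfl⟩ | ⟨h1, rfl⟩ |
      ⟨h1, h2, hk, rfl⟩ | ⟨p', ⟨i, rfl, rfl⟩, h1, hk, rfl⟩
    · obtain ⟨i, t, rfl, rfl, rfl⟩ := t1 ih1 h1
      exact Or.inl ⟨i, .succ t, rfl⟩
    · obtain ⟨i, t, rfl, rfl, rfl⟩ := t1 ih1 h1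
      obtain ⟨i', s, e, rfl, rfl⟩ := t1 ih2 h2
      obtain rfl := hinj e
      rcases hk with rfl | rfl
      · exact Or.inl ⟨i, .add t s, rfl⟩
      · exact Or.inl ⟨i, .mul t s, rfl⟩
    · obtain ⟨i, t, rfl, rfl, rfl⟩ := t1 ih1 h1
      obtain ⟨i', s, e, rfl, rfl⟩ := t1 ih2 h2
      obtain rfl := hinj e
      rcases hk with rfl | rfl
      · exact Or.inr ⟨i, .eq t s, rfl⟩
      · exact Or.inr ⟨i, .le t s, rfl⟩
    · obtain ⟨i, t, rfl, rfl, rfl⟩ := t2 ih1 h1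
      exact Or.inr ⟨i, .neg t, rfl⟩
    · obtain ⟨i, t, rfl, rfl, rfl⟩ := t2 ih1 h1
      obtain ⟨i', s, e, rfl, rfl⟩ := t2 ih2 h2
      obtain rfl := hinj e
      rcases hk with rfl | rfl | rfl
      · exact Or.inr ⟨i, .and t s, rfl⟩
      · exact Or.inr ⟨i, .or t s, rfl⟩
      · exact Or.inr ⟨i, .imp t s, rfl⟩
    · obtain ⟨i', t, e, rfl, rfl⟩ := t2 ih1 h1
      obtain rfl := hinj e
      rcases hk with rfl | rfl
      · exact Or.inr ⟨i, .all t, by simp [AFml.code, AFml.substAll, hup]⟩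
      · exact Or.inr ⟨i, .ex t, by simp [AFml.code, AFml.substAll, hup]⟩

theorem Op_term (i : ι) (t : ATerm) : Cl (OpA (OpV σ enc) (OpW enc)) (OpB (OpU up enc))
    (o4 0 (enc i) t.code (t.substAll (σ i)).code) := by
  induction t with
  | var n => exact .ax (Or.inl ⟨_, n, _, ⟨i, rfl, rfl⟩, rfl⟩)
  | zero => exact .ax (Or.inr ⟨_, ⟨i, rfl⟩, rfl⟩)
  | succ t ih => exact .step ih ih ⟨enc i, _, _, 0, 0, 0, Or.inl ⟨rfl, rfl⟩⟩
  | add t s ih1 ih2 =>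
    exact .step ih1 ih2 ⟨enc i, _, _, _, _, 3, Or.inr (Or.inl ⟨rfl, rfl, Or.inl rfl, rfl⟩)⟩
  | mul t s ih1 ih2 =>
    exact .step ih1 ih2 ⟨enc i, _, _, _, _, 4, Or.inr (Or.inl ⟨rfl, rfl, Or.inr rfl, rfl⟩)⟩

theorem Op_fml (hup : ∀ i, liftSub (σ i) = σ (up i)) (φ : AFml) : ∀ i : ι,
    Cl (OpA (OpV σ enc) (OpW enc)) (OpB (OpU up enc))
    (o4 1 (enc i) φ.code (φ.substAll (σ i)).code) := by
  have un : ∀ (i : ι) (k : ℕ) {x x' : ℕ}, (k = 6 ∨ k = 7) →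
      Cl (OpA (OpV σ enc) (OpW enc)) (OpB (OpU up enc)) (o4 1 (enc (up i)) x x') →
      Cl (OpA (OpV σ enc) (OpW enc)) (OpB (OpU up enc))
        (o4 1 (enc i) (Nat.pair k x) (Nat.pair k x')) := fun i k x x' hk h =>
    .step h h ⟨enc i, x, x', 0, 0, k, Or.inr (Or.inr (Or.inr (Or.inr (Or.inr
      ⟨_, ⟨i, rfl, rfl⟩, rfl, hk, rfl⟩))))⟩
  induction φ with
  | eq t s =>
    intro i
    exact .step (Op_term σ up enc i t) (Op_term σ up enc i s)
      ⟨enc i, _, _, _, _, 0, Or.inr (Or.inr (Or.inl ⟨rfl, rfl, Or.inl rfl, rfl⟩))⟩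
  | le t s =>
    intro i
    exact .step (Op_term σ up enc i t) (Op_term σ up enc i s)
      ⟨enc i, _, _, _, _, 1, Or.inr (Or.inr (Or.inl ⟨rfl, rfl, Or.inr rfl, rfl⟩))⟩
  | neg t ih => exact fun i => .step (ih i) (ih i) ⟨enc i, _, _, 0, 0, 0,
      Or.inr (Or.inr (Or.inr (Or.inl ⟨rfl, rfl⟩)))⟩
  | and t s ih1 ih2 =>
    exact fun i => .step (ih1 i) (ih2 i) ⟨enc i, _, _, _, _, 3,
      Or.inr (Or.inr (Or.inr (Or.inr (Or.inl ⟨rfl, rfl, Or.inl rfl, rfl⟩))))⟩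
  | or t s ih1 ih2 =>
    exact fun i => .step (ih1 i) (ih2 i) ⟨enc i, _, _, _, _, 4,
      Or.inr (Or.inr (Or.inr (Or.inr (Or.inl ⟨rfl, rfl, Or.inr (Or.inl rfl), rfl⟩))))⟩
  | imp t s ih1 ih2 =>
    exact fun i => .step (ih1 i) (ih2 i) ⟨enc i, _, _, _, _, 5,
      Or.inr (Or.inr (Or.inr (Or.inr (Or.inl ⟨rfl, rfl, Or.inr (Or.inr rfl), rfl⟩))))⟩
  | all t ih =>
    intro i
    have := un i 6 (Or.inl rfl) (ih (up i))
    simpa only [AFml.code, AFml.substAll, hup] using this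
  | ex t ih =>
    intro i
    have := un i 7 (Or.inr rfl) (ih (up i))
    simpa only [AFml.code, AFml.substAll, hup] using this

theorem Op_cl_S1 (hV : S1 fun ρ => OpV σ enc (ρ 0) (ρ 1) (ρ 2)) (hW : S1 fun ρ => OpW enc (ρ 0))
    (hU : S1 fun ρ => OpU up enc (ρ 0) (ρ 1)) {f : (ℕ → ℕ) → ℕ} (hf : SF f) :
    S1 fun ρ => Cl (OpA (OpV σ enc) (OpW enc)) (OpB (OpU up enc)) (f ρ) := by
  refine S1.cl (A := fun _ => _) (B := fun _ => _) ?_ ?_ hf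
  · unfold OpA
    refine S1.or (S1.ex (S1.ex (S1.ex (S1.and (S1.comp3 hV ?_ ?_ ?_) ?_))))
      (S1.ex (S1.and (S1.comp1 hW ?_) ?_)) <;>
    repeat' with_reducible
      first | exact SF.var _ | exact SF.const _ | apply S1.eqF | apply SF.o4 | apply SF.pair | apply SF.add
            | apply SF.num | apply S1.and | apply S1.or | apply S1.ex | apply S1.ltF | apply S1.leF
  · unfold OpB
    refine S1.ex (S1.ex (S1.ex (S1.ex (S1.ex (S1.ex ?_)))))
    repeat' with_reducible
      first | exact SF.var _ | exact SF.const _ | apply S1.eqF | apply SF.o4 | apply SF.pair | apply SF.add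
            | apply SF.num | apply S1.and | apply S1.or | apply S1.ex | apply S1.ltF | apply S1.leF | apply S1.comp2 hU

theorem S1.opT (hinj : Function.Injective enc) (hup : ∀ i, liftSub (σ i) = σ (up i))
    (hV : S1 fun ρ => OpV σ enc (ρ 0) (ρ 1) (ρ 2)) (hW : S1 fun ρ => OpW enc (ρ 0))
    (hU : S1 fun ρ => OpU up enc (ρ 0) (ρ 1)) :
    S1 fun ρ => ∃ i, ∃ t : ATerm, ρ 0 = enc i ∧ ρ 1 = t.code ∧ ρ 2 = (t.substAll (σ i)).code := by
  refine (Op_cl_S1 σ up enc hV hW hU ((SF.const 0).o4 (SF.var 0) (SF.var 1) (SF.var 2))).congr ?_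
  intro ρ
  constructor
  · rintro ⟨i, t, e1, e2, e3⟩
    rw [e1, e2, e3]; exact Op_term σ up enc i t
  · intro h
    rcases Op_sound σ up enc hinj hup _ h with ⟨i, t, e⟩ | ⟨i, t, e⟩
    · rw [o4_inj] at e; exact ⟨i, t, e.2.1, e.2.2.1, e.2.2.2⟩
    · rw [o4_inj] at e; exact absurd e.1 (by decide)

theorem S1.opF (hinj : Function.Injective enc) (hup : ∀ i, liftSub (σ i) = σ (up i))
    (hV : S1 fun ρ => OpV σ enc (ρ 0) (ρ 1) (ρ 2)) (hW : S1 fun ρ => OpW enc (ρ 0))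
    (hU : S1 fun ρ => OpU up enc (ρ 0) (ρ 1)) :
    S1 fun ρ => ∃ i, ∃ t : AFml, ρ 0 = enc i ∧ ρ 1 = t.code ∧ ρ 2 = (t.substAll (σ i)).code := by
  refine (Op_cl_S1 σ up enc hV hW hU ((SF.const 1).o4 (SF.var 0) (SF.var 1) (SF.var 2))).congr ?_
  intro ρ
  constructor
  · rintro ⟨i, t, e1, e2, e3⟩
    rw [e1, e2, e3]; exact Op_fml σ up enc hup t i
  · intro h
    rcases Op_sound σ up enc hinj hup _ h with ⟨i, t, e⟩ | ⟨i, t, e⟩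
    · rw [o4_inj] at e; exact absurd e.1 (by decide)
    · rw [o4_inj] at e; exact ⟨i, t, e.2.1, e.2.2.1, e.2.2.2⟩

end Op

theorem S1.ren_V : S1 fun ρ => OpV ren id (ρ 0) (ρ 1) (ρ 2) := by
  refine (S1.or (S1.and (S1.ltF (SF.var 1) (SF.var 0))
      (S1.eqF (SF.var 2) ((SF.const 0).pair (SF.var 1))))
    (S1.and (S1.leF (SF.var 0) (SF.var 1))
      (S1.eqF (SF.var 2) ((SF.const 0).pair ((SF.var 1).add (SF.const 1)))))).congr fun ρ => ?_
  unfold OpV ren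
  constructor
  · rintro ⟨i, rfl, h⟩
    by_cases hl : ρ 1 < ρ 0
    · left; simp [hl] at h; exact ⟨hl, h⟩
    · right; simp [hl] at h; exact ⟨by omega, h⟩
  · rintro (⟨hl, h⟩ | ⟨hl, h⟩)
    · exact ⟨ρ 0, rfl, by simp [hl, h, ATerm.code]⟩
    · exact ⟨ρ 0, rfl, by simp [hl, h, ATerm.code]⟩

theorem S1.ren_W : S1 fun ρ => OpW (id : ℕ → ℕ) (ρ 0) :=
  (S1.eqF (SF.const 0) (SF.const 0)).congr fun ρ => by simp [OpW]

theorem S1.ren_U : S1 fun ρ => OpU (· + 1) (id : ℕ → ℕ) (ρ 0) (ρ 1) :=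
  (S1.eqF (SF.var 1) ((SF.var 0).add (SF.const 1))).congr fun ρ => by simp [OpU]

def LiftT (d x y : ℕ) : Prop := ∃ t : ATerm, x = t.code ∧ y = (t.lift d).code
def LiftF (d x y : ℕ) : Prop := ∃ φ : AFml, x = φ.code ∧ y = (φ.lift d).code
def IsT (x : ℕ) : Prop := ∃ t : ATerm, x = t.code
def IsF (x : ℕ) : Prop := ∃ φ : AFml, x = φ.code

theorem S1.liftT {f g h : (ℕ → ℕ) → ℕ} (hf : SF f) (hg : SF g) (hh : SF h) :
    S1 fun ρ => LiftT (f ρ) (g ρ) (h ρ) := by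
  refine S1.comp3 ?_ hf hg hh
  refine (S1.opT ren (· + 1) id Function.injective_id liftSub_ren S1.ren_V S1.ren_W S1.ren_U).congr ?_
  intro ρ; simp [LiftT, ATerm.lift_eq]

theorem S1.liftF {f g h : (ℕ → ℕ) → ℕ} (hf : SF f) (hg : SF g) (hh : SF h) :
    S1 fun ρ => LiftF (f ρ) (g ρ) (h ρ) := by
  refine S1.comp3 ?_ hf hg hh
  refine (S1.opF ren (· + 1) id Function.injective_id liftSub_ren S1.ren_V S1.ren_W S1.ren_U).congr ?_
  intro ρ; simp [LiftF, AFml.lift_eq]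

theorem S1.isT {f : (ℕ → ℕ) → ℕ} (hf : SF f) : S1 fun ρ => IsT (f ρ) :=
  (S1.ex (R := fun a ρ => LiftT 0 (f ρ) a) (S1.liftT (SF.const 0) hf.tl (SF.var 0))).congr fun ρ => by simp [IsT, LiftT]

theorem S1.isF {f : (ℕ → ℕ) → ℕ} (hf : SF f) : S1 fun ρ => IsF (f ρ) :=
  (S1.ex (R := fun a ρ => LiftF 0 (f ρ) a) (S1.liftF (SF.const 0) hf.tl (SF.var 0))).congr fun ρ => by simp [IsF, LiftF]

/-- The substitution replacing variable `d` by `t`. -/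
def sub (i : ℕ × ATerm) (n : ℕ) : ATerm :=
  if n < i.1 then .var n else if n = i.1 then i.2 else .var (n - 1)

def subUp (i : ℕ × ATerm) : ℕ × ATerm := (i.1 + 1, i.2.lift 0)
def subEnc (i : ℕ × ATerm) : ℕ := Nat.pair i.1 i.2.code

theorem subEnc_inj : Function.Injective subEnc := by
  rintro ⟨a, t⟩ ⟨b, s⟩ h
  simp only [subEnc, Nat.pair_eq_pair] at h
  rw [h.1, ATerm.code_inj h.2]

theorem liftSub_sub (i : ℕ × ATerm) : liftSub (sub i) = sub (subUp i) := by
  funext n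
  cases n with
  | zero => simp [liftSub, sub, subUp]
  | succ n =>
    simp only [liftSub, sub, subUp]
    rcases Nat.lt_trichotomy n i.1 with h | h | h
    · simp [h, ATerm.lift]
    · simp [h]
    · have h1 : ¬ n < i.1 := by omega
      have h2 : n ≠ i.1 := by omega
      simp [h1, h2, ATerm.lift]
      omega

theorem S1.sub_V : S1 fun ρ => OpV sub subEnc (ρ 0) (ρ 1) (ρ 2) := by
  have : S1 fun ρ => ∃ d t, IsT t ∧ ρ 0 = Nat.pair d t ∧
      ((ρ 1 < d ∧ ρ 2 = Nat.pair 0 (ρ 1)) ∨ (ρ 1 = d ∧ ρ 2 = t) ∨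
        (∃ n, ρ 1 = n + 1 ∧ d ≤ n ∧ ρ 2 = Nat.pair 0 n)) := by
    repeat' with_reducible
      first | exact SF.var _ | exact SF.const _ | apply S1.eqF | apply SF.o4 | apply SF.pair | apply SF.add
            | apply SF.num | apply S1.and | apply S1.or | apply S1.ex | apply S1.ltF | apply S1.leF | apply S1.isT
  refine this.congr fun ρ => ?_
  constructor
  · rintro ⟨⟨d, t⟩, h1, h2⟩
    refine ⟨d, t.code, ⟨t, rfl⟩, h1, ?_⟩
    rw [h2]
    rcases Nat.lt_trichotomy (ρ 1) d with h | h | h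
    · left; simp [sub, h, ATerm.code]
    · right; left; simp [sub, h]
    · right; right
      refine ⟨ρ 1 - 1, by omega, by omega, ?_⟩
      have h1 : ¬ ρ 1 < d := by omega
      have h2 : ρ 1 ≠ d := by omega
      simp [sub, h1, h2, ATerm.code]
  · rintro ⟨d, _, ⟨t, rfl⟩, h0, h⟩
    refine ⟨(d, t), h0, ?_⟩
    rcases h with ⟨h1, h2⟩ | ⟨h1, h2⟩ | ⟨n, h1, h2, h3⟩
    · simp [sub, h1, h2, ATerm.code]
    · simp [sub, h1, h2]
    · have h4 : ¬ n + 1 < d := by omega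
      have h5 : n + 1 ≠ d := by omega
      simp [sub, h1, h3, h4, h5, ATerm.code]

theorem S1.sub_W : S1 fun ρ => OpW subEnc (ρ 0) := by
  have : S1 fun ρ => ∃ d t, IsT t ∧ ρ 0 = Nat.pair d t := by
    repeat' with_reducible
      first | exact SF.var _ | exact SF.const _ | apply S1.eqF | apply SF.o4 | apply SF.pair | apply SF.add
            | apply SF.num | apply S1.and | apply S1.or | apply S1.ex | apply S1.ltF | apply S1.leF | apply S1.isT
  refine this.congr fun ρ => ?_
  constructor
  · rintro ⟨⟨d, t⟩, h⟩; exact ⟨d, t.code, ⟨t, rfl⟩, h⟩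
  · rintro ⟨d, _, ⟨t, rfl⟩, h⟩; exact ⟨(d, t), h⟩

theorem S1.sub_U : S1 fun ρ => OpU subUp subEnc (ρ 0) (ρ 1) := by
  have : S1 fun ρ => ∃ d t t', LiftT 0 t t' ∧ ρ 0 = Nat.pair d t ∧ ρ 1 = Nat.pair (d + 1) t' := by
    repeat' with_reducible
      first | exact SF.var _ | exact SF.const _ | apply S1.eqF | apply SF.o4 | apply SF.pair | apply SF.add
            | apply SF.num | apply S1.and | apply S1.or | apply S1.ex | apply S1.ltF | apply S1.leF | apply S1.liftT
  refine this.congr fun ρ => ?_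
  constructor
  · rintro ⟨⟨d, t⟩, h1, h2⟩; exact ⟨d, t.code, (t.lift 0).code, ⟨t, rfl, rfl⟩, h1, h2⟩
  · rintro ⟨d, _, _, ⟨t, rfl, rfl⟩, h1, h2⟩; exact ⟨(d, t), h1, h2⟩

/-- Graph of one-variable substitution. -/
def SubF (t x y : ℕ) : Prop := ∃ (s : ATerm) (φ : AFml), t = s.code ∧ x = φ.code ∧
  y = (φ.subst0 s).code

theorem sub_zero (t : ATerm) : sub (0, t) = subst0Env t := by
  funext n; cases n <;> simp [sub, subst0Env]

theorem S1.subF {f g h : (ℕ → ℕ) → ℕ} (hf : SF f) (hg : SF g) (hh : SF h) :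
    S1 fun ρ => SubF (f ρ) (g ρ) (h ρ) := by
  refine S1.comp3 ?_ hf hg hh
  have := S1.comp3 (R := fun p x y => ∃ i, ∃ t : AFml, p = subEnc i ∧ x = t.code ∧
    y = (t.substAll (sub i)).code) (S1.opF sub subUp subEnc subEnc_inj liftSub_sub S1.sub_V S1.sub_W S1.sub_U)
    ((SF.const 0).pair (SF.var 0)) (SF.var 1) (SF.var 2)
  refine this.congr fun ρ => ?_
  constructor
  · rintro ⟨s, φ, e1, e2, e3⟩
    refine ⟨(0, s), φ, by rw [e1]; rfl, e2, ?_⟩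
    rw [e3, sub_zero]; rfl
  · rintro ⟨⟨d, s⟩, φ, e1, e2, e3⟩
    simp only [subEnc, Nat.pair_eq_pair] at e1
    obtain ⟨rfl, e1⟩ := e1
    exact ⟨s, φ, e1, e2, by rw [e3, sub_zero]; rfl⟩

theorem SF.num {f : (ℕ → ℕ) → ℕ} (hf : SF f) : SF fun ρ => (numeral (f ρ)).code := by
  have h : Nat.Primrec fun n => (numeral n).code := by
    rw [← Primrec.nat_iff]
    have : Primrec fun n : ℕ => (n.rec (Nat.pair 1 0) (fun _ r => Nat.pair 2 r) : ℕ) :=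
      Primrec.nat_rec' (f := fun n : ℕ => n) (g := fun _ => Nat.pair 1 0)
        (h := fun _ p => Nat.pair 2 p.2) Primrec.id
        (Primrec.const _) (Primrec₂.natPair.comp (Primrec.const 2)
          (Primrec.snd.comp Primrec.snd))
    refine this.of_eq fun n => ?_
    induction n with
    | zero => rfl
    | succ n ih => simp only [numeral, ATerm.code, ← ih]
  exact primrec_SF h hf

/-- The predicate obtained from `θ` by self-application. -/
def selfP (θ : AFml) : AFml := θ.subst0 (numeral θ.code)

def AppP (q x r : ℕ) : Prop := ∃ θ : AFml, q = θ.code ∧ r = ((selfP θ).subst0 (numeral x)).code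

theorem S1.appP {f g h : (ℕ → ℕ) → ℕ} (hf : SF f) (hg : SF g) (hh : SF h) :
    S1 fun ρ => AppP (f ρ) (g ρ) (h ρ) := by
  refine S1.comp3 ?_ hf hg hh
  have : S1 fun ρ => ∃ a, SubF (numeral (ρ 0)).code (ρ 0) a ∧ SubF (numeral (ρ 1)).code a (ρ 2) := by
    repeat' with_reducible
      first | exact SF.var _ | exact SF.const _ | apply S1.eqF | apply SF.o4 | apply SF.pair | apply SF.add
            | apply SF.num | apply S1.and | apply S1.or | apply S1.ex | apply S1.ltF | apply S1.leF | apply S1.subF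
  refine this.congr fun ρ => ?_
  constructor
  · rintro ⟨θ, e1, e2⟩
    refine ⟨(selfP θ).code, ⟨numeral (ρ 0), θ, rfl, e1, ?_⟩, numeral (ρ 1), selfP θ, rfl, rfl, e2⟩
    rw [e1]; rfl
  · rintro ⟨_, ⟨s, θ, e1, e2, rfl⟩, s', φ', e3, e4, e5⟩
    obtain rfl := ATerm.code_inj e1
    obtain rfl := ATerm.code_inj e3
    obtain rfl := AFml.code_inj e4
    refine ⟨θ, e2, ?_⟩
    rw [e5, e2]; rfl


/-! ### Propositional completeness for a finite list of schemes -/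

theorem prop_complete (L : Set AFml)
    (hmp : ∀ a b, AFml.imp a b ∈ L → a ∈ L → b ∈ L)
    (hK : ∀ a b, AFml.imp a (.imp b a) ∈ L)
    (hS : ∀ a b c, AFml.imp (.imp a (.imp b c)) (.imp (.imp a b) (.imp a c)) ∈ L)
    (hP : ∀ a b c, AFml.imp (.imp a c) (.imp (.imp (.imp a b) c) c) ∈ L)
    (hN1 : ∀ a b, AFml.imp (.neg a) (.imp a b) ∈ L)
    (hN2 : ∀ a b, AFml.imp (.imp a b) (.imp (.imp (.neg a) b) b) ∈ L)
    (hA1 : ∀ a b, AFml.imp a (.imp b (.and a b)) ∈ L)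
    (hA2 : ∀ a b, AFml.imp (.and a b) a ∈ L)
    (hA3 : ∀ a b, AFml.imp (.and a b) b ∈ L)
    (hO1 : ∀ a b, AFml.imp a (.or a b) ∈ L)
    (hO2 : ∀ a b, AFml.imp b (.or a b) ∈ L)
    (hO3 : ∀ a b c, AFml.imp (.imp a c) (.imp (.imp b c) (.imp (.or a b) c)) ∈ L)
    (φ : AFml) (h : ATaut φ) : φ ∈ L := by
  by_contra hφ
  obtain ⟨M, hLM, hM, hn, hmax⟩ := lindenbaum AFml.imp L hK hS hmp φ hφ
  have key : ∀ ψ : AFml, ψ.evalProp (fun χ => χ ∈ M) ↔ ψ ∈ M := by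
    intro ψ
    induction ψ with
    | eq t s => exact Iff.rfl
    | le t s => exact Iff.rfl
    | all ψ _ => exact Iff.rfl
    | ex ψ _ => exact Iff.rfl
    | neg a ih =>
      simp only [AFml.evalProp, ih]
      constructor
      · intro ha
        have h1 := (hmax a).resolve_left ha
        by_contra h2
        have h3 := (hmax (.neg a)).resolve_left h2
        exact hn (hM _ _ (hM _ _ (hLM (hN2 a φ)) h1) h3)
      · intro h1 h2
        exact hn (hM _ _ (hM _ _ (hLM (hN1 a φ)) h1) h2)
    | and a b ih1 ih2 =>
      simp only [AFml.evalProp, ih1, ih2]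
      constructor
      · rintro ⟨h1, h2⟩; exact hM _ _ (hM _ _ (hLM (hA1 a b)) h1) h2
      · intro h1; exact ⟨hM _ _ (hLM (hA2 a b)) h1, hM _ _ (hLM (hA3 a b)) h1⟩
    | or a b ih1 ih2 =>
      simp only [AFml.evalProp, ih1, ih2]
      constructor
      · rintro (h1 | h1)
        · exact hM _ _ (hLM (hO1 a b)) h1
        · exact hM _ _ (hLM (hO2 a b)) h1
      · intro h1
        by_contra h2
        push Not at h2
        have h3 := (hmax a).resolve_left h2.1
        have h4 := (hmax b).resolve_left h2.2
        exact hn (hM _ _ (hM _ _ (hM _ _ (hLM (hO3 a b φ)) h3) h4) h1)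
    | imp a b ih1 ih2 =>
      simp only [AFml.evalProp, ih1, ih2]
      constructor
      · intro h1
        by_contra h2
        have h3 := (hmax (.imp a b)).resolve_left h2
        by_cases ha : a ∈ M
        · exact h2 (hM _ _ (hLM (hK b a)) (h1 ha))
        · have h4 := (hmax a).resolve_left ha
          exact hn (hM _ _ (hM _ _ (hLM (hP a b φ)) h4) h3)
      · intro h1 h2; exact hM _ _ h1 h2
  exact hn ((key φ).1 (h _))

/-! ### The set of theorems is Σ₁ -/

def im (a b : ℕ) : ℕ := Nat.pair 5 (Nat.pair a b)
def an (a b : ℕ) : ℕ := Nat.pair 3 (Nat.pair a b)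
def orr (a b : ℕ) : ℕ := Nat.pair 4 (Nat.pair a b)
def ng (a : ℕ) : ℕ := Nat.pair 2 a
def al (a : ℕ) : ℕ := Nat.pair 6 a
def exx (a : ℕ) : ℕ := Nat.pair 7 a
def eqq (a b : ℕ) : ℕ := Nat.pair 0 (Nat.pair a b)

theorem SF.im {f g : (ℕ → ℕ) → ℕ} (hf : SF f) (hg : SF g) : SF fun ρ => im (f ρ) (g ρ) :=
  (SF.const 5).pair (hf.pair hg)
theorem SF.an {f g : (ℕ → ℕ) → ℕ} (hf : SF f) (hg : SF g) : SF fun ρ => an (f ρ) (g ρ) :=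
  (SF.const 3).pair (hf.pair hg)
theorem SF.orr {f g : (ℕ → ℕ) → ℕ} (hf : SF f) (hg : SF g) : SF fun ρ => orr (f ρ) (g ρ) :=
  (SF.const 4).pair (hf.pair hg)
theorem SF.ng {f : (ℕ → ℕ) → ℕ} (hf : SF f) : SF fun ρ => ng (f ρ) := (SF.const 2).pair hf
theorem SF.al {f : (ℕ → ℕ) → ℕ} (hf : SF f) : SF fun ρ => al (f ρ) := (SF.const 6).pair hf
theorem SF.exx {f : (ℕ → ℕ) → ℕ} (hf : SF f) : SF fun ρ => exx (f ρ) := (SF.const 7).pair hf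
theorem SF.eqq {f g : (ℕ → ℕ) → ℕ} (hf : SF f) (hg : SF g) : SF fun ρ => eqq (f ρ) (g ρ) :=
  (SF.const 0).pair (hf.pair hg)

def SchA (x : ℕ) : Prop := ∃ a b c, IsF a ∧ IsF b ∧ IsF c ∧
  (x = im a (im b a) ∨
   x = im (im a (im b c)) (im (im a b) (im a c)) ∨
   x = im (im a c) (im (im (im a b) c) c) ∨
   x = im (ng a) (im a b) ∨
   x = im (im a b) (im (im (ng a) b) b) ∨
   x = im a (im b (an a b)) ∨
   x = im (an a b) a ∨
   x = im (an a b) b ∨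
   x = im a (orr a b) ∨
   x = im b (orr a b) ∨
   x = im (im a c) (im (im b c) (im (orr a b) c)) ∨
   x = im (al (im a b)) (im (al a) (al b)) ∨
   x = an (im (exx a) (ng (al (ng a)))) (im (ng (al (ng a))) (exx a)))

def SchB (x : ℕ) : Prop := ∃ a b c t s,
  (SubF t a b ∧ x = im (al a) b) ∨
  (SubF t a b ∧ x = im b (exx a)) ∨
  (LiftF 0 a b ∧ x = im a (al b)) ∨
  (IsT t ∧ x = eqq t t) ∨
  (SubF t a b ∧ SubF s a c ∧ x = im (eqq t s) (im b c))

def ThA (p : ℕ → Bool) (x : ℕ) : Prop := (IsF x ∧ p x = true) ∨ SchA x ∨ SchB x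
def ThB (j q1 q2 : ℕ) : Prop := q1 = im q2 j ∨ j = al q1

def Thm (Tax : Set AFml) (x : ℕ) : Prop := ∃ φ : AFml, x = φ.code ∧ Proves Tax φ

theorem thmI {Tax : Set AFml} {φ : AFml} {x : ℕ} (h : Proves Tax φ) (e : x = φ.code) : Thm Tax x :=
  ⟨φ, e, h⟩

theorem ThA_sound {Tax : Set AFml} {p : ℕ → Bool} (hp : ∀ φ : AFml, φ ∈ Tax ↔ p φ.code = true)
    {x : ℕ} (h : ThA p x) : Thm Tax x := by
  rcases h with ⟨⟨φ, rfl⟩, h⟩ | h | h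
  · exact ⟨φ, rfl, .ax ((hp φ).2 h)⟩
  · obtain ⟨_, _, _, ⟨a, rfl⟩, ⟨b, rfl⟩, ⟨c, rfl⟩, h⟩ := h
    rcases h with h | h | h | h | h | h | h | h | h | h | h | h | h
    · exact ⟨.imp a (.imp b a), h, .taut fun v => by simp only [AFml.evalProp]; tauto⟩
    · exact ⟨.imp (.imp a (.imp b c)) (.imp (.imp a b) (.imp a c)), h,
        .taut fun v => by simp only [AFml.evalProp]; tauto⟩
    · exact ⟨.imp (.imp a c) (.imp (.imp (.imp a b) c) c), h,
        .taut fun v => by simp only [AFml.evalProp]; tauto⟩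
    · exact ⟨.imp (.neg a) (.imp a b), h, .taut fun v => by simp only [AFml.evalProp]; tauto⟩
    · exact ⟨.imp (.imp a b) (.imp (.imp (.neg a) b) b), h,
        .taut fun v => by simp only [AFml.evalProp]; tauto⟩
    · exact ⟨.imp a (.imp b (.and a b)), h, .taut fun v => by simp only [AFml.evalProp]; tauto⟩
    · exact ⟨.imp (.and a b) a, h, .taut fun v => by simp only [AFml.evalProp]; tauto⟩
    · exact ⟨.imp (.and a b) b, h, .taut fun v => by simp only [AFml.evalProp]; tauto⟩
    · exact ⟨.imp a (.or a b), h, .taut fun v => by simp only [AFml.evalProp]; tauto⟩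
    · exact ⟨.imp b (.or a b), h, .taut fun v => by simp only [AFml.evalProp]; tauto⟩
    · exact ⟨.imp (.imp a c) (.imp (.imp b c) (.imp (.or a b) c)), h,
        .taut fun v => by simp only [AFml.evalProp]; tauto⟩
    · exact thmI (Proves.allImp a b) h
    · exact thmI (Proves.exDef a) h
  · obtain ⟨a, b, c, t, s, h⟩ := h
    rcases h with ⟨⟨u, φ, rfl, rfl, rfl⟩, h⟩ | ⟨⟨u, φ, rfl, rfl, rfl⟩, h⟩ | ⟨⟨φ, rfl, rfl⟩, h⟩ |
      ⟨⟨u, rfl⟩, h⟩ | ⟨⟨u, φ, rfl, rfl, rfl⟩, ⟨u', φ', rfl, e, rfl⟩, h⟩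
    · exact thmI (Proves.allE φ u) h
    · exact thmI (Proves.exI φ u) h
    · exact thmI (Proves.vacAll φ) h
    · exact thmI (Proves.eqRefl u) h
    · obtain rfl := AFml.code_inj e
      exact thmI (Proves.eqSubst φ u u') h

theorem Thm_iff {Tax : Set AFml} {p : ℕ → Bool} (hp : ∀ φ : AFml, φ ∈ Tax ↔ p φ.code = true)
    (x : ℕ) : Thm Tax x ↔ Cl (ThA p) ThB x := by
  constructor
  · rintro ⟨φ, rfl, h⟩
    have hsch : ∀ {x : ℕ}, SchA x → Cl (ThA p) ThB x := fun h => .ax (Or.inr (Or.inl h))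
    have hsch' : ∀ {x : ℕ}, SchB x → Cl (ThA p) ThB x := fun h => .ax (Or.inr (Or.inr h))
    induction h with
    | ax h => exact .ax (Or.inl ⟨⟨_, rfl⟩, (hp _).1 h⟩)
    | mp _ _ ih1 ih2 => exact .step ih1 ih2 (Or.inl rfl)
    | gen _ ih => exact .step ih ih (Or.inr rfl)
    | @taut φ h =>
      refine prop_complete {ψ | Cl (ThA p) ThB ψ.code} ?_ ?_ ?_ ?_ ?_ ?_ ?_ ?_ ?_ ?_ ?_ ?_ φ h
      · intro a b h1 h2; exact Cl.step h1 h2 (Or.inl rfl)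
      · intro a b
        exact hsch ⟨_, _, _, ⟨a, rfl⟩, ⟨b, rfl⟩, ⟨a, rfl⟩, Or.inl rfl⟩
      · intro a b c
        exact hsch ⟨_, _, _, ⟨a, rfl⟩, ⟨b, rfl⟩, ⟨c, rfl⟩, Or.inr (Or.inl rfl)⟩
      · intro a b c
        exact hsch ⟨_, _, _, ⟨a, rfl⟩, ⟨b, rfl⟩, ⟨c, rfl⟩, Or.inr (Or.inr (Or.inl rfl))⟩
      · intro a b
        exact hsch ⟨_, _, _, ⟨a, rfl⟩, ⟨b, rfl⟩, ⟨a, rfl⟩, Or.inr (Or.inr (Or.inr (Or.inl rfl)))⟩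
      · intro a b
        exact hsch ⟨_, _, _, ⟨a, rfl⟩, ⟨b, rfl⟩, ⟨a, rfl⟩,
          Or.inr (Or.inr (Or.inr (Or.inr (Or.inl rfl))))⟩
      · intro a b
        exact hsch ⟨_, _, _, ⟨a, rfl⟩, ⟨b, rfl⟩, ⟨a, rfl⟩,
          Or.inr (Or.inr (Or.inr (Or.inr (Or.inr (Or.inl rfl)))))⟩
      · intro a b
        exact hsch ⟨_, _, _, ⟨a, rfl⟩, ⟨b, rfl⟩, ⟨a, rfl⟩,
          Or.inr (Or.inr (Or.inr (Or.inr (Or.inr (Or.inr (Or.inl rfl))))))⟩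
      · intro a b
        exact hsch ⟨_, _, _, ⟨a, rfl⟩, ⟨b, rfl⟩, ⟨a, rfl⟩,
          Or.inr (Or.inr (Or.inr (Or.inr (Or.inr (Or.inr (Or.inr (Or.inl rfl)))))))⟩
      · intro a b
        exact hsch ⟨_, _, _, ⟨a, rfl⟩, ⟨b, rfl⟩, ⟨a, rfl⟩,
          Or.inr (Or.inr (Or.inr (Or.inr (Or.inr (Or.inr (Or.inr (Or.inr (Or.inl rfl))))))))⟩
      · intro a b
        exact hsch ⟨_, _, _, ⟨a, rfl⟩, ⟨b, rfl⟩, ⟨a, rfl⟩,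
          Or.inr (Or.inr (Or.inr (Or.inr (Or.inr (Or.inr (Or.inr (Or.inr (Or.inr (Or.inl rfl)))))))))⟩
      · intro a b c
        exact hsch ⟨_, _, _, ⟨a, rfl⟩, ⟨b, rfl⟩, ⟨c, rfl⟩, Or.inr (Or.inr (Or.inr (Or.inr (Or.inr
          (Or.inr (Or.inr (Or.inr (Or.inr (Or.inr (Or.inl rfl))))))))))⟩
    | allE φ t => exact hsch' ⟨_, _, 0, _, 0, Or.inl ⟨⟨t, φ, rfl, rfl, rfl⟩, rfl⟩⟩
    | exI φ t => exact hsch' ⟨_, _, 0, _, 0, Or.inr (Or.inl ⟨⟨t, φ, rfl, rfl, rfl⟩, rfl⟩)⟩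
    | allImp a b =>
      exact hsch ⟨_, _, _, ⟨a, rfl⟩, ⟨b, rfl⟩, ⟨a, rfl⟩, Or.inr (Or.inr (Or.inr (Or.inr (Or.inr
          (Or.inr (Or.inr (Or.inr (Or.inr (Or.inr (Or.inr (Or.inl rfl)))))))))))⟩
    | vacAll φ => exact hsch' ⟨_, _, 0, 0, 0, Or.inr (Or.inr (Or.inl ⟨⟨φ, rfl, rfl⟩, rfl⟩))⟩
    | exDef a =>
      exact hsch ⟨_, _, _, ⟨a, rfl⟩, ⟨a, rfl⟩, ⟨a, rfl⟩, Or.inr (Or.inr (Or.inr (Or.inr (Or.inr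
          (Or.inr (Or.inr (Or.inr (Or.inr (Or.inr (Or.inr (Or.inr rfl)))))))))))⟩
    | eqRefl t =>
      exact hsch' ⟨0, 0, 0, _, 0, Or.inr (Or.inr (Or.inr (Or.inl ⟨⟨t, rfl⟩, rfl⟩)))⟩
    | eqSubst φ t s =>
      exact hsch' ⟨_, _, _, _, _, Or.inr (Or.inr (Or.inr (Or.inr
        ⟨⟨t, φ, rfl, rfl, rfl⟩, ⟨s, φ, rfl, rfl, rfl⟩, rfl⟩)))⟩
  · intro h
    induction h with
    | ax h => exact ThA_sound hp h
    | @step j q1 q2 _ _ h ih1 ih2 =>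
      rcases h with h | h
      · obtain ⟨φ, rfl, h1⟩ := ih1
        obtain ⟨ψ, rfl, h2⟩ := ih2
        cases φ with
        | imp a b =>
          simp only [AFml.code, im, Nat.pair_eq_pair] at h
          obtain rfl := AFml.code_inj h.2.1
          exact ⟨b, h.2.2.symm, .mp h1 h2⟩
        | _ => simp [AFml.code, im, Nat.pair_eq_pair] at h
      · obtain ⟨φ, rfl, h1⟩ := ih1
        exact ⟨.all φ, h, .gen h1⟩

theorem S1.thm {Tax : Set AFml} (hpr : PrAxiomatized Tax) {f : (ℕ → ℕ) → ℕ} (hf : SF f) :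
    S1 fun ρ => Thm Tax (f ρ) := by
  obtain ⟨p, hp, hT⟩ := hpr
  refine S1.congr ?_ (fun ρ => Thm_iff hT (f ρ))
  refine S1.cl (A := fun _ => _) (B := fun _ => _) ?_ ?_ hf
  · unfold ThA SchA SchB
    refine S1.or (S1.and (S1.isF (SF.var 0)) (S1.primrec hp (SF.var 0))) ?_
    repeat' with_reducible
      first | exact SF.var _ | exact SF.const _ | apply S1.eqF | apply SF.im | apply SF.an | apply SF.orr
            | apply SF.ng | apply SF.al | apply SF.exx | apply SF.eqq
            | apply S1.and | apply S1.or | apply S1.ex | apply S1.isF | apply S1.isT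
            | apply S1.subF | apply S1.liftF
  · unfold ThB
    exact (S1.eqF (SF.var 1) ((SF.var 2).im (SF.var 0))).or (S1.eqF (SF.var 0) (SF.var 1).al)


/-! ### Coded finite sets -/

def InC (x c : ℕ) : Prop := Nat.beta c x = 0

theorem InC_iff (x c : ℕ) : InC x c ↔ ∃ u ≤ c, ∃ v ≤ c, ∃ q ≤ c, c = Nat.pair u v ∧
    u = q * ((x + 1) * v + 1) := by
  unfold InC Nat.beta
  constructor
  · intro h
    obtain ⟨q, hq⟩ := Nat.dvd_of_mod_eq_zero h
    refine ⟨_, Nat.unpair_left_le c, _, Nat.unpair_right_le c, q, ?_, (Nat.pair_unpair c).symm, ?_⟩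
    · refine le_trans ?_ (Nat.unpair_left_le c)
      rw [hq]; exact Nat.le_mul_of_pos_left _ (Nat.succ_pos _)
    · rw [hq, Nat.mul_comm]
  · rintro ⟨u, _, v, _, q, _, rfl, e⟩
    simp only [Nat.unpair_pair]
    rw [e]; exact Nat.mul_mod_left _ _

theorem D0.inC : D0 fun ρ => InC (ρ 0) (ρ 1) := by
  have : D0 fun ρ => ∃ u ≤ ρ 1, ∃ v ≤ ρ 1, ∃ q ≤ ρ 1, ρ 1 = Nat.pair u v ∧
    u = q * ((ρ 0 + 1) * v + 1) :=
    D0.bex (TF.var 1) (D0.bex (TF.var 2) (D0.bex (TF.var 3) (D0.and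
      (D0.pairEq (TF.var 4) (TF.var 2) (TF.var 1))
      (D0.eq (TF.var 2) ((TF.var 0).mul ((((TF.var 3).add (TF.const 1)).mul (TF.var 1)).add
        (TF.const 1)))))))
  exact this.congr fun ρ => InC_iff _ _

theorem exists_InC (E : ℕ → Prop) (n : ℕ) : ∃ c, ∀ x < n, InC x c ↔ E x := by
  classical
  obtain ⟨c, hc⟩ := exists_beta (fun x => if E x then 0 else 1) n
  refine ⟨c, fun x hx => ?_⟩
  unfold InC
  rw [hc x hx]
  by_cases h : E x <;> simp [h]

theorem S1.inC {f g : (ℕ → ℕ) → ℕ} (hf : SF f) (hg : SF g) : S1 fun ρ => InC (f ρ) (g ρ) :=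
  S1.comp2 (S1.ofD0 D0.inC) hf hg
theorem S1.ninC {f g : (ℕ → ℕ) → ℕ} (hf : SF f) (hg : SF g) : S1 fun ρ => ¬ InC (f ρ) (g ρ) :=
  S1.comp2 (R := fun a b => ¬ InC a b) (S1.ofD0 D0.inC.not) hf hg

/-- Membership in the set coded by an event, `y = ⟨c, ⟨n, t⟩⟩`. -/
def Mem (x y : ℕ) : Prop := x < y.unpair.2.unpair.1 ∧ InC x y.unpair.1

theorem D0.ev {R : ℕ → ℕ → ℕ → (ℕ → ℕ) → Prop} (i : ℕ)
    (h : D0 fun ρ => R (ρ 3) (ρ 1) (ρ 0) (tl (tl (tl (tl ρ))))) :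
    D0 fun ρ => R (ρ i).unpair.1 (ρ i).unpair.2.unpair.1 (ρ i).unpair.2.unpair.2 ρ := by
  have : D0 fun ρ => ∃ c ≤ ρ i, ∃ r ≤ ρ i, ∃ n ≤ ρ i, ∃ t ≤ ρ i,
      (ρ i = Nat.pair c r ∧ r = Nat.pair n t) ∧ R c n t ρ := by
    refine D0.bex (TF.var i) (R := fun c ρ => ∃ r ≤ ρ i, ∃ n ≤ ρ i, ∃ t ≤ ρ i,
      (ρ i = Nat.pair c r ∧ r = Nat.pair n t) ∧ R c n t ρ) ?_
    refine D0.bex (TF.var (i + 1)) (R := fun r ρ => ∃ n ≤ ρ (i + 1), ∃ t ≤ ρ (i + 1),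
      (ρ (i + 1) = Nat.pair (ρ 0) r ∧ r = Nat.pair n t) ∧ R (ρ 0) n t (tl ρ)) ?_
    refine D0.bex (TF.var (i + 2)) (R := fun n ρ => ∃ t ≤ ρ (i + 2),
      (ρ (i + 2) = Nat.pair (ρ 1) (ρ 0) ∧ ρ 0 = Nat.pair n t) ∧ R (ρ 1) n t (tl (tl ρ))) ?_
    refine D0.bex (TF.var (i + 3)) (R := fun t ρ =>
      (ρ (i + 3) = Nat.pair (ρ 2) (ρ 1) ∧ ρ 1 = Nat.pair (ρ 0) t) ∧
        R (ρ 2) (ρ 0) t (tl (tl (tl ρ)))) ?_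
    exact D0.and (D0.and (D0.pairEq (TF.var (i + 4)) (TF.var 3) (TF.var 2))
      (D0.pairEq (TF.var 2) (TF.var 1) (TF.var 0))) h
  refine this.congr fun ρ => ?_
  constructor
  · intro h
    refine ⟨_, Nat.unpair_left_le _, _, Nat.unpair_right_le _, _,
      (Nat.unpair_left_le _).trans (Nat.unpair_right_le _), _,
      (Nat.unpair_right_le _).trans (Nat.unpair_right_le _), ⟨?_, ?_⟩, h⟩
    · rw [Nat.pair_unpair]
    · rw [Nat.pair_unpair]
  · rintro ⟨c, _, r, _, n, _, t, _, ⟨h1, h2⟩, h⟩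
    rw [h1, h2]
    simpa only [Nat.unpair_pair] using h

theorem D0.mem : D0 fun ρ => Mem (ρ 0) (ρ 1) := by
  refine D0.ev (R := fun c n _ ρ => ρ 0 < n ∧ InC (ρ 0) c) 1 ?_
  refine D0.and (D0.lt (TF.var 4) (TF.var 1)) ?_
  exact D0.inC.subst (fun n ρ => Nat.casesOn n (ρ 4) fun _ => ρ 3) (fun n => by
    cases n with
    | zero => exact TF.var 4
    | succ n => exact TF.var 3)

/-! ### Chains -/

/-- `P(k̄)` -/
def atP (P : AFml) (k : ℕ) : AFml := P.subst0 (numeral k)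

open Classical in
noncomputable def lit (P : AFml) (c k : ℕ) : AFml := if InC k c then .neg (atP P k) else atP P k

noncomputable def chain (P : AFml) (c : ℕ) : ℕ → AFml
  | 0 => botFml
  | k + 1 => .imp (lit P c k) (chain P c k)

def ChA (j : ℕ) : Prop := j = Nat.pair 0 botFml.code
def ChB (q c j q1 : ℕ) : Prop := ∃ k x a l, q1 = Nat.pair k x ∧ AppP q k a ∧
  ((InC k c ∧ l = ng a) ∨ (¬ InC k c ∧ l = a)) ∧ j = Nat.pair (k + 1) (im l x)

theorem AppP_iff (θ : AFml) (x r : ℕ) : AppP θ.code x r ↔ r = (atP (selfP θ) x).code := by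
  constructor
  · rintro ⟨θ', e, h⟩
    obtain rfl := AFml.code_inj e
    exact h
  · intro h; exact ⟨θ, rfl, h⟩

theorem Ch_iff (θ : AFml) (c j : ℕ) : Cl ChA (fun j q1 _ => ChB θ.code c j q1) j ↔
    ∃ k, j = Nat.pair k (chain (selfP θ) c k).code := by
  constructor
  · intro h
    induction h with
    | ax h => exact ⟨0, h⟩
    | step _ _ h ih _ =>
      obtain ⟨k, x, a, l, h1, h2, h3, rfl⟩ := h
      obtain ⟨k', h4⟩ := ih
      rw [h1, Nat.pair_eq_pair] at h4
      obtain ⟨rfl, rfl⟩ := h4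
      refine ⟨k + 1, ?_⟩
      rw [AppP_iff] at h2
      subst h2
      rcases h3 with ⟨h5, rfl⟩ | ⟨h5, rfl⟩
      · simp [chain, lit, h5, AFml.code, im, ng]
      · simp [chain, lit, h5, AFml.code, im]
  · rintro ⟨k, rfl⟩
    induction k with
    | zero => exact .ax rfl
    | succ k ih =>
      refine .step ih ih ⟨k, _, _, (lit (selfP θ) c k).code, rfl, (AppP_iff θ k _).2 rfl, ?_, rfl⟩
      by_cases h : InC k c
      · left; exact ⟨h, by simp [lit, h, AFml.code, ng]⟩
      · right; exact ⟨h, by simp [lit, h]⟩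

/-- `T ⊢ ¬[E_c ↾ n]` -/
def WW (Tax : Set AFml) (q c n : ℕ) : Prop :=
  ∃ θ : AFml, q = θ.code ∧ Proves Tax (chain (selfP θ) c n)

theorem S1.ww {Tax : Set AFml} (hpr : PrAxiomatized Tax) :
    S1 fun ρ => WW Tax (ρ 0) (ρ 1) (ρ 2) := by
  have hB : ∀ {f g h k : (ℕ → ℕ) → ℕ}, SF f → SF g → SF h → SF k →
      S1 fun ρ => ChB (f ρ) (g ρ) (h ρ) (k ρ) := by
    intro f g h k hf hg hh hk
    unfold ChB
    repeat' with_reducible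
      first | exact SF.var _ | exact SF.const _ | exact hf.tl.tl.tl.tl | exact hg.tl.tl.tl.tl
            | exact hh.tl.tl.tl.tl | exact hk.tl.tl.tl.tl
            | apply S1.eqF | apply SF.im | apply SF.ng | apply SF.pair | apply SF.add
            | apply S1.and | apply S1.or | apply S1.ex | apply S1.appP | apply S1.inC | apply S1.ninC
  have h1 : S1 fun ρ => ∃ x, IsF (ρ 0) ∧
      Cl ChA (fun j q1 _ => ChB (ρ 0) (ρ 1) j q1) (Nat.pair (ρ 2) x) ∧ Thm Tax x := by
    refine S1.ex (S1.and (S1.isF (SF.var 1)) (S1.and ?_ (S1.thm hpr (SF.var 0))))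
    refine S1.cl (A := fun _ => ChA) (B := fun ρ j q1 _ => ChB (ρ 1) (ρ 2) j q1) ?_ ?_
      ((SF.var 3).pair (SF.var 0))
    · exact S1.eqF (SF.var 0) (SF.const _)
    · exact hB (SF.var 4) (SF.var 5) (SF.var 0) (SF.var 1)
  refine h1.congr fun ρ => ?_
  constructor
  · rintro ⟨θ, e, h⟩
    refine ⟨_, ⟨θ, e⟩, ?_, ⟨_, rfl, h⟩⟩
    rw [e, Ch_iff]; exact ⟨_, rfl⟩
  · rintro ⟨x, ⟨θ, e⟩, h2, ⟨φ, rfl, h3⟩⟩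
    rw [e, Ch_iff] at h2
    obtain ⟨k, h2⟩ := h2
    rw [Nat.pair_eq_pair] at h2
    obtain ⟨rfl, h2⟩ := h2
    rw [AFml.code_inj h2] at h3
    exact ⟨θ, e, h3⟩

/-! ### Possible truth values -/

def can (A : Bool → AFml → Prop) : Bool → AFml → Prop
  | b, .neg φ => can A (!b) φ
  | true, .and φ ψ => can A true φ ∧ can A true ψ
  | false, .and φ ψ => can A false φ ∨ can A false ψ
  | true, .or φ ψ => can A true φ ∨ can A true ψ
  | false, .or φ ψ => can A false φ ∧ can A false ψ
  | true, .imp φ ψ => can A false φ ∨ can A true ψ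
  | false, .imp φ ψ => can A true φ ∧ can A false ψ
  | b, .eq t s => A b (.eq t s)
  | b, .le t s => A b (.le t s)
  | b, .all t => A b (.all t)
  | b, .ex t => A b (.ex t)

def Atm (P : AFml) (c n : ℕ) (b : Bool) (φ : AFml) : Prop :=
  (b = false ∧ φ = botFml) ∨ (φ ≠ botFml ∧ ∀ k < n, φ = atP P k → (InC k c ↔ b = false))

/-- number version of the atomic case -/
def AtmN (q c n b x : ℕ) : Prop :=
  (b = 0 ∧ x = botFml.code) ∨ (x ≠ botFml.code ∧ ∀ k < n, (∃ a, AppP q k a ∧ x ≠ a) ∨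
    (b = 0 ∧ InC k c) ∨ (b = 1 ∧ ¬ InC k c))

def CanA (q c n j : ℕ) : Prop := ∃ b x t, j = Nat.pair b x ∧ IsF x ∧ (b = 0 ∨ b = 1) ∧
  (x = Nat.pair 0 t ∨ x = Nat.pair 1 t ∨ x = Nat.pair 6 t ∨ x = Nat.pair 7 t) ∧ AtmN q c n b x

def CanB (j q1 q2 : ℕ) : Prop := ∃ x y, IsF x ∧ IsF y ∧
  ((q1 = Nat.pair 0 x ∧ j = Nat.pair 1 (ng x)) ∨
   (q1 = Nat.pair 1 x ∧ j = Nat.pair 0 (ng x)) ∨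
   (q1 = Nat.pair 1 x ∧ q2 = Nat.pair 1 y ∧ j = Nat.pair 1 (an x y)) ∨
   (q1 = Nat.pair 0 x ∧ j = Nat.pair 0 (an x y)) ∨
   (q1 = Nat.pair 0 y ∧ j = Nat.pair 0 (an x y)) ∨
   (q1 = Nat.pair 1 x ∧ j = Nat.pair 1 (orr x y)) ∨
   (q1 = Nat.pair 1 y ∧ j = Nat.pair 1 (orr x y)) ∨
   (q1 = Nat.pair 0 x ∧ q2 = Nat.pair 0 y ∧ j = Nat.pair 0 (orr x y)) ∨
   (q1 = Nat.pair 0 x ∧ j = Nat.pair 1 (im x y)) ∨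
   (q1 = Nat.pair 1 y ∧ j = Nat.pair 1 (im x y)) ∨
   (q1 = Nat.pair 1 x ∧ q2 = Nat.pair 0 y ∧ j = Nat.pair 0 (im x y)))

theorem AtmN_iff (θ : AFml) (c n : ℕ) (b : Bool) (φ : AFml) :
    AtmN θ.code c n b.toNat φ.code ↔ Atm (selfP θ) c n b φ := by
  unfold AtmN Atm
  have h1 : φ.code = botFml.code ↔ φ = botFml := ⟨AFml.code_inj, fun h => by rw [h]⟩
  have h2 : b.toNat = 0 ↔ b = false := by cases b <;> simp
  have h3 : b.toNat = 1 ↔ ¬ (b = false) := by cases b <;> simp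
  rw [Ne, h1, h2, h3]
  refine or_congr Iff.rfl (and_congr Iff.rfl (forall_congr' fun k => imp_congr Iff.rfl ?_))
  have h4 : (∃ a, AppP θ.code k a ∧ φ.code ≠ a) ↔ ¬ (φ = atP (selfP θ) k) := by
    constructor
    · rintro ⟨a, h, h'⟩ e
      rw [AppP_iff] at h; rw [h, e] at h'; exact h' rfl
    · intro h
      exact ⟨_, (AppP_iff θ k _).2 rfl, fun e => h (AFml.code_inj e)⟩
  rw [h4]
  tauto

theorem Can_iff (θ : AFml) (c n j : ℕ) : Cl (CanA θ.code c n) CanB j ↔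
    ∃ (b : Bool) (φ : AFml), j = Nat.pair b.toNat φ.code ∧ can (Atm (selfP θ) c n) b φ := by
  constructor
  · intro h
    induction h with
    | ax h =>
      obtain ⟨b, _, t, rfl, ⟨φ, rfl⟩, hb, ht, h⟩ := h
      obtain ⟨b, rfl⟩ : ∃ b' : Bool, b = b'.toNat := by
        rcases hb with rfl | rfl
        · exact ⟨false, rfl⟩
        · exact ⟨true, rfl⟩
      rw [AtmN_iff] at h
      refine ⟨b, φ, rfl, ?_⟩
      cases φ <;> first
        | (simp [AFml.code, Nat.pair_eq_pair] at ht; done)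
        | (cases b <;> exact h)
    | step _ _ h ih1 ih2 =>
      have t0 : ∀ {q : ℕ} {φ : AFml}, (∃ (b : Bool) (φ : AFml), q = Nat.pair b.toNat φ.code ∧
          can (Atm (selfP θ) c n) b φ) → q = Nat.pair 0 φ.code → can (Atm (selfP θ) c n) false φ := by
        rintro q φ ⟨b, ψ, e, h⟩ e'
        rw [e, Nat.pair_eq_pair] at e'
        obtain rfl := AFml.code_inj e'.2
        cases b
        · exact h
        · simp at e'
      have t1 : ∀ {q : ℕ} {φ : AFml}, (∃ (b : Bool) (φ : AFml), q = Nat.pair b.toNat φ.code ∧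
          can (Atm (selfP θ) c n) b φ) → q = Nat.pair 1 φ.code → can (Atm (selfP θ) c n) true φ := by
        rintro q φ ⟨b, ψ, e, h⟩ e'
        rw [e, Nat.pair_eq_pair] at e'
        obtain rfl := AFml.code_inj e'.2
        cases b
        · simp at e'
        · exact h
      obtain ⟨_, _, ⟨x, rfl⟩, ⟨y, rfl⟩, h⟩ := h
      rcases h with ⟨h1, h⟩ | ⟨h1, h⟩ | ⟨h1, h2, h⟩ | ⟨h1, h⟩ | ⟨h1, h⟩ | ⟨h1, h⟩ | ⟨h1, h⟩ |
        ⟨h1, h2, h⟩ | ⟨h1, h⟩ | ⟨h1, h⟩ | ⟨h1, h2, h⟩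
      · exact ⟨true, .neg x, h, t0 ih1 h1⟩
      · exact ⟨false, .neg x, h, t1 ih1 h1⟩
      · exact ⟨true, .and x y, h, t1 ih1 h1, t1 ih2 h2⟩
      · exact ⟨false, .and x y, h, Or.inl (t0 ih1 h1)⟩
      · exact ⟨false, .and x y, h, Or.inr (t0 ih1 h1)⟩
      · exact ⟨true, .or x y, h, Or.inl (t1 ih1 h1)⟩
      · exact ⟨true, .or x y, h, Or.inr (t1 ih1 h1)⟩
      · exact ⟨false, .or x y, h, t0 ih1 h1, t0 ih2 h2⟩
      · exact ⟨true, .imp x y, h, Or.inl (t0 ih1 h1)⟩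
      · exact ⟨true, .imp x y, h, Or.inr (t1 ih1 h1)⟩
      · exact ⟨false, .imp x y, h, t1 ih1 h1, t0 ih2 h2⟩
  · rintro ⟨b, φ, rfl, h⟩
    have hA : ∀ (b : Bool) (φ : AFml) (t : ℕ), (φ.code = Nat.pair 0 t ∨ φ.code = Nat.pair 1 t ∨
        φ.code = Nat.pair 6 t ∨ φ.code = Nat.pair 7 t) → Atm (selfP θ) c n b φ →
        Cl (CanA θ.code c n) CanB (Nat.pair b.toNat φ.code) := by
      intro b φ t ht h
      exact .ax ⟨_, _, t, rfl, ⟨φ, rfl⟩, by cases b <;> simp, ht, (AtmN_iff θ c n b φ).2 h⟩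
    have hB : ∀ (x y : AFml) {j q1 q2 : ℕ}, Cl (CanA θ.code c n) CanB q1 →
        Cl (CanA θ.code c n) CanB q2 → _ → Cl (CanA θ.code c n) CanB j :=
      fun x y j q1 q2 h1 h2 h => .step h1 h2 ⟨x.code, y.code, ⟨x, rfl⟩, ⟨y, rfl⟩, h⟩
    induction φ generalizing b with
    | eq t s => exact hA b _ _ (Or.inl rfl) (by cases b <;> exact h)
    | le t s => exact hA b _ _ (Or.inr (Or.inl rfl)) (by cases b <;> exact h)
    | all t _ => exact hA b _ _ (Or.inr (Or.inr (Or.inl rfl))) (by cases b <;> exact h)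
    | ex t _ => exact hA b _ _ (Or.inr (Or.inr (Or.inr rfl))) (by cases b <;> exact h)
    | neg x ih =>
      cases b
      · have := ih true h
        exact hB x x this this (Or.inr (Or.inl ⟨rfl, rfl⟩))
      · have := ih false h
        exact hB x x this this (Or.inl ⟨rfl, rfl⟩)
    | and x y ih1 ih2 =>
      cases b
      · rcases h with h | h
        · have := ih1 false h
          exact hB x y this this (Or.inr (Or.inr (Or.inr (Or.inl ⟨rfl, rfl⟩))))
        · have := ih2 false h
          exact hB x y this this (Or.inr (Or.inr (Or.inr (Or.inr (Or.inl ⟨rfl, rfl⟩)))))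
      · exact hB x y (ih1 true h.1) (ih2 true h.2) (Or.inr (Or.inr (Or.inl ⟨rfl, rfl, rfl⟩)))
    | or x y ih1 ih2 =>
      cases b
      · exact hB x y (ih1 false h.1) (ih2 false h.2) (Or.inr (Or.inr (Or.inr (Or.inr (Or.inr
          (Or.inr (Or.inr (Or.inl ⟨rfl, rfl, rfl⟩))))))))
      · rcases h with h | h
        · have := ih1 true h
          exact hB x y this this (Or.inr (Or.inr (Or.inr (Or.inr (Or.inr (Or.inl ⟨rfl, rfl⟩))))))
        · have := ih2 true h
          exact hB x y this this (Or.inr (Or.inr (Or.inr (Or.inr (Or.inr (Or.inr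
            (Or.inl ⟨rfl, rfl⟩)))))))
    | imp x y ih1 ih2 =>
      cases b
      · exact hB x y (ih1 true h.1) (ih2 false h.2) (Or.inr (Or.inr (Or.inr (Or.inr (Or.inr
          (Or.inr (Or.inr (Or.inr (Or.inr (Or.inr ⟨rfl, rfl, rfl⟩))))))))))
      · rcases h with h | h
        · have := ih1 false h
          exact hB x y this this (Or.inr (Or.inr (Or.inr (Or.inr (Or.inr
            (Or.inr (Or.inr (Or.inr (Or.inl ⟨rfl, rfl⟩)))))))))
        · have := ih2 true h
          exact hB x y this this (Or.inr (Or.inr (Or.inr (Or.inr (Or.inr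
            (Or.inr (Or.inr (Or.inr (Or.inr (Or.inl ⟨rfl, rfl⟩))))))))))

/-! ### Bad sets -/

def IterR (q : ℕ) : ℕ → ℕ → ℕ → Prop
  | 0, x, y => y = x
  | k + 1, x, y => ∃ z, IterR q k x z ∧ AppP q z y

theorem IterR_iff (θ φ : AFml) (k y : ℕ) :
    IterR θ.code k φ.code y ↔ y = (iterPred (selfP θ) k φ).code := by
  induction k generalizing y with
  | zero => exact Iff.rfl
  | succ k ih =>
    simp only [IterR, ih, AppP_iff, exists_eq_left, iterPred]
    rfl

theorem S1.iterR (k : ℕ) : ∀ {f g h : (ℕ → ℕ) → ℕ}, SF f → SF g → SF h →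
    S1 fun ρ => IterR (f ρ) k (g ρ) (h ρ) := by
  induction k with
  | zero => intro f g h _ hg hh; exact S1.eqF hh hg
  | succ k ih =>
    intro f g h hf hg hh
    exact S1.ex (R := fun z ρ => IterR (f ρ) k (g ρ) z ∧ AppP (f ρ) z (h ρ))
      (S1.and (ih hf.tl hg.tl (SF.var 0)) (S1.appP hf.tl (SF.var 0) hh.tl))

def BadP (m : ℕ) (P : AFml) (c n : ℕ) : Prop := ∃ φ : AFml,
  (iterPred P (m - 1) φ).code < n ∧ InC (iterPred P (m - 1) φ).code c ∧ can (Atm P c n) true φ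

def Bad (m : ℕ) (q c n : ℕ) : Prop := ∃ θ : AFml, q = θ.code ∧ BadP m (selfP θ) c n

theorem S1.bad (m : ℕ) : S1 fun ρ => Bad m (ρ 0) (ρ 1) (ρ 2) := by
  have h1 : S1 fun ρ => ∃ p x, IsF (ρ 0) ∧ IsF p ∧ IterR (ρ 0) (m - 1) p x ∧ x < ρ 2 ∧ InC x (ρ 1) ∧
      Cl (CanA (ρ 0) (ρ 1) (ρ 2)) CanB (Nat.pair 1 p) := by
    refine S1.ex (S1.ex (S1.and (S1.isF (SF.var 2)) (S1.and (S1.isF (SF.var 1)) (S1.and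
      (S1.iterR _ (SF.var 2) (SF.var 1) (SF.var 0)) (S1.and (S1.ltF (SF.var 0) (SF.var 4)) (S1.and
        (S1.inC (SF.var 0) (SF.var 3)) ?_))))))
    refine S1.cl (A := fun ρ => CanA (ρ 2) (ρ 3) (ρ 4)) (B := fun _ => CanB) ?_ ?_
      ((SF.const 1).pair (SF.var 1))
    · unfold CanA AtmN
      repeat' with_reducible
        first | exact SF.var _ | exact SF.const _
              | apply S1.eqF | apply S1.neF | apply SF.pair
              | apply S1.and | apply S1.or | apply S1.ex | apply S1.appP | apply S1.inC
              | apply S1.ninC | apply S1.blt | apply S1.isF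
    · unfold CanB
      repeat' with_reducible
        first | exact SF.var _ | exact SF.const _
              | apply S1.eqF | apply SF.pair | apply SF.ng | apply SF.an | apply SF.orr | apply SF.im
              | apply S1.and | apply S1.or | apply S1.ex | apply S1.isF
  refine h1.congr fun ρ => ?_
  constructor
  · rintro ⟨θ, e, φ, h1, h2, h3⟩
    refine ⟨φ.code, _, ⟨θ, e⟩, ⟨φ, rfl⟩, ?_, h1, h2, ?_⟩
    · rw [e, IterR_iff]
    · rw [e, Can_iff]; exact ⟨true, φ, rfl, h3⟩
  · rintro ⟨_, x, ⟨θ, e⟩, ⟨φ, rfl⟩, h1, h2, h3, h4⟩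
    rw [e, IterR_iff] at h1
    rw [e, Can_iff] at h4
    subst h1
    obtain ⟨b, φ', h5, h6⟩ := h4
    rw [Nat.pair_eq_pair] at h5
    obtain rfl := AFml.code_inj h5.2
    cases b
    · simp at h5
    · exact ⟨θ, e, φ, h2, h3, h6⟩


/-! ### Environments with four entries, and renaming -/

def e4 {α : Type} (a b c d : α) : ℕ → α
  | 0 => a
  | 1 => b
  | 2 => c
  | _ + 3 => d

def rn (φ : AFml) (i j k l : ℕ) : AFml := φ.substAll fun n => .var (e4 i j k l n)

def R4 {M : Type} (S : Str M) (φ : AFml) (a b c d : M) : Prop := φ.Ms S (e4 a b c d)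

theorem e4_comp {α β : Type} (f : α → β) (a b c d : α) :
    (fun n => f (e4 a b c d n)) = e4 (f a) (f b) (f c) (f d) := by
  funext n
  match n with
  | 0 => rfl
  | 1 => rfl
  | 2 => rfl
  | _ + 3 => rfl

theorem rn_Ms {M : Type} (S : Str M) (φ : AFml) (i j k l : ℕ) (ρ : ℕ → M) :
    (rn φ i j k l).Ms S ρ ↔ R4 S φ (ρ i) (ρ j) (ρ k) (ρ l) := by
  unfold rn R4
  rw [AFml.Ms_subst]
  rw [← e4_comp]
  exact Iff.rfl

theorem rn_delta0 {φ : AFml} (h : IsDelta0 φ) (i j k l : ℕ) : IsDelta0 (rn φ i j k l) := h.subst _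

theorem rn_freeLt (φ : AFml) {i j k l c : ℕ} (hi : i < c) (hj : j < c) (hk : k < c) (hl : l < c) :
    (rn φ i j k l).FreeLt c := by
  obtain ⟨c', hc⟩ := AFml.exists_freeLt φ
  refine AFml.FreeLt.subst φ ?_ hc
  intro n _
  match n with
  | 0 => exact hi
  | 1 => exact hj
  | 2 => exact hk
  | _ + 3 => exact hl

theorem R4_abs {M : Type} {S : Str M} (hM : Models S PA) {φ : AFml} (h : IsDelta0 φ) (a b c d : ℕ) :
    R4 S φ (S.num a) (S.num b) (S.num c) (S.num d) ↔ R4 natStr φ a b c d := by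
  unfold R4
  rw [natStr_Ms, ← delta0_abs hM h, e4_comp]

/-! ### The basic data -/

structure Dat (Tax : Set AFml) (m : ℕ) where
  dl : AFml
  w : AFml
  b : AFml
  pf : AFml
  me : AFml
  inn : AFml
  dl0 : IsDelta0 dl
  w0 : IsDelta0 w
  b0 : IsDelta0 b
  pf0 : IsDelta0 pf
  me0 : IsDelta0 me
  inn0 : IsDelta0 inn
  dl_ex : ∀ (M : Type) (S : Str M), Models S Tax → ∃ y, R4 S dl y y y y
  dl_nat : ∀ y, ¬ R4 natStr dl y y y y
  w1 : ∀ q y, R4 natStr w q y y y → WW Tax q y.unpair.1 y.unpair.2.unpair.1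
  w2 : ∀ q c n, WW Tax q c n → ∃ t, ∀ y, y = Nat.pair c (Nat.pair n t) → R4 natStr w q y y y
  b1 : ∀ q c n, Bad m q c n ↔ ∃ z, R4 natStr b q c n z
  pf1 : ∀ x, Thm Tax x ↔ ∃ z, R4 natStr pf x z z z
  me1 : ∀ x y, R4 natStr me x y y y ↔ Mem x y
  inn1 : ∀ x y, R4 natStr inn x y y y ↔ InC x y

theorem S1.get {R : (ℕ → ℕ) → Prop} (h : S1 R) : ∃ D, D0 D ∧ ∀ ρ, R ρ ↔ ∃ y, D (consEnv y ρ) := by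
  unfold S1 at h; exact h

def e5 (v a b c d : ℕ) : ℕ → ℕ
  | 0 => v
  | 1 => a
  | 2 => b
  | 3 => c
  | _ + 4 => d

theorem D0.e5 {D : (ℕ → ℕ) → Prop} (h : D0 D) (v a b c d : ℕ) :
    D0 fun ρ => D (consEnv (ρ v) (e4 (ρ a) (ρ b) (ρ c) (ρ d))) := by
  refine (h.subst (fun n ρ => ρ (PLN.e5 v a b c d n)) (fun n => TF.var _)).congr fun ρ => ?_
  have : consEnv (ρ v) (e4 (ρ a) (ρ b) (ρ c) (ρ d)) = fun n => ρ (PLN.e5 v a b c d n) := by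
    funext n
    match n with
    | 0 => rfl
    | 1 => rfl
    | 2 => rfl
    | 3 => rfl
    | _ + 4 => rfl
  rw [this]

theorem exists_Dat {Tax : Set AFml} (hext : PA ⊆ Tax) (hpr : PrAxiomatized Tax)
    (hill : ¬ Sigma1Sound Tax) (m : ℕ) : Nonempty (Dat Tax m) := by
  obtain ⟨δ, hδ0, hδf, hδe, hδn⟩ := exists_ill hext hill
  obtain ⟨Dw, hDw, hw⟩ := (S1.ww hpr).get
  obtain ⟨Db, hDb, hb⟩ := (S1.bad m).get
  obtain ⟨Dp, hDp, hp⟩ := (S1.thm hpr (SF.var 0)).get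
  have h1 : D0 fun ρ => Dw (consEnv (ρ 1).unpair.2.unpair.2 (e4 (ρ 0) (ρ 1).unpair.1
      (ρ 1).unpair.2.unpair.1 (ρ 1).unpair.2.unpair.1)) :=
    D0.ev (R := fun c n t ρ => Dw (consEnv t (e4 (ρ 0) c n n))) 1 (hDw.e5 0 4 3 1 1)
  have h2 := hDb.e5 3 0 1 2 2
  have h3 := hDp.e5 1 0 0 0 0
  obtain ⟨w, w0, w1⟩ := h1
  obtain ⟨b, b0, b1⟩ := h2
  obtain ⟨p, p0, p1⟩ := h3
  obtain ⟨me, me0, me1⟩ := D0.mem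
  obtain ⟨inn, in0, in1⟩ := D0.inC
  have hc : ∀ {M : Type} (S : Str M) (y : M) (ρ : ℕ → M),
      δ.Ms S (mcons y ρ) ↔ R4 S δ y y y y := by
    intro M S y ρ
    refine AFml.Ms_congr S δ ?_ hδf
    intro n hn
    obtain rfl : n = 0 := by omega
    rfl
  refine ⟨⟨δ, w, b, p, me, inn, hδ0, w0, b0, p0, me0, in0, ?_, ?_, ?_, ?_, ?_, ?_, ?_, ?_⟩⟩
  · intro M S hM
    obtain ⟨y, hy⟩ := hδe M S hM (fun _ => S.zero)
    exact ⟨y, (hc S y _).1 hy⟩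
  · intro y hy
    rw [← hc natStr y (fun _ => 0), natStr_Ms] at hy
    refine hδn (fun _ => 0) y ?_
    have : mcons y (fun _ => 0) = consEnv y (fun _ => 0) := by
      funext n; cases n <;> rfl
    rwa [this] at hy
  · intro q y h
    unfold R4 at h
    rw [natStr_Ms, w1] at h
    exact (hw (e4 q y.unpair.1 y.unpair.2.unpair.1 y.unpair.2.unpair.1)).2 ⟨_, h⟩
  · intro q c n h
    obtain ⟨t, ht⟩ := (hw (e4 q c n n)).1 h
    refine ⟨t, fun y e => ?_⟩
    unfold R4
    rw [natStr_Ms, w1]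
    simp only [e4, e, Nat.unpair_pair]
    exact ht
  · intro q c n
    refine (hb (e4 q c n n)).trans (exists_congr fun z => ?_)
    unfold R4
    rw [natStr_Ms, b1]; exact Iff.rfl
  · intro x
    refine (hp (e4 x x x x)).trans (exists_congr fun z => ?_)
    unfold R4
    rw [natStr_Ms, p1]; exact Iff.rfl
  · intro x y
    unfold R4
    rw [natStr_Ms, me1]; exact Iff.rfl
  · intro x y
    unfold R4
    rw [natStr_Ms, in1]; exact Iff.rfl

theorem subst0_freeLt (θ : AFml) (h : θ.FreeLt 2) (k : ℕ) : (θ.subst0 (numeral k)).FreeLt 1 := by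
  refine AFml.FreeLt.subst θ ?_ h
  intro n hn
  match n with
  | 0 => exact numeral_freeLt k 1
  | 1 => exact Nat.one_pos

/-! ### The formula -/

namespace Dat
variable {Tax : Set AFml} {m : ℕ} (d : Dat Tax m)

def evW : AFml := .and (rn d.w 0 1 1 1) (.and
  (ballF (.var 1) (.imp (rn d.me 0 2 2 2) (ballF (.var 2) (.neg (rn d.pf 1 0 0 0)))))
  (ballF (.var 1) (ballF (.var 2) (ballF (.var 3) (.imp (rn d.b 3 2 1 0)
    (bexF (.var 1) (.and (.le (.succ (.var 0)) (.var 2))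
      (.neg (iffF (rn d.inn 0 3 3 3) (rn d.me 0 5 5 5))))))))))

def ev : AFml := .or (rn d.dl 1 1 1 1) d.evW

def thBody : AFml := .and
  (ballF (.var 0) (.imp (.le (.succ (.var 0)) (.var 1)) (.neg (rn d.ev 2 0 0 0))))
  (.or (rn d.pf 2 0 0 0) (.and (rn d.ev 1 0 0 0) (.neg (.and (rn d.evW 1 0 0 0) (rn d.me 2 0 0 0)))))

def th : AFml := .ex (.and (.eq (.var 2) (.var 2)) d.thBody)

def P : AFml := selfP d.th

theorem evW0 : IsDelta0 d.evW :=
  .and (rn_delta0 d.w0 _ _ _ _) (.and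
    (.ball _ (.imp (rn_delta0 d.me0 _ _ _ _) (.ball _ (.neg (rn_delta0 d.pf0 _ _ _ _)))))
    (.ball _ (.ball _ (.ball _ (.imp (rn_delta0 d.b0 _ _ _ _) (.bex _ (.and (.le _ _)
      (.neg (.and (.imp (rn_delta0 d.inn0 _ _ _ _) (rn_delta0 d.me0 _ _ _ _))
        (.imp (rn_delta0 d.me0 _ _ _ _) (rn_delta0 d.inn0 _ _ _ _)))))))))))

theorem ev0 : IsDelta0 d.ev := .or (rn_delta0 d.dl0 _ _ _ _) d.evW0

theorem thBody0 : IsDelta0 d.thBody :=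
  .and (.ball _ (.imp (.le _ _) (.neg (rn_delta0 d.ev0 _ _ _ _))))
    (.or (rn_delta0 d.pf0 _ _ _ _) (.and (rn_delta0 d.ev0 _ _ _ _)
      (.neg (.and (rn_delta0 d.evW0 _ _ _ _) (rn_delta0 d.me0 _ _ _ _)))))

theorem P_sigma1 : IsSigma1 d.P :=
  .ex (.delta0 (.and (.eq _ _) (d.thBody0.subst _)))

theorem atP_sigma1 (k : ℕ) : ∃ ψ, atP d.P k = .ex ψ ∧ IsDelta0 ψ :=
  ⟨_, rfl, .and (.eq _ _) ((d.thBody0.subst _).subst _)⟩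

theorem th_freeLt : d.th.FreeLt 2 := by
  refine ⟨⟨by simp [ATerm.FreeLt, ATerm.lift], by simp [ATerm.FreeLt, ATerm.lift]⟩, ⟨⟨?_, ?_, ?_⟩, ?_, ?_, ?_, ?_⟩⟩
  · exact ⟨by simp [ATerm.FreeLt, ATerm.lift], by simp [ATerm.FreeLt, ATerm.lift]⟩
  · exact ⟨by simp [ATerm.FreeLt, ATerm.lift], by simp [ATerm.FreeLt, ATerm.lift]⟩
  all_goals apply rn_freeLt <;> decide

theorem P_freeLt : d.P.FreeLt 1 := subst0_freeLt _ d.th_freeLt _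

theorem atP_shape (k : ℕ) : ∃ ψ, atP d.P k =
    .ex (.and (.eq ((numeral k).lift 0) ((numeral k).lift 0)) ψ) := ⟨_, rfl⟩

end Dat

theorem numeral_lift (k c : ℕ) : (numeral k).lift c = numeral k := by
  induction k with
  | zero => rfl
  | succ k ih => simp [numeral, ATerm.lift, ih]

theorem numeral_inj {k j : ℕ} (h : numeral k = numeral j) : k = j := by
  have := congrArg (ATerm.val fun _ => 0) h
  simpa [val_numeral] using this

theorem numeral_code (k : ℕ) : k ≤ (numeral k).code := by
  induction k with
  | zero => exact Nat.zero_le _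
  | succ k ih =>
    simp only [numeral, ATerm.code]
    have h1 : (numeral k).code < Nat.pair 2 (numeral k).code := by
      have := Nat.add_le_pair 2 (numeral k).code
      omega
    omega

namespace Dat
variable {Tax : Set AFml} {m : ℕ} (d : Dat Tax m)

theorem atP_inj {k j : ℕ} (h : atP d.P k = atP d.P j) : k = j := by
  obtain ⟨ψ, e⟩ := d.atP_shape k
  obtain ⟨ψ', e'⟩ := d.atP_shape j
  rw [e, e'] at h
  injection h with h
  injection h with h _
  injection h with h _
  rw [numeral_lift, numeral_lift] at h
  exact numeral_inj h

theorem le_atP (k : ℕ) : k < (atP d.P k).code := by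
  obtain ⟨ψ, e⟩ := d.atP_shape k
  rw [e, numeral_lift]
  simp only [AFml.code]
  have h0 := numeral_code k
  have h1 := Nat.right_le_pair 0 (Nat.pair (numeral k).code (numeral k).code)
  have h2 := Nat.left_le_pair (numeral k).code (numeral k).code
  have h3 := Nat.left_le_pair (Nat.pair 0 (Nat.pair (numeral k).code (numeral k).code)) ψ.code
  have h4 := Nat.add_le_pair 3 (Nat.pair (Nat.pair 0 (Nat.pair (numeral k).code (numeral k).code)) ψ.code)
  have h5 := Nat.add_le_pair 7 (Nat.pair 3 (Nat.pair (Nat.pair 0 (Nat.pair (numeral k).code (numeral k).code)) ψ.code))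
  omega

/-! ### Semantics -/

def EvW {M : Type} (S : Str M) (y : M) : Prop :=
  R4 S d.evW (S.num d.th.code) y y y
def Ev {M : Type} (S : Str M) (y : M) : Prop :=
  R4 S d.ev (S.num d.th.code) y y y

theorem EvW_iff {M : Type} (S : Str M) (y : M) : d.EvW S y ↔
    R4 S d.w (S.num d.th.code) y y y ∧
    (∀ x, S.le x y → R4 S d.me x y y y → ∀ z, S.le z y → ¬ R4 S d.pf x z z z) ∧
    (∀ r, S.le r y → ∀ n, S.le n y → ∀ z, S.le z y → R4 S d.b (S.num d.th.code) r n z →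
      ∃ x, S.le x n ∧ S.le (S.succ x) n ∧ ¬ (R4 S d.inn x r r r ↔ R4 S d.me x y y y)) := by
  unfold EvW
  generalize S.num d.th.code = q
  conv_lhs => unfold R4 evW
  simp only [AFml.Ms, ballF_Ms, bexF_Ms, rn_Ms, iffF, ← iff_iff_implies_and_implies]
  rfl

theorem Ev_iff {M : Type} (S : Str M) (y : M) : d.Ev S y ↔ R4 S d.dl y y y y ∨ d.EvW S y := by
  unfold Ev EvW
  generalize S.num d.th.code = q
  conv_lhs => unfold R4 ev
  simp only [AFml.Ms, rn_Ms]
  rfl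

theorem atP_Ms {M : Type} (S : Str M) (ρ : ℕ → M) (k : ℕ) : (atP d.P k).Ms S ρ ↔
    ∃ y, (∀ z, S.le z y → S.le (S.succ z) y → ¬ d.Ev S z) ∧
      (R4 S d.pf (S.num k) y y y ∨ (d.Ev S y ∧ ¬ (d.EvW S y ∧ R4 S d.me (S.num k) y y y))) := by
  unfold atP P selfP
  rw [AFml.Ms_subst0, AFml.Ms_subst0, numeral_ev, numeral_ev]
  unfold Ev EvW
  generalize S.num d.th.code = q
  generalize S.num k = x
  unfold th thBody
  simp only [AFml.Ms, ballF_Ms, rn_Ms]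
  refine exists_congr fun y => ?_
  constructor
  · rintro ⟨_, h⟩; exact h
  · intro h; exact ⟨trivial, h⟩

theorem EvW_abs {M : Type} {S : Str M} (hM : Models S PA) (y : ℕ) :
    d.EvW S (S.num y) ↔ d.EvW natStr y := by
  unfold EvW
  rw [R4_abs hM d.evW0, natStr_num]

theorem Ev_abs {M : Type} {S : Str M} (hM : Models S PA) (y : ℕ) :
    d.Ev S (S.num y) ↔ d.Ev natStr y := by
  unfold Ev
  rw [R4_abs hM d.ev0, natStr_num]

/-- truth values of `P(k̄)` given the first event `y` -/
theorem atP_first {M : Type} {S : Str M} (hM : Models S PA) (y : M) (hy : d.Ev S y)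
    (hf : ∀ z, S.le (S.succ z) y → ¬ d.Ev S z) (k : ℕ) (hk : S.le (S.num k) y) (ρ : ℕ → M) :
    (atP d.P k).Ms S ρ ↔ ¬ (d.EvW S y ∧ R4 S d.me (S.num k) y y y) := by
  rw [atP_Ms]
  constructor
  · rintro ⟨y', h1, h2⟩ ⟨h3, h4⟩
    have hle : S.le y' y := by
      rcases pa_trich hM y' y with h | h
      · exact h
      · exact absurd hy (h1 y (pa_le_trans hM (pa_le_succ hM y) h) h)
    rcases h2 with h2 | ⟨h2, h5⟩
    · exact ((d.EvW_iff S y).1 h3).2.1 _ hk h4 y' hle h2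
    · rcases pa_trich hM y y' with h | h
      · obtain rfl := pa_le_antisymm hM h hle
        exact h5 ⟨h3, h4⟩
      · exact hf y' h h2
  · intro h
    exact ⟨y, fun z _ hz => hf z hz, Or.inr ⟨hy, h⟩⟩

end Dat

theorem Models.mono {M : Type} {S : Str M} {Γ Δ : Set AFml} (h : Γ ⊆ Δ) (hM : Models S Δ) :
    Models S Γ := fun φ hφ => hM φ (h hφ)

theorem bot_Ms {M : Type} {S : Str M} (hM : Models S PA) (ρ : ℕ → M) : ¬ botFml.Ms S ρ :=
  fun h => pa_succ_ne_zero hM _ (Eq.symm h)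

theorem chain_Ms {M : Type} {S : Str M} {ρ : ℕ → M} (P : AFml) (c n : ℕ)
    (h : ∀ k < n, (lit P c k).Ms S ρ) (hc : (chain P c n).Ms S ρ) : botFml.Ms S ρ := by
  induction n with
  | zero => exact hc
  | succ n ih => exact ih (fun k hk => h k (Nat.lt_succ_of_lt hk)) (hc (h n (Nat.lt_succ_self n)))

theorem Mem.lt {x y : ℕ} (h : Mem x y) : x < y :=
  h.1.trans_le ((Nat.unpair_left_le _).trans (Nat.unpair_right_le _))

theorem WW_iff {Tax : Set AFml} (θ : AFml) (c n : ℕ) :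
    WW Tax θ.code c n ↔ Proves Tax (chain (selfP θ) c n) := by
  constructor
  · rintro ⟨θ', e, h⟩
    rw [AFml.code_inj e]; exact h
  · intro h; exact ⟨θ, rfl, h⟩

theorem Bad_iff (m : ℕ) (θ : AFml) (c n : ℕ) : Bad m θ.code c n ↔ BadP m (selfP θ) c n := by
  constructor
  · rintro ⟨θ', e, h⟩
    rw [AFml.code_inj e]; exact h
  · intro h; exact ⟨θ, rfl, h⟩

theorem can_of_Ms {M : Type} {S : Str M} {ρ : ℕ → M} {A : Bool → AFml → Prop}
    (hA : ∀ φ : AFml, (φ.Ms S ρ → A true φ) ∧ (¬ φ.Ms S ρ → A false φ)) (φ : AFml) :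
    (φ.Ms S ρ → can A true φ) ∧ (¬ φ.Ms S ρ → can A false φ) := by
  induction φ with
  | eq t s => exact hA _
  | le t s => exact hA _
  | all t _ => exact hA _
  | ex t _ => exact hA _
  | neg φ ih =>
    simp only [AFml.Ms, can, Bool.not_true, Bool.not_false]
    tauto
  | and φ ψ ih1 ih2 => simp only [AFml.Ms, can]; tauto
  | or φ ψ ih1 ih2 => simp only [AFml.Ms, can]; tauto
  | imp φ ψ ih1 ih2 => simp only [AFml.Ms, can]; tauto

namespace Dat
variable {Tax : Set AFml} {m : ℕ} (d : Dat Tax m)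

theorem no_event (hext : PA ⊆ Tax) (hcons : ¬ Proves Tax botFml) (y : ℕ) : ¬ d.Ev natStr y := by
  induction y using Nat.strong_induction_on with
  | _ y ih =>
  intro hy
  have hW : d.EvW natStr y := ((d.Ev_iff _ _).1 hy).resolve_left (d.dl_nat y)
  have hw := ((d.EvW_iff _ _).1 hW).1
  rw [natStr_num] at hw
  have hw := d.w1 _ _ hw
  rw [WW_iff] at hw
  apply hcons
  refine completeness fun M S hM ρ => ?_
  have hPA := hM.mono hext
  refine chain_Ms _ _ _ ?_ (soundness hM hw ρ)
  intro k hk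
  have hky : k ≤ y := (hk.trans_le ((Nat.unpair_left_le _).trans (Nat.unpair_right_le _))).le
  have key := d.atP_first hPA (S.num y) ((d.Ev_abs hPA y).2 hy) (by
    intro z hz
    obtain ⟨j, hj, rfl⟩ := le_num hPA (pa_le_trans hPA (pa_le_succ hPA z) hz)
    have : j + 1 ≤ y := (num_le hPA (a := j + 1)).1 hz
    rw [d.Ev_abs hPA]
    exact ih j this) k ((num_le hPA).2 hky) ρ
  have hmem : R4 S d.me (S.num k) (S.num y) (S.num y) (S.num y) ↔ InC k y.unpair.1 := by
    rw [R4_abs hPA d.me0, d.me1]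
    exact ⟨fun h => h.2, fun h => ⟨hk, h⟩⟩
  rw [d.EvW_abs hPA, hmem] at key
  change (lit d.P _ k).Ms S ρ
  unfold lit
  by_cases h : InC k y.unpair.1
  · rw [if_pos h]
    intro h'
    exact (key.1 h') ⟨hW, h⟩
  · rw [if_neg h]
    exact key.2 fun h' => h h'.2

theorem provPred (hext : PA ⊆ Tax) (hcons : ¬ Proves Tax botFml) : IsProvPred Tax d.P := by
  refine ⟨d.P_freeLt, fun φ => ?_⟩
  have hT : Thm Tax φ.code ↔ Proves Tax φ := by
    constructor
    · rintro ⟨ψ, e, h⟩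
      rw [AFml.code_inj e]; exact h
    · intro h; exact ⟨φ, rfl, h⟩
  rw [← hT, d.pf1]
  change _ ↔ Proves PA (atP d.P φ.code)
  constructor
  · rintro ⟨z, hz⟩
    refine completeness fun M S hM ρ => ?_
    rw [atP_Ms]
    refine ⟨S.num z, fun y hy _ => ?_, Or.inl ((R4_abs hM d.pf0 _ _ _ _).2 hz)⟩
    obtain ⟨j, _, rfl⟩ := le_num hM hy
    rw [d.Ev_abs hM]
    exact d.no_event hext hcons j
  · intro h
    have := soundness natStr_PA h (fun _ => 0)
    rw [atP_Ms] at this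
    obtain ⟨y, _, h | h⟩ := this
    · rw [natStr_num] at h; exact ⟨y, h⟩
    · exact absurd h.1 (d.no_event hext hcons y)

theorem acc (hext : PA ⊆ Tax) (hcons : ¬ Proves Tax botFml) (hm : 1 ≤ m) (φ : AFml) :
    Proves Tax (.imp φ (iterPred d.P m φ)) := by
  refine completeness fun M S hM ρ => ?_
  have hPA := hM.mono hext
  intro hφ
  obtain ⟨m', rfl⟩ : ∃ m', m = m' + 1 := ⟨m - 1, by omega⟩
  change (atP d.P (iterPred d.P m' φ).code).Ms S ρ
  -- first event
  obtain ⟨y, hy, hf⟩ : ∃ y, d.Ev S y ∧ ∀ z, S.le (S.succ z) y → ¬ d.Ev S z := by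
    obtain ⟨y, hy⟩ := d.dl_ex M S hM
    have e : ∀ y, (rn d.ev 1 0 0 0).Ms S (mcons y fun _ => S.num d.th.code) ↔ d.Ev S y := by
      intro y; unfold Ev
      generalize S.num d.th.code = q
      rw [rn_Ms]; exact Iff.rfl
    obtain ⟨y, h1, h2⟩ := pa_lnp hPA (rn d.ev 1 0 0 0) (fun _ => S.num d.th.code)
      ⟨y, (e y).2 ((d.Ev_iff _ _).2 (Or.inl hy))⟩
    exact ⟨y, (e y).1 h1, fun z hz h => h2 z hz ((e z).2 h)⟩
  have hns : ∀ k, y ≠ S.num k := by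
    rintro k rfl
    rw [d.Ev_abs hPA] at hy
    exact d.no_event hext hcons k hy
  have key := fun k => d.atP_first hPA y hy hf k (num_le_nonstd hPA hns k) ρ
  rw [key]
  rintro ⟨hW, hx⟩
  obtain ⟨c, hc⟩ := exists_InC (fun k => R4 S d.me (S.num k) y y y) ((iterPred d.P m' φ).code + 1)
  have hbad : BadP (m' + 1) d.P c ((iterPred d.P m' φ).code + 1) := by
    refine ⟨φ, Nat.lt_succ_self _, (hc _ (Nat.lt_succ_self _)).2 hx, (can_of_Ms ?_ φ).1 hφ⟩
    intro ψ
    by_cases hb : ψ = botFml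
    · subst hb
      exact ⟨fun h => absurd h (bot_Ms hPA ρ), fun _ => Or.inl ⟨rfl, rfl⟩⟩
    · refine ⟨fun h => Or.inr ⟨hb, fun k hk e => ?_⟩, fun h => Or.inr ⟨hb, fun k hk e => ?_⟩⟩
      · rw [hc k hk]
        rw [e, key] at h
        simpa [hW] using h
      · rw [hc k hk]
        rw [e, key] at h
        simpa [hW] using h
  have hbad := (Bad_iff (m' + 1) d.th _ _).2 hbad
  rw [d.b1] at hbad
  obtain ⟨z, hz⟩ := hbad
  have hz := (R4_abs hPA d.b0 _ _ _ _).2 hz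
  obtain ⟨x, h1, h2, h3⟩ := ((d.EvW_iff _ _).1 hW).2.2 _ (num_le_nonstd hPA hns c) _
    (num_le_nonstd hPA hns _) _ (num_le_nonstd hPA hns z) hz
  obtain ⟨j, _, rfl⟩ := le_num hPA h1
  have hj : j + 1 ≤ _ := (num_le hPA (a := j + 1)).1 h2
  apply h3
  rw [R4_abs hPA d.inn0, d.inn1]
  exact hc j hj

end Dat

/-- the sentences `⊥_i` -/
def bt (i : ℕ) : AFml := .and botFml (.eq (numeral i) (numeral i))

/-- the interpretation used for completeness -/
def ff (P : AFml) : MFml → AFml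
  | .var i => atP P (bt i).code
  | .bot => botFml
  | .neg A => .neg (ff P A)
  | .and A B => .and (ff P A) (ff P B)
  | .or A B => .or (ff P A) (ff P B)
  | .imp A B => .imp (ff P A) (ff P B)
  | .box A => atP P (ff P A).code

theorem chain_intro {M : Type} {S : Str M} {ρ : ℕ → M} (P : AFml) (c n : ℕ)
    (h : (∀ k < n, (lit P c k).Ms S ρ) → botFml.Ms S ρ) : (chain P c n).Ms S ρ := by
  induction n with
  | zero => exact h fun k hk => absurd hk (Nat.not_lt_zero k)
  | succ n ih =>
    intro hl
    refine ih fun h' => h fun k hk => ?_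
    rcases Nat.lt_succ_iff_lt_or_eq.1 hk with h1 | rfl
    · exact h' k h1
    · exact hl

theorem code_neg (φ : AFml) : φ.code < (AFml.neg φ).code := by
  have := Nat.add_le_pair 2 φ.code
  simp only [AFml.code]; omega
theorem code_bin (a x y : ℕ) (ha : 0 < a) :
    x < Nat.pair a (Nat.pair x y) ∧ y < Nat.pair a (Nat.pair x y) := by
  have := Nat.add_le_pair a (Nat.pair x y)
  have := Nat.left_le_pair x y
  have := Nat.right_le_pair x y
  omega

/-- Maximal consistent sets of modal formulas. -/
structure MCS (m : ℕ) (M : Set MFml) : Prop where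
  log : ∀ A, NAProves m 0 A → A ∈ M
  bot : MFml.bot ∉ M
  neg : ∀ A, MFml.neg A ∈ M ↔ ¬ A ∈ M
  and : ∀ A B, MFml.and A B ∈ M ↔ (A ∈ M ∧ B ∈ M)
  or : ∀ A B, MFml.or A B ∈ M ↔ (A ∈ M ∨ B ∈ M)
  imp : ∀ A B, MFml.imp A B ∈ M ↔ (A ∈ M → B ∈ M)

theorem exists_MCS {m : ℕ} {C : MFml} (hC : ¬ NAProves m 0 C) : ∃ M, MCS m M ∧ C ∉ M := by
  obtain ⟨M, hL, hmp, hCM, hdec⟩ := lindenbaum MFml.imp {A | NAProves m 0 A}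
    (fun A B => .taut fun v => by simp only [MFml.evalTC]; tauto)
    (fun A B D => .taut fun v => by simp only [MFml.evalTC]; tauto)
    (fun A B h1 h2 => .mp h1 h2) C hC
  have hT : ∀ {A}, MTaut A → A ∈ M := fun h => hL (.taut h)
  have hbot : MFml.bot ∉ M := fun h => hCM (hmp _ _ (hT fun v => by simp only [MFml.evalTC]; tauto) h)
  have hneg : ∀ A, MFml.neg A ∈ M ↔ ¬ A ∈ M := by
    intro A
    constructor
    · intro h h'
      exact hbot (hmp _ _ (hmp _ _ (hT (A := .imp (.neg A) (.imp A .bot))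
        fun v => by simp only [MFml.evalTC]; tauto) h) h')
    · intro h
      have h1 := (hdec A).resolve_left h
      rcases hdec (.neg A) with h2 | h2
      · exact h2
      · exact absurd (hmp _ _ (hmp _ _ (hT (A := .imp (.imp A C) (.imp (.imp (.neg A) C) C))
          fun v => by simp only [MFml.evalTC]; tauto) h1) h2) hCM
  have himp : ∀ A B, MFml.imp A B ∈ M ↔ (A ∈ M → B ∈ M) := by
    intro A B
    constructor
    · intro h h'; exact hmp _ _ h h'
    · intro h
      by_cases hA : A ∈ M
      · exact hmp _ _ (hT (A := .imp B (.imp A B)) fun v => by simp only [MFml.evalTC]; tauto) (h hA)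
      · exact hmp _ _ (hT (A := .imp (.neg A) (.imp A B))
          fun v => by simp only [MFml.evalTC]; tauto) ((hneg A).2 hA)
  refine ⟨M, ⟨fun A h => hL h, hbot, hneg, ?_, ?_, himp⟩, hCM⟩
  · intro A B
    have h1 : MFml.imp (.and A B) A ∈ M := hT fun v => by simp only [MFml.evalTC]; tauto
    have h2 : MFml.imp (.and A B) B ∈ M := hT fun v => by simp only [MFml.evalTC]; tauto
    have h3 : MFml.imp A (.imp B (.and A B)) ∈ M := hT fun v => by simp only [MFml.evalTC]; tauto
    simp only [himp] at h1 h2 h3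
    tauto
  · intro A B
    have h1 : MFml.imp A (.or A B) ∈ M := hT fun v => by simp only [MFml.evalTC]; tauto
    have h2 : MFml.imp B (.or A B) ∈ M := hT fun v => by simp only [MFml.evalTC]; tauto
    have h3 : MFml.imp (.or A B) (.imp (.neg A) B) ∈ M := hT fun v => by
      simp only [MFml.evalTC]; tauto
    simp only [himp, hneg] at h1 h2 h3
    tauto

theorem IsSub.trans {A B C : MFml} (h1 : IsSub A B) (h2 : IsSub B C) : IsSub A C := by
  induction h2 with
  | refl => exact h1
  | neg _ ih => exact .neg ih
  | andL _ ih => exact .andL ih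
  | andR _ ih => exact .andR ih
  | orL _ ih => exact .orL ih
  | orR _ ih => exact .orR ih
  | impL _ ih => exact .impL ih
  | impR _ ih => exact .impR ih
  | box _ ih => exact .box ih

theorem boxIter_sub (k : ℕ) (A : MFml) : IsSub A (boxIter k A) := by
  induction k with
  | zero => exact .refl _
  | succ k ih => exact .box ih

theorem iterPred_succ (P : AFml) (k : ℕ) (φ : AFml) :
    iterPred P (k + 1) φ = atP P (iterPred P k φ).code := rfl

theorem iterPred_le {P : AFml} (h : ∀ k, k < (atP P k).code) (k : ℕ) (φ : AFml) :
    φ.code ≤ (iterPred P k φ).code := by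
  induction k with
  | zero => exact le_rfl
  | succ k ih => exact ih.trans (h _).le

namespace Dat
variable {Tax : Set AFml} {m : ℕ} (d : Dat Tax m)

theorem ff_sub {B A : MFml} (h : IsSub B A) : (ff d.P B).code ≤ (ff d.P A).code := by
  induction h with
  | refl => exact le_rfl
  | neg _ ih => exact ih.trans (code_neg _).le
  | andL _ ih => exact ih.trans (code_bin 3 _ _ (by decide)).1.le
  | andR _ ih => exact ih.trans (code_bin 3 _ _ (by decide)).2.le
  | orL _ ih => exact ih.trans (code_bin 4 _ _ (by decide)).1.le
  | orR _ ih => exact ih.trans (code_bin 4 _ _ (by decide)).2.le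
  | impL _ ih => exact ih.trans (code_bin 5 _ _ (by decide)).1.le
  | impR _ ih => exact ih.trans (code_bin 5 _ _ (by decide)).2.le
  | box _ ih => exact ih.trans (d.le_atP _).le

theorem ff_bt (A : MFml) (i : ℕ) : ff d.P A ≠ bt i := by
  intro h
  cases A with
  | and A B =>
    injection h with _ h
    cases B with
    | bot =>
      injection h with h1 h2
      rw [← h1] at h2
      exact ATerm.noConfusion h2
    | var j => exact AFml.noConfusion h
    | box B => exact AFml.noConfusion h
    | neg B => exact AFml.noConfusion h
    | and B _ => exact AFml.noConfusion h
    | or B _ => exact AFml.noConfusion h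
    | imp B _ => exact AFml.noConfusion h
  | var j => exact AFml.noConfusion h
  | bot => exact AFml.noConfusion h
  | box B => exact AFml.noConfusion h
  | neg B => exact AFml.noConfusion h
  | or B _ => exact AFml.noConfusion h
  | imp B _ => exact AFml.noConfusion h

theorem bt_inj {i j : ℕ} (h : bt i = bt j) : i = j := by
  injection h with _ h
  injection h with h _
  exact numeral_inj h

theorem atP_ne_bot (k : ℕ) : atP d.P k ≠ botFml := fun h => AFml.noConfusion h

theorem ff_atP {A : MFml} {k : ℕ} (h : ff d.P A = atP d.P k) :
    (∃ i, A = .var i ∧ k = (bt i).code) ∨ ∃ B, A = .box B ∧ k = (ff d.P B).code := by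
  cases A with
  | var i => exact Or.inl ⟨i, rfl, (d.atP_inj h).symm⟩
  | box B => exact Or.inr ⟨B, rfl, (d.atP_inj h).symm⟩
  | bot => exact AFml.noConfusion h
  | neg B => exact AFml.noConfusion h
  | and B _ => exact AFml.noConfusion h
  | or B _ => exact AFml.noConfusion h
  | imp B _ => exact AFml.noConfusion h

theorem ff_inj : ∀ {A B : MFml}, ff d.P A = ff d.P B → A = B := by
  intro A
  induction A with
  | var i =>
    intro B h
    rcases d.ff_atP h.symm with ⟨j, rfl, e⟩ | ⟨B, rfl, e⟩
    · rw [bt_inj (AFml.code_inj e)]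
    · exact absurd (AFml.code_inj e).symm (d.ff_bt B i)
  | box A ih =>
    intro B h
    rcases d.ff_atP h.symm with ⟨j, rfl, e⟩ | ⟨B, rfl, e⟩
    · exact absurd (AFml.code_inj e) (d.ff_bt A j)
    · rw [ih (AFml.code_inj e)]
  | bot =>
    intro B h
    cases B with
    | bot => rfl
    | var j => exact AFml.noConfusion h
    | box B => exact AFml.noConfusion h
    | neg B => exact AFml.noConfusion h
    | and B _ => exact AFml.noConfusion h
    | or B _ => exact AFml.noConfusion h
    | imp B _ => exact AFml.noConfusion h
  | neg A ih =>
    intro B h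
    cases B with
    | bot => exact AFml.noConfusion h
    | var j => exact AFml.noConfusion h
    | box B => exact AFml.noConfusion h
    | neg B => injection h with h; rw [ih h]
    | and B _ => exact AFml.noConfusion h
    | or B _ => exact AFml.noConfusion h
    | imp B _ => exact AFml.noConfusion h
  | and A A' ih ih' =>
    intro B h
    cases B with
    | bot => exact AFml.noConfusion h
    | var j => exact AFml.noConfusion h
    | box B => exact AFml.noConfusion h
    | neg B => exact AFml.noConfusion h
    | and B _ => injection h with h h'; rw [ih h, ih' h']
    | or B _ => exact AFml.noConfusion h
    | imp B _ => exact AFml.noConfusion h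
  | or A A' ih ih' =>
    intro B h
    cases B with
    | bot => exact AFml.noConfusion h
    | var j => exact AFml.noConfusion h
    | box B => exact AFml.noConfusion h
    | neg B => exact AFml.noConfusion h
    | or B _ => injection h with h h'; rw [ih h, ih' h']
    | and B _ => exact AFml.noConfusion h
    | imp B _ => exact AFml.noConfusion h
  | imp A A' ih ih' =>
    intro B h
    cases B with
    | bot => exact AFml.noConfusion h
    | var j => exact AFml.noConfusion h
    | box B => exact AFml.noConfusion h
    | neg B => exact AFml.noConfusion h
    | imp B _ => injection h with h h'; rw [ih h, ih' h']
    | or B _ => exact AFml.noConfusion h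
    | and B _ => exact AFml.noConfusion h

theorem ff_iter (k : ℕ) : ∀ {a : MFml} {φ : AFml}, ff d.P a = iterPred d.P (k + 1) φ →
    (∃ D, a = boxIter (k + 1) D ∧ ff d.P D = φ) ∨ ∃ i, φ = bt i := by
  induction k with
  | zero =>
    intro a φ h
    rcases d.ff_atP (k := φ.code) h with ⟨i, _, e⟩ | ⟨B, rfl, e⟩
    · exact Or.inr ⟨i, AFml.code_inj e⟩
    · have e1 := AFml.code_inj e
      exact Or.inl ⟨B, rfl, e1.symm⟩
  | succ k ih =>
    intro a φ h
    rw [iterPred_succ] at h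
    rcases d.ff_atP h with ⟨i, _, e⟩ | ⟨B, rfl, e⟩
    · have e1 := AFml.code_inj e
      obtain ⟨ψ, h'⟩ := d.atP_shape (iterPred d.P k φ).code
      have e2 := iterPred_succ d.P k φ
      rw [e2, h'] at e1
      exact AFml.noConfusion e1
    · have e1 := AFml.code_inj e
      rcases ih e1.symm with ⟨D, h2, h3⟩ | h2
      · refine Or.inl ⟨D, ?_, h3⟩
        rw [h2]; rfl
      · exact Or.inr h2

theorem ff_eval {N : Type} {S : Str N} (hPA : Models S PA) (ρ : ℕ → N) {M : Set MFml} (hM : MCS m M)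
    (C : MFml) (hat : ∀ a k, IsSub a C → ff d.P a = atP d.P k → ((atP d.P k).Ms S ρ ↔ a ∈ M)) :
    ∀ A, IsSub A C → ((ff d.P A).Ms S ρ ↔ A ∈ M) := by
  intro A
  induction A with
  | var i => intro h; exact hat _ _ h rfl
  | box A _ => intro h; exact hat _ _ h rfl
  | bot => intro _; exact iff_of_false (bot_Ms hPA ρ) hM.bot
  | neg A ih => 
    intro h
    rw [hM.neg, ← ih ((IsSub.refl A).neg.trans h)]; exact Iff.rfl
  | and A B ih1 ih2 =>
    intro h
    rw [hM.and, ← ih1 ((IsSub.refl A).andL.trans h), ← ih2 ((IsSub.refl B).andR.trans h)]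
    exact Iff.rfl
  | or A B ih1 ih2 =>
    intro h
    rw [hM.or, ← ih1 ((IsSub.refl A).orL.trans h), ← ih2 ((IsSub.refl B).orR.trans h)]
    exact Iff.rfl
  | imp A B ih1 ih2 =>
    intro h
    rw [hM.imp, ← ih1 ((IsSub.refl A).impL.trans h), ← ih2 ((IsSub.refl B).impR.trans h)]
    exact Iff.rfl

theorem ff_can {c n : ℕ} {M : Set MFml} (hM : MCS m M)
    (C : MFml) (hat : ∀ a k, IsSub a C → k < n → ff d.P a = atP d.P k → (InC k c ↔ a ∉ M)) :
    ∀ A, IsSub A C → (ff d.P A).code ≤ n →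
      (can (Atm d.P c n) true (ff d.P A) → A ∈ M) ∧ (can (Atm d.P c n) false (ff d.P A) → A ∉ M) := by
  have hatom : ∀ a k, IsSub a C → (ff d.P a).code ≤ n → ff d.P a = atP d.P k → ∀ b,
      Atm d.P c n b (atP d.P k) → (a ∉ M ↔ b = false) := by
    intro a k h hn e b hb
    have hk : k < n := by
      have := d.le_atP k
      rw [← e] at this; omega
    rcases hb with hb | hb
    · exact absurd hb.2 (d.atP_ne_bot k)
    · rw [← hat a k h hk e]
      exact hb.2 k hk rfl
  intro A
  induction A with
  | var i =>
    intro h hn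
    refine ⟨fun hc => ?_, fun hc => ?_⟩
    · have := hatom _ _ h hn rfl true hc
      simpa using this
    · have := hatom _ _ h hn rfl false hc
      simpa using this
  | box A _ =>
    intro h hn
    refine ⟨fun hc => ?_, fun hc => ?_⟩
    · have := hatom _ _ h hn rfl true hc
      simpa using this
    · have := hatom _ _ h hn rfl false hc
      simpa using this
  | bot =>
    intro _ _
    refine ⟨fun hc => ?_, fun _ => hM.bot⟩
    rcases hc with hc | hc
    · exact absurd hc.1 (by decide)
    · exact absurd rfl hc.1
  | neg A ih =>
    intro h hn
    have := ih ((IsSub.refl A).neg.trans h) ((code_neg _).le.trans hn)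
    rw [hM.neg]
    exact ⟨fun h => this.2 h, fun h h' => h' (this.1 h)⟩
  | and A B ih1 ih2 =>
    intro h hn
    have h1 := ih1 ((IsSub.refl A).andL.trans h) ((code_bin 3 _ _ (by decide)).1.le.trans hn)
    have h2 := ih2 ((IsSub.refl B).andR.trans h) ((code_bin 3 _ _ (by decide)).2.le.trans hn)
    rw [hM.and]
    exact ⟨fun h => ⟨h1.1 h.1, h2.1 h.2⟩,
      fun h h' => Or.elim h (fun h => h1.2 h h'.1) (fun h => h2.2 h h'.2)⟩
  | or A B ih1 ih2 =>
    intro h hn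
    have h1 := ih1 ((IsSub.refl A).orL.trans h) ((code_bin 4 _ _ (by decide)).1.le.trans hn)
    have h2 := ih2 ((IsSub.refl B).orR.trans h) ((code_bin 4 _ _ (by decide)).2.le.trans hn)
    rw [hM.or]
    exact ⟨fun h => Or.elim h (fun h => Or.inl (h1.1 h)) (fun h => Or.inr (h2.1 h)),
      fun h h' => Or.elim h' (h1.2 h.1) (h2.2 h.2)⟩
  | imp A B ih1 ih2 =>
    intro h hn
    have h1 := ih1 ((IsSub.refl A).impL.trans h) ((code_bin 5 _ _ (by decide)).1.le.trans hn)
    have h2 := ih2 ((IsSub.refl B).impR.trans h) ((code_bin 5 _ _ (by decide)).2.le.trans hn)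
    rw [hM.imp]
    exact ⟨fun h h' => Or.elim h (fun h => absurd h' (h1.2 h)) (fun h => h2.1 h),
      fun h h' => h2.2 h.2 (h' (h1.1 h.1))⟩

theorem complete (hext : PA ⊆ Tax) (hcons : ¬ Proves Tax botFml) (hm : 1 ≤ m) :
    ∀ (n : ℕ) (C : MFml), (ff d.P C).code = n → Proves Tax (ff d.P C) → NAProves m 0 C := by
  intro n
  induction n using Nat.strong_induction_on with
  | _ n ih =>
  intro C hn hpC
  by_contra hC
  obtain ⟨M, hM, hCM⟩ := exists_MCS hC
  -- the set of false boxes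
  obtain ⟨E, hE⟩ : ∃ E : ℕ → Prop, ∀ x, E x ↔ ∃ a, IsSub a C ∧ a ∉ M ∧ ff d.P a = atP d.P x :=
    ⟨_, fun _ => Iff.rfl⟩
  have hEn : ∀ a k, IsSub a C → ff d.P a = atP d.P k → k < n := by
    intro a k h e
    have h1 := d.le_atP k
    have h2 := d.ff_sub h
    rw [e] at h2; omega
  have hEa : ∀ a k, IsSub a C → ff d.P a = atP d.P k → (E k ↔ a ∉ M) := by
    intro a k h e
    rw [hE]
    constructor
    · rintro ⟨a', _, h2, e'⟩
      rw [d.ff_inj (e.trans e'.symm)]; exact h2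
    · intro h'; exact ⟨a, h, h', e⟩
  obtain ⟨c, hc⟩ := exists_InC E n
  -- the chain is provable
  have hch : Proves Tax (chain (selfP d.th) c n) := by
    refine completeness fun N S hN ρ => chain_intro _ _ _ fun hl => ?_
    have hPA := hN.mono hext
    refine absurd ((d.ff_eval hPA ρ hM C ?_ C (.refl _)).1 (soundness hN hpC ρ)) hCM
    intro a k ha e
    have hk := hEn a k ha e
    have h1 := hl k hk
    change (lit d.P c k).Ms S ρ at h1
    unfold lit at h1
    have h2 : InC k c ↔ a ∉ M := (hc k hk).trans (hEa a k ha e)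
    by_cases h : InC k c
    · rw [if_pos h] at h1
      exact iff_of_false h1 (h2.1 h)
    · rw [if_neg h] at h1
      exact iff_of_true h1 (by_contra fun h' => h (h2.2 h'))
  obtain ⟨t, ht⟩ := d.w2 _ _ _ ((WW_iff d.th c n).2 hch)
  obtain ⟨y, hy⟩ : ∃ y, y = Nat.pair c (Nat.pair n t) := ⟨_, rfl⟩
  have hmem : ∀ x, Mem x y ↔ E x := by
    intro x
    unfold Mem
    simp only [hy, Nat.unpair_pair]
    constructor
    · rintro ⟨h1, h2⟩; exact (hc x h1).1 h2
    · intro h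
      obtain ⟨a, h1, h2, h3⟩ := (hE x).1 h
      have := hEn a x h1 h3
      exact ⟨this, (hc x this).2 h⟩
  have hEv : d.EvW natStr y := by
    rw [EvW_iff]
    refine ⟨?_, ?_, ?_⟩
    · rw [natStr_num]; exact ht y hy
    · intro x _ hx z _ hz
      rw [d.me1, hmem, hE] at hx
      obtain ⟨a, h1, h2, h3⟩ := hx
      obtain ⟨ψ, rfl, hψ⟩ := (d.pf1 x).2 ⟨z, hz⟩
      have hlt := hEn a _ h1 h3
      rcases d.ff_atP h3 with ⟨i, rfl, e⟩ | ⟨B, rfl, e⟩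
      · rw [AFml.code_inj e] at hψ
        refine hcons (Proves.mp (.taut fun v => ?_) hψ)
        intro h; exact h.1
      · rw [AFml.code_inj e] at hψ hlt
        exact h2 (hM.log _ (.nec (ih _ hlt B rfl hψ)))
    · intro r _ n' _ z _ hb
      rw [natStr_num] at hb
      have hb := (Bad_iff m d.th r n').1 ((d.b1 _ _ _).2 ⟨z, hb⟩)
      by_contra hcon
      have hr : ∀ j < n', InC j r ↔ E j := by
        intro j hj
        by_contra h
        refine hcon ⟨j, hj.le, hj, ?_⟩
        rw [d.inn1, d.me1, hmem]; exact h
      obtain ⟨φ, h1, h2, h3⟩ := hb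
      change (iterPred d.P (m - 1) φ).code < n' at h1
      change InC (iterPred d.P (m - 1) φ).code r at h2
      change can (Atm d.P r n') true φ at h3
      rw [hr _ h1, hE] at h2
      obtain ⟨a, h4, h5, h6⟩ := h2
      have hle := iterPred_le d.le_atP (m - 1) φ
      rcases d.ff_iter (m - 1) (a := a) (φ := φ) h6 with ⟨D, rfl, rfl⟩ | ⟨i, rfl⟩
      · rw [Nat.sub_add_cancel hm] at h4 h5
        have hDC := (boxIter_sub m D).trans h4
        have := (d.ff_can hM C (fun a k ha hk e => (hr k hk).trans (hEa a k ha e)) D hDC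
          (hle.trans h1.le)).1 h3
        exact h5 ((hM.imp _ _).1 (hM.log _ (.acc D)) this)
      · rcases h3.1 with h | h
        · exact absurd h.1 (by decide)
        · exact h.1 rfl
  exact d.no_event hext hcons y ((d.Ev_iff _ _).2 (Or.inr hEv))

end Dat

theorem no_neg_box {m n : ℕ} (hm : 1 ≤ m) {A : MFml} (h : NAProves m n A) :
    A.evalTC (fun _ => True) := by
  obtain ⟨k, rfl⟩ : ∃ k, m = k + 1 := ⟨m - 1, by omega⟩
  induction h with
  | taut h => exact h _
  | acc A => exact fun _ => trivial
  | mp _ _ ih1 ih2 => exact ih1 ih2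
  | nec _ _ => trivial
  | ros _ ih => exact absurd trivial ih

theorem evalTC_interp {P : AFml} {f : MFml → AFml} (hf : IsInterp P f) (v : AFml → Prop) (A : MFml) :
    ¬ (botFml.evalProp v) → ((f A).evalProp v ↔ A.evalTC fun B => (f B).evalProp v) := by
  obtain ⟨_, hb, hn, ha, ho, hi, _⟩ := hf
  intro hbv
  induction A with
  | var i => exact Iff.rfl
  | box A _ => exact Iff.rfl
  | bot => rw [hb]; exact iff_of_false hbv id
  | neg A ih => rw [hn]; exact not_congr ih
  | and A B ih1 ih2 => rw [ha]; exact and_congr ih1 ih2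
  | or A B ih1 ih2 => rw [ho]; exact or_congr ih1 ih2
  | imp A B ih1 ih2 => rw [hi]; exact imp_congr ih1 ih2

theorem interp_iter {P : AFml} {f : MFml → AFml} (hf : IsInterp P f) (k : ℕ) (A : MFml) :
    f (boxIter k A) = iterPred P k (f A) := by
  induction k with
  | zero => rfl
  | succ k ih => rw [boxIter, hf.2.2.2.2.2.2, ih, iterPred]

theorem neg_bot {Tax : Set AFml} (hext : PA ⊆ Tax) : Proves Tax (.neg botFml) :=
  completeness fun _ _ hM ρ => bot_Ms (hM.mono hext) ρ

theorem sound {Tax : Set AFml} {m : ℕ} (d : Dat Tax m) (hext : PA ⊆ Tax)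
    (hcons : ¬ Proves Tax botFml) (hm : 1 ≤ m) {A : MFml} (h : NAProves m 0 A) {f : MFml → AFml}
    (hf : IsInterp d.P f) : Proves Tax (f A) := by
  induction h with
  | @taut A h =>
    refine Proves.mp (.taut ?_) (neg_bot hext)
    intro v hb
    exact (evalTC_interp hf v A hb).2 (h _)
  | acc A =>
    rw [hf.2.2.2.2.2.1, interp_iter hf m, interp_iter hf 0]
    exact d.acc hext hcons hm (f A)
  | mp _ _ ih1 ih2 =>
    rw [hf.2.2.2.2.2.1] at ih1
    exact .mp ih1 ih2
  | @nec A _ ih =>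
    rw [hf.2.2.2.2.2.2]
    have h1 := ((d.provPred hext hcons).2 (f A)).1 ih
    exact completeness fun M S hM ρ => soundness (hM.mono hext) h1 ρ
  | ros h _ => exact absurd trivial (no_neg_box hm h)

theorem ff_interp (P : AFml) (hP : P.FreeLt 1) : IsInterp P (ff P) := by
  refine ⟨fun i => ?_, rfl, fun _ => rfl, fun _ _ => rfl, fun _ _ => rfl, fun _ _ => rfl, fun _ => rfl⟩
  refine AFml.FreeLt.subst P ?_ hP
  intro n hn
  obtain rfl : n = 0 := by omega
  exact numeral_freeLt (bt i).code 0

theorem main {Tax : Set AFml} (hext : PA ⊆ Tax)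
    (hcons : ¬ Proves Tax botFml) (hpr : PrAxiomatized Tax)
    (hill : ¬ Sigma1Sound Tax) (m : ℕ) (hm : 1 ≤ m) :
    ∃ P : AFml, IsSigma1 P ∧ IsProvPred Tax P ∧
      PL Tax P = {A : MFml | NAProves m 0 A} := by
  obtain ⟨d⟩ := exists_Dat hext hpr hill m
  refine ⟨d.P, d.P_sigma1, d.provPred hext hcons, ?_⟩
  ext A
  constructor
  · intro h
    exact d.complete hext hcons hm _ A rfl (h _ (ff_interp d.P d.P_freeLt))
  · intro h f hf
    exact sound d hext hcons hm h hf

/-- Suppose `T` is `Σ₁`-ill and `m ≥ 1`. Then there exists a `Σ₁` provability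
predicate `PR_T(x)` of `T` such that `PL(PR_T) = N⁺A_{m,0}`. -/
theorem statement_1 (Tax : Set AFml) (hext : PA ⊆ Tax)
    (hcons : ¬ Proves Tax botFml) (hpr : PrAxiomatized Tax)
    (hill : ¬ Sigma1Sound Tax)
    (m : ℕ) (hm : 1 ≤ m) :
    ∃ P : AFml, IsSigma1 P ∧ IsProvPred Tax P ∧
      PL Tax P = {A : MFml | NAProves m 0 A} := by
  exact main hext hcons hpr hill m hm

end PLN
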